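/- arXiv:2311.13891 — 6 statements merged into one kernel-verified Lean document; each statement's English description precedes it below -/
import Mathlib

section
/- Let A be a nonempty compact subset of ℝ with min(A) = 0, and write d = diam(A) = max(A) and A_x = A ∩ [0, x] for x ∈ ℝ. Assume A is additively left-stable, i.e. (A + A) ∩ [0, d] = A. Then for every x ∈ A and every integer k ≥ 2 such that λ(A ∩ [(k−1)x, d]) < λ([(k−1)x, d]) (where λ([(k−1)x,d]) = d − (k−1)x when (k−1)x ≤ d and 0 otherwise), one has: if kx > d then λ(A_x) ≤ (2/(k+1))·(x − (d − λ(A))/k), and if kx ≤ d then λ(A_x) ≤ (2/(k(k+1)))·λ(A_{kx}). -/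
open MeasureTheory Pointwise Set

/-- The indices of the cells of the subdivision of `[0, p * h]` into `p` equal intervals
that meet `S`. -/
noncomputable def meetingCells (p : ℕ) [NeZero p] (h : ℝ) (S : Set ℝ) : Finset (ZMod p) :=
  open Classical in
  Finset.univ.filter fun i => (S ∩ Icc ((i.val : ℝ) * h) (((i.val : ℝ) + 1) * h)).Nonempty

theorem mem_meetingCells {p : ℕ} [NeZero p] {h : ℝ} {S : Set ℝ} {i : ZMod p} :
    i ∈ meetingCells p h S ↔
      ∃ s ∈ S, (i.val : ℝ) * h ≤ s ∧ s ≤ ((i.val : ℝ) + 1) * h := by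
  classical
  exact Finset.mem_filter.trans (and_iff_right (Finset.mem_univ i))

theorem exists_mem_cell {p : ℕ} [NeZero p] {h : ℝ} (hh : 0 < h) {s : ℝ}
    (hs : s ∈ Icc 0 ((p : ℝ) * h)) :
    ∃ i : ZMod p, (i.val : ℝ) * h ≤ s ∧ s ≤ ((i.val : ℝ) + 1) * h := by
  have hp : 0 < p := NeZero.pos p
  rcases hs.2.lt_or_eq with hlt | rfl
  · have h0 : 0 ≤ s / h := div_nonneg hs.1 hh.le
    have hfl : ⌊s / h⌋₊ < p := (Nat.floor_lt h0).2 ((div_lt_iff₀ hh).2 hlt)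
    refine ⟨(⌊s / h⌋₊ : ZMod p), ?_⟩
    rw [ZMod.val_natCast_of_lt hfl]
    exact ⟨(le_div_iff₀ hh).1 (Nat.floor_le h0), ((div_lt_iff₀ hh).1 (Nat.lt_floor_add_one _)).le⟩
  · refine ⟨((p - 1 : ℕ) : ZMod p), ?_⟩
    rw [ZMod.val_natCast_of_lt (Nat.sub_lt hp one_pos), Nat.cast_pred hp]
    constructor <;> nlinarith

theorem meetingCells_nonempty {p : ℕ} [NeZero p] {h : ℝ} (hh : 0 < h) {S : Set ℝ}
    (hS : S ⊆ Icc 0 ((p : ℝ) * h)) (hne : S.Nonempty) : (meetingCells p h S).Nonempty := by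
  obtain ⟨s, hs⟩ := hne
  obtain ⟨i, hi⟩ := exists_mem_cell hh (hS hs)
  exact ⟨i, mem_meetingCells.2 ⟨s, hs, hi⟩⟩

theorem volume_le_card_meetingCells {p : ℕ} [NeZero p] {h : ℝ} (hh : 0 < h) {S : Set ℝ}
    (hS : S ⊆ Icc 0 ((p : ℝ) * h)) :
    volume.real S ≤ (meetingCells p h S).card * h := by
  have hsub : S ⊆ ⋃ i ∈ meetingCells p h S, Icc ((i.val : ℝ) * h) (((i.val : ℝ) + 1) * h) := by
    intro s hs
    obtain ⟨i, hi⟩ := exists_mem_cell hh (hS hs)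
    exact mem_biUnion (mem_meetingCells.2 ⟨s, hs, hi⟩) hi
  have h1 : volume S ≤ ((meetingCells p h S).card : ENNReal) * ENNReal.ofReal h := by
    calc volume S ≤ _ := measure_mono hsub
      _ ≤ _ := measure_biUnion_finset_le _ _
      _ = _ := by
        simp only [Real.volume_Icc, add_mul, one_mul, add_sub_cancel_left, Finset.sum_const,
          nsmul_eq_mul]
  have h2 := ENNReal.toReal_mono
    (ENNReal.mul_ne_top (ENNReal.natCast_ne_top _) ENNReal.ofReal_ne_top) h1
  simpa [Measure.real, ENNReal.toReal_mul, hh.le] using h2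

theorem card_mul_le_volume {p : ℕ} [NeZero p] {h : ℝ} (hh : 0 < h) {T : Set ℝ}
    (hT : volume T ≠ ⊤) (M : Finset (ZMod p))
    (hM : ∀ m ∈ M, Ico ((m.val : ℝ) * h) (((m.val : ℝ) + 1) * h) ⊆ T) :
    M.card * h ≤ volume.real T := by
  have hdisj : (M : Set (ZMod p)).PairwiseDisjoint
      fun m : ZMod p => Ico ((m.val : ℝ) * h) (((m.val : ℝ) + 1) * h) := by
    have key : ∀ a b : ZMod p, ∀ y : ℝ, (a.val : ℝ) * h ≤ y → y < ((b.val : ℝ) + 1) * h →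
        a.val ≤ b.val := by
      intro a b y h1 h2
      have h3 : (a.val : ℝ) < (b.val : ℝ) + 1 := lt_of_mul_lt_mul_right (h1.trans_lt h2) hh.le
      exact_mod_cast Nat.lt_succ_iff.1 (by exact_mod_cast h3)
    intro a _ b _ hab
    refine Set.disjoint_left.2 fun y hya hyb => hab ?_
    exact ZMod.val_injective p
      (le_antisymm (key a b y hya.1 hyb.2) (key b a y hyb.1 hya.2))
  have h1 : (M.card : ENNReal) * ENNReal.ofReal h ≤ volume T := by
    calc (M.card : ENNReal) * ENNReal.ofReal h
        = ∑ m ∈ M, volume (Ico ((m.val : ℝ) * h) (((m.val : ℝ) + 1) * h)) := by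
          simp only [Real.volume_Ico, add_mul, one_mul, add_sub_cancel_left, Finset.sum_const,
            nsmul_eq_mul]
      _ = volume (⋃ m ∈ M, Ico ((m.val : ℝ) * h) (((m.val : ℝ) + 1) * h)) :=
          (measure_biUnion_finset hdisj fun _ _ => measurableSet_Ico).symm
      _ ≤ volume T := measure_mono (iUnion₂_subset hM)
  have h2 := ENNReal.toReal_mono hT h1
  simpa [Measure.real, ENNReal.toReal_mul, hh.le] using h2

theorem min_sub_le_volume_cthickening {p : ℕ} (hp : p.Prime) {h : ℝ} (hh : 0 < h)
    {C D E : Set ℝ} (hC : C ⊆ Icc 0 ((p : ℝ) * h)) (hD : D ⊆ Icc 0 ((p : ℝ) * h))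
    (hE : IsCompact E) (hCne : C.Nonempty) (hDne : D.Nonempty)
    (hlow : ∀ c ∈ C, ∀ e ∈ D, c + e ≤ p * h → c + e ∈ E)
    (hhigh : ∀ c ∈ C, ∀ e ∈ D, p * h ≤ c + e → c + e - p * h ∈ E) :
    min ((p : ℝ) * h) (volume.real C + volume.real D - h) - h ≤
      volume.real (Metric.cthickening (2 * h) E) := by
  classical
  have : NeZero p := ⟨hp.ne_zero⟩
  set M := (meetingCells p h C + meetingCells p h D).erase ((p - 1 : ℕ) : ZMod p) with hM
  have hcd := ZMod.cauchy_davenport hp (meetingCells_nonempty hh hC hCne)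
    (meetingCells_nonempty hh hD hDne)
  have hcard := Finset.pred_card_le_card_erase
    (s := meetingCells p h C + meetingCells p h D) (a := ((p - 1 : ℕ) : ZMod p))
  rw [← hM] at hcard
  have hcells : ∀ m ∈ M, Ico ((m.val : ℝ) * h) (((m.val : ℝ) + 1) * h) ⊆
      Metric.cthickening (2 * h) E := by
    intro m hm y hy
    rw [hM, Finset.mem_erase] at hm
    obtain ⟨hmne, hm⟩ := hm
    obtain ⟨i, hi, j, hj, rfl⟩ := Finset.mem_add.1 hm
    obtain ⟨c, hc, hc1, hc2⟩ := mem_meetingCells.1 hi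
    obtain ⟨e, he, he1, he2⟩ := mem_meetingCells.1 hj
    rcases lt_or_ge (i.val + j.val) p with hlt | hge
    · have hval : (i + j).val = i.val + j.val := ZMod.val_add_of_lt hlt
      have hne : i.val + j.val ≠ p - 1 := by
        intro heq
        apply hmne
        apply ZMod.val_injective p
        rw [hval, ZMod.val_natCast_of_lt (Nat.sub_lt hp.pos one_pos), heq]
      have hle : ((i.val : ℝ) + j.val + 2) ≤ p := by
        have : i.val + j.val + 2 ≤ p := by omega
        exact_mod_cast this
      rw [hval] at hy
      push_cast at hy
      refine Metric.mem_cthickening_of_dist_le y (c + e) _ _ (hlow c hc e he ?_) ?_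
      · nlinarith
      · rw [Real.dist_eq, abs_le]
        constructor <;> nlinarith [hy.1, hy.2]
    · have hval : (i + j).val + p = i.val + j.val := ZMod.val_add_val_of_le hge |>.symm
      have hval' : ((i + j).val : ℝ) = i.val + j.val - p := by
        rw [eq_sub_iff_add_eq]
        exact_mod_cast hval
      have hge' : (p : ℝ) ≤ i.val + j.val := by exact_mod_cast hge
      rw [hval'] at hy
      refine Metric.mem_cthickening_of_dist_le y (c + e - p * h) _ _ (hhigh c hc e he ?_) ?_
      · nlinarith
      · rw [Real.dist_eq, abs_le]
        constructor <;> nlinarith [hy.1, hy.2]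
  have hvol := card_mul_le_volume hh hE.cthickening.measure_lt_top.ne M hcells
  have hvC := volume_le_card_meetingCells hh hC
  have hvD := volume_le_card_meetingCells hh hD
  refine le_trans ?_ hvol
  rcases min_le_iff.1 hcd with h1 | h1
  · have h2 : (p : ℝ) ≤ M.card + 1 := by
      have : p ≤ M.card + 1 := by omega
      exact_mod_cast this
    have := min_le_left ((p : ℝ) * h) (volume.real C + volume.real D - h)
    nlinarith
  · have h2 : ((meetingCells p h C).card : ℝ) + (meetingCells p h D).card ≤ M.card + 2 := by
      have : (meetingCells p h C).card + (meetingCells p h D).card ≤ M.card + 2 := by omega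
      exact_mod_cast this
    have := min_le_right ((p : ℝ) * h) (volume.real C + volume.real D - h)
    nlinarith

/-- Raikov's inequality on the circle `ℝ / xℤ`, phrased with representatives in `[0, x]`. -/
theorem min_le_volume_of_add_mod_mem {x : ℝ} (hx : 0 < x) {C D E : Set ℝ}
    (hC : C ⊆ Icc 0 x) (hD : D ⊆ Icc 0 x) (hE : IsCompact E)
    (hCne : C.Nonempty) (hDne : D.Nonempty)
    (hlow : ∀ c ∈ C, ∀ e ∈ D, c + e ≤ x → c + e ∈ E)
    (hhigh : ∀ c ∈ C, ∀ e ∈ D, x ≤ c + e → c + e - x ∈ E) :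
    min x (volume.real C + volume.real D) ≤ volume.real E := by
  choose p hpn hp using fun n : ℕ => Nat.exists_infinite_primes n
  have hptop : Filter.Tendsto (fun n => (p n : ℝ)) Filter.atTop Filter.atTop :=
    tendsto_natCast_atTop_atTop.comp (Filter.tendsto_atTop_mono hpn Filter.tendsto_id)
  have hh : Filter.Tendsto (fun n => x / (p n : ℝ)) Filter.atTop (nhds 0) :=
    hptop.const_div_atTop x
  have hbound : ∀ n, min x (volume.real C + volume.real D - x / p n) - x / p n ≤
      volume.real (Metric.cthickening (2 * (x / p n)) E) := by
    intro n
    have hp0 : (0 : ℝ) < p n := by exact_mod_cast (hp n).pos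
    have hmul : (p n : ℝ) * (x / p n) = x := by field_simp
    have := min_sub_le_volume_cthickening (hp n) (div_pos hx hp0) (C := C) (D := D) (E := E)
      (by rwa [hmul]) (by rwa [hmul]) hE hCne hDne (by rwa [hmul]) (by rwa [hmul])
    rwa [hmul] at this
  have hleft : Filter.Tendsto
      (fun n => min x (volume.real C + volume.real D - x / p n) - x / p n) Filter.atTop
      (nhds (min x (volume.real C + volume.real D))) := by
    have := (tendsto_const_nhds (x := x)).min
      ((tendsto_const_nhds (x := volume.real C + volume.real D)).sub hh) |>.sub hh
    simpa using this
  have hright : Filter.Tendsto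
      (fun n => volume.real (Metric.cthickening (2 * (x / p n)) E)) Filter.atTop
      (nhds (volume.real E)) := by
    have h2 : Filter.Tendsto (fun n => 2 * (x / (p n : ℝ))) Filter.atTop (nhds 0) := by
      simpa using hh.const_mul 2
    exact (ENNReal.tendsto_toReal hE.measure_lt_top.ne).comp
      ((tendsto_measure_cthickening_of_isCompact hE).comp h2)
  exact le_of_tendsto_of_tendsto' hleft hright hbound

theorem Icc_subset_of_isClosed_of_volume_le {S : Set ℝ} (hS : IsClosed S) {a b : ℝ} (hab : a < b)
    (hvol : b - a ≤ volume.real (S ∩ Icc a b)) : Icc a b ⊆ S := by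
  have hle : volume (Icc a b) ≤ volume (S ∩ Icc a b) := by
    rw [Real.volume_Icc]
    exact ENNReal.ofReal_le_of_le_toReal hvol
  have hfin : volume (S ∩ Icc a b) ≠ ⊤ :=
    ((measure_mono inter_subset_right).trans_lt measure_Icc_lt_top).ne
  have hdiff : volume (Icc a b \ (S ∩ Icc a b)) = 0 := by
    rw [measure_sdiff inter_subset_right
      (hS.measurableSet.inter measurableSet_Icc).nullMeasurableSet hfin]
    exact tsub_eq_zero_of_le hle
  have hopen : IsOpen (Ioo a b \ S) := isOpen_Ioo.sdiff hS
  have hzero : volume (Ioo a b \ S) = 0 :=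
    measure_mono_null (t := Icc a b \ (S ∩ Icc a b))
      (fun y hy => ⟨Ioo_subset_Icc_self hy.1, fun h => hy.2 h.1⟩) hdiff
  have hempty := (hopen.measure_eq_zero_iff volume).1 hzero
  rw [← closure_Ioo hab.ne]
  exact closure_minimal (sdiff_eq_empty.1 hempty) hS

theorem natCast_mul_mem {B : Set ℝ} {x : ℝ} (hx : 0 < x) {k : ℕ} (h0 : 0 ∈ B) (hxB : x ∈ B)
    (hadd : ∀ a ∈ B, ∀ b ∈ B, a + b ≤ k * x → a + b ∈ B) :
    ∀ n : ℕ, n ≤ k → (n : ℝ) * x ∈ B := by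
  intro n
  induction n with
  | zero => intro _; simpa using h0
  | succ n ih =>
    intro hn
    have hn' : ((n : ℝ) + 1) ≤ k := by exact_mod_cast hn
    have := hadd _ (ih (by omega)) x hxB (by nlinarith)
    push_cast
    rwa [add_mul, one_mul]

theorem volume_inter_Ico_eq_sum {B : Set ℝ} (hB : MeasurableSet B) {x : ℝ} (hx : 0 < x) (n : ℕ) :
    volume.real (B ∩ Ico 0 ((n : ℝ) * x)) =
      ∑ j ∈ Finset.range n, volume.real ((fun y => y + (j : ℝ) * x) ⁻¹' B ∩ Icc 0 x) := by
  induction n with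
  | zero => simp
  | succ n ih =>
    have hn : 0 ≤ (n : ℝ) * x := by positivity
    have hsplit : B ∩ Ico 0 (((n + 1 : ℕ) : ℝ) * x) =
        (B ∩ Ico 0 ((n : ℝ) * x)) ∪ (B ∩ Ico ((n : ℝ) * x) (((n + 1 : ℕ) : ℝ) * x)) := by
      rw [← inter_union_distrib_left, Ico_union_Ico_eq_Ico hn]
      push_cast
      nlinarith
    have hfin : ∀ a b : ℝ, volume (B ∩ Ico a b) ≠ ⊤ := fun a b =>
      ((measure_mono inter_subset_right).trans_lt measure_Ico_lt_top).ne
    have hshift : (fun y => y + (n : ℝ) * x) ⁻¹' (B ∩ Ico ((n : ℝ) * x) (((n + 1 : ℕ) : ℝ) * x)) =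
        (fun y => y + (n : ℝ) * x) ⁻¹' B ∩ Ico 0 x := by
      ext y
      simp only [mem_preimage, mem_inter_iff, mem_Ico]
      push_cast
      constructor <;> rintro ⟨h1, h2, h3⟩ <;> exact ⟨h1, by linarith, by linarith⟩
    have hlast : volume.real (B ∩ Ico ((n : ℝ) * x) (((n + 1 : ℕ) : ℝ) * x)) =
        volume.real ((fun y => y + (n : ℝ) * x) ⁻¹' B ∩ Icc 0 x) := by
      rw [Measure.real, Measure.real, ← measure_preimage_add_right volume ((n : ℝ) * x), hshift]
      exact congrArg _ (measure_congr ((ae_eq_refl _).inter Ico_ae_eq_Icc))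
    rw [Finset.sum_range_succ, ← ih, ← hlast, hsplit]
    refine measureReal_union ?_ (hB.inter measurableSet_Ico) (hfin _ _) (hfin _ _)
    exact (Ico_disjoint_Ico_same).mono inter_subset_right inter_subset_right

/-- A compact set stable under the sums that stay in `[0, kx]`, containing `0` and `x` but not the
whole of `[(k - 1)x, kx]`, has small measure in `[0, x]`. -/
theorem volume_Icc_le_of_not_subset {B : Set ℝ} (hB : IsCompact B) {x : ℝ} (hx : 0 < x) {k : ℕ}
    (h0 : 0 ∈ B) (hxB : x ∈ B)
    (hadd : ∀ a ∈ B, ∀ b ∈ B, a + b ≤ k * x → a + b ∈ B)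
    (hnot : ¬ Icc (((k : ℝ) - 1) * x) (k * x) ⊆ B) :
    (k : ℝ) * (k + 1) / 2 * volume.real (B ∩ Icc 0 x) ≤ volume.real (B ∩ Icc 0 (k * x)) := by
  set S : ℕ → Set ℝ := fun j => (fun y => y + (j : ℝ) * x) ⁻¹' B ∩ Icc 0 x with hS
  have hmul := natCast_mul_mem hx h0 hxB hadd
  have hclosed : ∀ j : ℕ, IsClosed ((fun y => y + (j : ℝ) * x) ⁻¹' B) := fun j =>
    hB.isClosed.preimage (by fun_prop)
  have hlt : ∀ j : ℕ, j < k → volume.real (S j) < x := by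
    intro j hj
    by_contra hge
    have hsub := Icc_subset_of_isClosed_of_volume_le (hclosed j) hx
      (by simpa using not_lt.1 hge)
    refine hnot fun y hy => ?_
    have hcast : ((k - 1 - j : ℕ) : ℝ) = k - 1 - j := by
      rw [Nat.sub_sub, Nat.cast_sub (by omega)]
      push_cast
      ring
    have h1 : y - ((k : ℝ) - 1) * x + (j : ℝ) * x ∈ B :=
      hsub ⟨by linarith [hy.1], by linarith [hy.2]⟩
    have heq : y - ((k : ℝ) - 1) * x + (j : ℝ) * x + ((k - 1 - j : ℕ) : ℝ) * x = y := by
      rw [hcast]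
      ring
    have h2 := hadd _ h1 _ (hmul (k - 1 - j) (by omega)) (by rw [heq]; exact hy.2)
    rwa [heq] at h2
  have hne : ∀ j : ℕ, j < k → (S j).Nonempty := fun j hj =>
    ⟨0, by simpa using hmul j hj.le, by simp [hx.le]⟩
  have hzero : S 0 = B ∩ Icc 0 x := by simp [hS]
  have hgrow : ∀ j : ℕ, j < k → ((j : ℝ) + 1) * volume.real (S 0) ≤ volume.real (S j) := by
    intro j
    induction j with
    | zero => intro _; simp
    | succ j ih =>
      intro hj
      have hj' : ((j : ℝ) + 1 + 1) ≤ k := by exact_mod_cast hj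
      have hjx : ((j : ℝ) + 1 + 1) * x ≤ k * x := by gcongr
      have hmin := min_le_volume_of_add_mod_mem hx (C := S j) (D := S 0) (E := S (j + 1))
        inter_subset_right inter_subset_right (isCompact_Icc.inter_left (hclosed _))
        (hne _ (by omega)) (hne _ (by omega))
        (by
          rintro c ⟨hc, hc0, hcx⟩ e ⟨he, he0, hex⟩ hce
          simp only [mem_preimage, Nat.cast_zero, zero_mul, add_zero] at hc he
          refine ⟨?_, by linarith, hce⟩
          have h1 := hadd _ hc _ he (by linarith)
          have h2 := hadd _ h1 _ hxB (by linarith)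
          simp only [mem_preimage]
          convert h2 using 1
          push_cast
          ring)
        (by
          rintro c ⟨hc, hc0, hcx⟩ e ⟨he, he0, hex⟩ hce
          simp only [mem_preimage, Nat.cast_zero, zero_mul, add_zero] at hc he
          refine ⟨?_, by linarith, by linarith⟩
          have h1 := hadd _ hc _ he (by linarith)
          simp only [mem_preimage]
          convert h1 using 1
          push_cast
          ring)
      have hih := ih (by omega)
      have hltj := hlt (j + 1) hj
      push_cast
      rcases min_le_iff.1 hmin with h | h <;> linarith
  have hsum := volume_inter_Ico_eq_sum hB.measurableSet hx k
  have hIco : volume.real (B ∩ Icc 0 (k * x)) = volume.real (B ∩ Ico 0 (k * x)) :=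
    congrArg ENNReal.toReal (measure_congr ((ae_eq_refl B).inter Ico_ae_eq_Icc.symm))
  have hgauss : ∀ n : ℕ, ∑ j ∈ Finset.range n, ((j : ℝ) + 1) = (n : ℝ) * (n + 1) / 2 := by
    intro n
    induction n with
    | zero => simp
    | succ n ih => rw [Finset.sum_range_succ, ih]; push_cast; ring
  rw [hIco, hsum, ← hgauss, ← hzero, Finset.sum_mul]
  exact Finset.sum_le_sum fun j hj => hgrow j (Finset.mem_range.1 hj)

/-- Lemma 2.2 (Lemma `lem_stab`): bounds on the measure of an additively
left-stable compact set near its infimum. -/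
theorem leftStable_measure_bound (A : Set ℝ) (hA : IsCompact A) (hne : A.Nonempty)
    (hinf : sInf A = 0) (d : ℝ) (hd : d = sSup A)
    (hstab : (A + A) ∩ Icc 0 d = A) :
    ∀ x ∈ A, ∀ k : ℕ, 2 ≤ k →
      volume (A ∩ Icc (((k : ℝ) - 1) * x) d) < volume (Icc (((k : ℝ) - 1) * x) d) →
      (d < (k : ℝ) * x →
        (volume (A ∩ Icc 0 x)).toReal ≤
          2 / ((k : ℝ) + 1) * (x - (d - (volume A).toReal) / (k : ℝ))) ∧
      ((k : ℝ) * x ≤ d →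
        (volume (A ∩ Icc 0 x)).toReal ≤
          2 / ((k : ℝ) * ((k : ℝ) + 1)) * (volume (A ∩ Icc 0 ((k : ℝ) * x))).toReal) := by
  intro x hxA k hk hvol
  have h0A : (0 : ℝ) ∈ A := hinf ▸ hA.sInf_mem hne
  have hdA : d ∈ A := hd ▸ hA.sSup_mem hne
  have hAIcc : A ⊆ Icc 0 d := fun y hy => (hstab.symm ▸ hy : y ∈ (A + A) ∩ Icc 0 d).2
  have hadd : ∀ a ∈ A, ∀ b ∈ A, a + b ≤ d → a + b ∈ A := by
    intro a ha b hb hab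
    rw [← hstab]
    exact ⟨add_mem_add ha hb, add_nonneg (hAIcc ha).1 (hAIcc hb).1, hab⟩
  have hk2 : (2 : ℝ) ≤ k := by exact_mod_cast hk
  have hnsub : ¬ Icc (((k : ℝ) - 1) * x) d ⊆ A := fun h => by
    rw [inter_eq_right.2 h] at hvol
    exact lt_irrefl _ hvol
  have hlt : ((k : ℝ) - 1) * x < d := by
    by_contra hge
    have : volume (Icc (((k : ℝ) - 1) * x) d) = 0 := by
      rw [Real.volume_Icc, ENNReal.ofReal_eq_zero]
      linarith
    exact not_lt_zero (this ▸ hvol)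
  have hconv : ∀ a m : ℝ, (k : ℝ) * (k + 1) / 2 * a ≤ m → a ≤ 2 / ((k : ℝ) * (k + 1)) * m := by
    intro a m h
    have hpos : (0 : ℝ) < k * (k + 1) := by positivity
    rw [div_mul_eq_mul_div, le_div_iff₀ hpos]
    linarith
  constructor
  · intro hdk
    have hx : 0 < x := by
      have := (hAIcc h0A).2
      by_contra hx
      nlinarith
    have hsubset : A ∪ Icc d (k * x) ⊆ Icc 0 (k * x) :=
      union_subset (hAIcc.trans (Icc_subset_Icc_right hdk.le))
        (Icc_subset_Icc_left (hAIcc h0A).2)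
    have hmain := volume_Icc_le_of_not_subset (B := A ∪ Icc d (k * x)) (hA.union isCompact_Icc)
      hx (k := k) (Or.inl h0A) (Or.inl hxA)
      (by
        intro a ha b hb hab
        have ha0 := (hsubset ha).1
        have hb0 := (hsubset hb).1
        rcases le_or_gt d (a + b) with h | h
        · exact Or.inr ⟨h, hab⟩
        · rcases ha with ha | ha
          · rcases hb with hb | hb
            · exact Or.inl (hadd a ha b hb h.le)
            · linarith [hb.1]
          · linarith [ha.1])
      (by
        intro h
        refine hnsub fun y hy => ?_
        rcases h ⟨hy.1, hy.2.trans hdk.le⟩ with hyA | hyd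
        · exact hyA
        · rwa [le_antisymm hy.2 hyd.1])
    rw [inter_eq_left.2 hsubset] at hmain
    have hunion : volume.real (A ∪ Icc d (k * x)) ≤ volume.real A + (k * x - d) := by
      refine (measureReal_union_le _ _).trans_eq ?_
      rw [Real.volume_real_Icc_of_le hdk.le]
    have hmono : volume.real (A ∩ Icc 0 x) ≤ volume.real ((A ∪ Icc d (k * x)) ∩ Icc 0 x) :=
      measureReal_mono (inter_subset_inter_left _ subset_union_left)
        ((measure_mono inter_subset_right).trans_lt measure_Icc_lt_top).ne
    refine hmono.trans ((hconv _ _ (hmain.trans hunion)).trans_eq ?_)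
    simp only [Measure.real]
    field_simp
    ring
  · intro hkd
    rcases (hAIcc hxA).1.eq_or_lt with rfl | hx
    · have hnull : volume (A ∩ Icc 0 0) = 0 :=
        measure_mono_null inter_subset_right (by simp)
      rw [mul_zero, hnull]
      simp
    have hB : (A ∩ Icc 0 (k * x)) ∩ Icc 0 x = A ∩ Icc 0 x := by
      rw [inter_assoc, Icc_inter_Icc, max_self, min_eq_right (by nlinarith)]
    have hmain := volume_Icc_le_of_not_subset (B := A ∩ Icc 0 (k * x))
      (hA.inter_right isClosed_Icc) hx (k := k) ⟨h0A, le_rfl, by positivity⟩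
      ⟨hxA, hx.le, by nlinarith⟩
      (fun a ha b hb hab => ⟨hadd a ha.1 b hb.1 (hab.trans hkd),
        add_nonneg ha.2.1 hb.2.1, hab⟩)
      (by
        intro h
        have hshift : ∀ n : ℕ, ∀ y ∈ Icc (((k : ℝ) - 1) * x) d, y ≤ (k + n) * x → y ∈ A := by
          intro n
          induction n with
          | zero => exact fun y hy hyn => (h ⟨hy.1, by simpa using hyn⟩).1
          | succ n ih =>
            intro y hy hyn
            push_cast at hyn
            rcases le_or_gt y (k * x) with hyk | hyk
            · exact (h ⟨hy.1, hyk⟩).1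
            · have h1 := ih (y - x) ⟨by linarith, by linarith [hy.2]⟩ (by linarith)
              have h2 := hadd _ h1 x hxA (by linarith [hy.2])
              rwa [sub_add_cancel] at h2
        obtain ⟨n, hn⟩ := exists_nat_ge (d / x)
        rw [div_le_iff₀ hx] at hn
        exact hnsub fun y hy => hshift n y hy (by nlinarith [hy.2]))
    rw [hB, inter_assoc, inter_self] at hmain
    exact hconv _ _ hmain
end

section
/- Let A be a nonempty compact subset of ℝ with min(A) = 0, d = diam(A) = max(A), and assume (A + A) ∩ [0, d] = A and λ(A) = d/2 > 0. Then for all x ∈ [0, d], λ(A ∩ [0, x]) ≤ d·h(x/d), where h : [0,1] → ℝ is the continuous piecewise affine function defined by h(0) = 0 and, for every integer k ≥ 2 and every x ∈ (1/k, 1/(k−1)], h(x) = (1/(k+1))·(2x − 1/k). -/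
open MeasureTheory Pointwise Set

lemma isCompact_nsmul {B : Set ℝ} (hB : IsCompact B) (k : ℕ) : IsCompact (k • B) := by
  induction k with
  | zero => simp
  | succ k ih => rw [succ_nsmul]; exact ih.add hB

lemma card_add_card_image_intCast_le {p : ℕ} (hp : 0 < p) {S B : Finset ℤ} (h0 : 0 ∈ B)
    (hpB : (p : ℤ) ∈ B) :
    S.card + ((S + B).image (Int.cast : ℤ → ZMod p)).card ≤ (S + B).card := by
  have hS : S ⊆ S + B := fun s hs => by simpa using Finset.add_mem_add hs h0
  rw [← Finset.card_sdiff_add_card_eq_card hS, add_comm]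
  refine Nat.add_le_add_right (le_trans (Finset.card_le_card ?_)
    (Finset.card_image_le (f := (Int.cast : ℤ → ZMod p)))) _
  intro r hr
  obtain ⟨t, ht, rfl⟩ := Finset.mem_image.1 hr
  obtain ⟨u, hu, hmax⟩ := ((S + B).filter fun u : ℤ => (u : ZMod p) = t).exists_max_image id
    ⟨t, Finset.mem_filter.2 ⟨ht, rfl⟩⟩
  obtain ⟨huT, hut⟩ := Finset.mem_filter.1 hu
  refine Finset.mem_image.2 ⟨u, Finset.mem_sdiff.2 ⟨huT, fun huS => ?_⟩, hut⟩
  have := hmax (u + p) (Finset.mem_filter.2 ⟨Finset.add_mem_add huS hpB, by simp [hut]⟩)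
  simp only [id] at this
  omega

lemma min_le_card_nsmul {p : ℕ} (hp : p.Prime) {T : Finset (ZMod p)} {m : ℕ}
    (hm : m + 1 ≤ T.card) (n : ℕ) : min p (n * m + 1) ≤ (n • T).card := by
  have hT : T.Nonempty := Finset.card_pos.1 (by omega)
  induction n with
  | zero => simp
  | succ n ih =>
    rw [succ_nsmul]
    refine le_trans ?_ (ZMod.cauchy_davenport hp hT.nsmul hT)
    have : (n + 1) * m = n * m + m := by ring
    omega

lemma sum_min_le_card_nsmul {p : ℕ} (hp : p.Prime) {B : Finset ℤ} (h0 : 0 ∈ B)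
    (hpB : (p : ℤ) ∈ B) {m : ℕ} (hm : m + 1 ≤ (B.image (Int.cast : ℤ → ZMod p)).card) (k : ℕ) :
    ∑ j ∈ Finset.range k, min p ((j + 1) * m + 1) ≤ (k • B).card := by
  induction k with
  | zero => simp
  | succ k ih =>
    rw [Finset.sum_range_succ, succ_nsmul]
    refine le_trans (add_le_add ih ?_) (card_add_card_image_intCast_le hp.pos h0 hpB)
    rw [← succ_nsmul]
    have : ((k + 1) • B).image (Int.cast : ℤ → ZMod p)
        = (k + 1) • B.image (Int.cast : ℤ → ZMod p) :=
      Finset.image_nsmul (Int.castRingHom (ZMod p)) B (k + 1)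
    rw [this]
    exact min_le_card_nsmul hp hm _

lemma exists_mem_nsmul_near {δ : ℝ} {B : Set ℝ} {C : Finset ℤ}
    (hC : ∀ i ∈ C, ∃ b ∈ B, (i : ℝ) * δ ≤ b ∧ b ≤ i * δ + δ) (k : ℕ) :
    ∀ i ∈ k • C, ∃ b ∈ k • B, (i : ℝ) * δ ≤ b ∧ b ≤ i * δ + k * δ := by
  induction k with
  | zero => simp
  | succ k ih =>
    intro i hi
    rw [succ_nsmul] at hi ⊢
    obtain ⟨u, hu, v, hv, rfl⟩ := Finset.mem_add.1 hi
    obtain ⟨b, hb, h1, h2⟩ := ih u hu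
    obtain ⟨c, hc, h3, h4⟩ := hC v hv
    exact ⟨b + c, Set.add_mem_add hb hc, by push_cast; linarith, by push_cast; linarith⟩

lemma card_mul_le_measureReal_cthickening {δ ε : ℝ} (hδ : 0 < δ) (hδε : δ ≤ ε) {K : Set ℝ}
    (hK : IsCompact K) {C : Finset ℤ}
    (hC : ∀ i ∈ C, ∃ b ∈ K, (i : ℝ) * δ ≤ b ∧ b ≤ i * δ + ε) :
    C.card * δ ≤ volume.real (Metric.cthickening ε K) := by
  have hd : (C : Set ℤ).PairwiseDisjoint fun i : ℤ => Ico ((i : ℝ) * δ) (i * δ + δ) := by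
    intro i _ j _ hij
    refine Set.disjoint_left.2 fun y hi hj => hij ?_
    have h1 : (i : ℝ) < j + 1 := by
      by_contra! h
      nlinarith [hi.1, hj.2]
    have h2 : (j : ℝ) < i + 1 := by
      by_contra! h
      nlinarith [hj.1, hi.2]
    norm_cast at h1 h2
    omega
  have hvol : volume.real (⋃ i ∈ C, Ico ((i : ℝ) * δ) (i * δ + δ)) = C.card * δ := by
    rw [measureReal_biUnion_finset hd (fun i _ => measurableSet_Ico)
      (fun i _ => measure_Ico_lt_top.ne)]
    simp [Real.volume_real_Ico, hδ.le]
  rw [← hvol]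
  refine measureReal_mono ?_ hK.cthickening.measure_lt_top.ne
  refine Set.iUnion₂_subset fun i hi y hy => ?_
  obtain ⟨b, hb, h1, h2⟩ := hC i hi
  refine Metric.mem_cthickening_of_dist_le y b _ _ hb ?_
  rw [Real.dist_eq, abs_le]
  constructor <;> linarith [hy.1, hy.2]

lemma sum_min_le_measureReal_cthickening_nsmul {B : Set ℝ} (hB : IsCompact B) {x : ℝ}
    (hx : 0 < x) (h0 : 0 ∈ B) (hxB : x ∈ B) (hBx : B ⊆ Icc 0 x) {p : ℕ} (hp : p.Prime)
    {k : ℕ} (hk : 1 ≤ k) :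
    ∑ j ∈ Finset.range k, min x ((j + 1) * (volume.real B - x / p))
      ≤ volume.real (Metric.cthickening (k * (x / p)) (k • B)) := by
  classical
  have hp0 : (0 : ℝ) < p := by exact_mod_cast hp.pos
  obtain ⟨δ, hδ⟩ : ∃ δ, δ = x / p := ⟨_, rfl⟩
  rw [← hδ]
  have hδ0 : 0 < δ := by rw [hδ]; positivity
  have hpδ : p * δ = x := by rw [hδ]; field_simp
  obtain ⟨C, hCdef⟩ : ∃ C : Finset ℤ, C = (Finset.Icc (0 : ℤ) p).filter
      fun i : ℤ => ∃ b ∈ B, (i : ℝ) * δ ≤ b ∧ b ≤ i * δ + δ := ⟨_, rfl⟩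
  have hC : ∀ i ∈ C, ∃ b ∈ B, (i : ℝ) * δ ≤ b ∧ b ≤ i * δ + δ := fun i hi => by
    rw [hCdef] at hi
    exact (Finset.mem_filter.1 hi).2
  have h0C : 0 ∈ C := by
    rw [hCdef]
    exact Finset.mem_filter.2 ⟨by simp, 0, h0, by simp, by simpa using hδ0.le⟩
  have hpC : (p : ℤ) ∈ C := by
    rw [hCdef]
    exact Finset.mem_filter.2 ⟨by simp, x, hxB, by simp [hpδ], by simp [hpδ, hδ0.le]⟩
  obtain ⟨m, hm⟩ : ∃ m, m + 1 = (C.image (Int.cast : ℤ → ZMod p)).card :=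
    ⟨_, Nat.sub_add_cancel (Finset.card_pos.2 ⟨_, Finset.mem_image_of_mem _ h0C⟩)⟩
  have hBm : volume.real B ≤ (m + 1) * δ := by
    have hcard : (C.erase p).card ≤ m + 1 := by
      rw [hm]
      refine Finset.card_le_card_of_injOn (Int.cast : ℤ → ZMod p)
        (fun i hi => Finset.mem_image_of_mem _ (Finset.mem_of_mem_erase hi)) ?_
      intro i hi j hj hij
      have hlt : ∀ i ∈ C.erase (p : ℤ), 0 ≤ i ∧ i < p := fun i hi => by
        obtain ⟨h1, h2⟩ := Finset.mem_erase.1 hi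
        rw [hCdef, Finset.mem_filter, Finset.mem_Icc] at h2
        exact ⟨h2.1.1, lt_of_le_of_ne h2.1.2 h1⟩
      have := (ZMod.intCast_eq_intCast_iff i j p).1 hij
      rw [Int.ModEq, Int.emod_eq_of_lt (hlt i hi).1 (hlt i hi).2,
        Int.emod_eq_of_lt (hlt j hj).1 (hlt j hj).2] at this
      exact this
    have hcover : B ⊆ ⋃ i ∈ C.erase (p : ℤ), Icc ((i : ℝ) * δ) (i * δ + δ) := by
      intro b hb
      obtain ⟨hb0, hbx⟩ := hBx hb
      suffices ∃ i : ℤ, 0 ≤ i ∧ i < p ∧ (i : ℝ) * δ ≤ b ∧ b ≤ i * δ + δ by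
        obtain ⟨i, hi0, hip, h1, h2⟩ := this
        refine Set.mem_iUnion₂.2 ⟨i, Finset.mem_erase.2 ⟨hip.ne, ?_⟩, h1, h2⟩
        rw [hCdef]
        exact Finset.mem_filter.2 ⟨Finset.mem_Icc.2 ⟨hi0, hip.le⟩, b, hb, h1, h2⟩
      rcases eq_or_lt_of_le hbx with rfl | hlt
      · refine ⟨p - 1, by have := hp.pos; omega, by omega, ?_, ?_⟩ <;> push_cast <;> linarith
      · refine ⟨⌊b / δ⌋, Int.floor_nonneg.2 (by positivity), Int.floor_lt.2 ?_, ?_, ?_⟩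
        · rw [div_lt_iff₀ hδ0]; push_cast; linarith
        · rw [← le_div_iff₀ hδ0]; exact Int.floor_le _
        · have := (div_lt_iff₀ hδ0).1 (Int.lt_floor_add_one (b / δ))
          linarith
    calc volume.real B
        ≤ volume.real (⋃ i ∈ C.erase (p : ℤ), Icc ((i : ℝ) * δ) (i * δ + δ)) :=
          measureReal_mono hcover
            ((C.erase (p : ℤ)).isCompact_biUnion fun i _ => isCompact_Icc).measure_lt_top.ne
      _ ≤ ∑ i ∈ C.erase (p : ℤ), volume.real (Icc ((i : ℝ) * δ) (i * δ + δ)) :=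
          measureReal_biUnion_finset_le _ _
      _ = (C.erase (p : ℤ)).card * δ := by simp [Real.volume_real_Icc, hδ0.le]
      _ ≤ (m + 1) * δ := by
          gcongr
          exact_mod_cast hcard
  have hK := isCompact_nsmul hB k
  refine le_trans ?_ (card_mul_le_measureReal_cthickening hδ0
    (le_mul_of_one_le_left hδ0.le (by exact_mod_cast hk)) hK (exists_mem_nsmul_near hC k))
  have hsum : ((∑ j ∈ Finset.range k, min p ((j + 1) * m + 1) : ℕ) : ℝ) ≤ (k • C).card := by
    exact_mod_cast sum_min_le_card_nsmul hp h0C hpC hm.le k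
  refine le_trans ?_ (mul_le_mul_of_nonneg_right hsum hδ0.le)
  push_cast
  rw [Finset.sum_mul]
  refine Finset.sum_le_sum fun j _ => ?_
  rw [min_mul_of_nonneg _ _ hδ0.le, hpδ]
  refine min_le_min le_rfl ?_
  have : ((j : ℝ) + 1) * (volume.real B - δ) ≤ (j + 1) * (m * δ) := by
    gcongr
    linarith
  nlinarith

/-- A continuous form of Lev's theorem on the growth of iterated sumsets. -/
lemma sum_min_le_measureReal_nsmul {B : Set ℝ} (hB : IsCompact B) {x : ℝ}
    (hx : 0 < x) (h0 : 0 ∈ B) (hxB : x ∈ B) (hBx : B ⊆ Icc 0 x) (k : ℕ) :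
    ∑ j ∈ Finset.range k, min x ((j + 1) * volume.real B) ≤ volume.real (k • B) := by
  rcases Nat.eq_zero_or_pos k with rfl | hk
  · simp
  have hK := isCompact_nsmul hB k
  choose p hnp hp using Nat.exists_infinite_primes
  have hδ : Filter.Tendsto (fun n => x / (p n : ℝ)) Filter.atTop (nhds 0) :=
    Filter.Tendsto.const_div_atTop
      (tendsto_natCast_atTop_atTop.comp (Filter.tendsto_atTop_mono hnp Filter.tendsto_id)) x
  have hl : Filter.Tendsto
      (fun n => ∑ j ∈ Finset.range k, min x (((j : ℝ) + 1) * (volume.real B - x / p n)))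
      Filter.atTop (nhds (∑ j ∈ Finset.range k, min x (((j : ℝ) + 1) * volume.real B))) := by
    refine tendsto_finsetSum _ fun j _ => ?_
    have := (tendsto_const_nhds (x := x)).min
      ((hδ.const_sub (volume.real B)).const_mul ((j : ℝ) + 1))
    simpa using this
  have hr : Filter.Tendsto (fun n => volume.real (Metric.cthickening (k * (x / p n)) (k • B)))
      Filter.atTop (nhds (volume.real (k • B))) := by
    have h1 : Filter.Tendsto (fun n => (k : ℝ) * (x / p n)) Filter.atTop (nhds 0) := by
      simpa using hδ.const_mul (k : ℝ)
    exact (ENNReal.tendsto_toReal hK.measure_lt_top.ne).comp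
      ((tendsto_measure_cthickening_of_isCompact hK).comp h1)
  exact le_of_tendsto_of_tendsto' hl hr fun n =>
    sum_min_le_measureReal_cthickening_nsmul hB hx h0 hxB hBx (hp n) hk

lemma nsmul_inter_Icc_subset {A : Set ℝ} {d : ℝ} (h0 : 0 ∈ A) (hstab : (A + A) ∩ Icc 0 d = A)
    (k : ℕ) : k • A ⊆ Ici 0 ∧ (k • A) ∩ Icc 0 d ⊆ A := by
  have hA : ∀ a ∈ A, 0 ≤ a := fun a ha => by
    rw [← hstab] at ha
    exact ha.2.1
  induction k with
  | zero =>
    rw [zero_nsmul]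
    constructor
    · rintro _ rfl
      exact le_refl (0 : ℝ)
    · rintro _ ⟨rfl, -⟩
      exact h0
  | succ k ih =>
    rw [succ_nsmul]
    constructor
    · rintro _ ⟨u, hu, v, hv, rfl⟩
      exact add_nonneg (ih.1 hu) (hA v hv)
    · rintro _ ⟨⟨u, hu, v, hv, rfl⟩, huv⟩
      have hu0 : 0 ≤ u := ih.1 hu
      have hv0 := hA v hv
      have huA : u ∈ A := ih.2 ⟨hu, hu0, by linarith [huv.2]⟩
      rw [← hstab]
      exact ⟨Set.add_mem_add huA hv, huv⟩

lemma nsmul_subset_Iic {B : Set ℝ} {x : ℝ} (hB : B ⊆ Iic x) (k : ℕ) : k • B ⊆ Iic (k * x) := by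
  induction k with
  | zero => simp
  | succ k ih =>
    rw [succ_nsmul]
    rintro _ ⟨u, hu, v, hv, rfl⟩
    have h1 : u ≤ k * x := ih hu
    have h2 : v ≤ x := hB hv
    simp only [mem_Iic]
    push_cast
    linarith

lemma measureReal_inter_Icc_le_of_mem {A : Set ℝ} (hA : IsCompact A) {d : ℝ} (h0 : 0 ∈ A)
    (hstab : (A + A) ∩ Icc 0 d = A) (hmeas : volume.real A = d / 2) {x : ℝ} (hxA : x ∈ A)
    (hx : 0 < x) {k : ℕ} (hk : 2 ≤ k) (hkx : d ≤ k * x) (hkx' : (k - 1) * x ≤ d) :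
    k * (k + 1) * volume.real (A ∩ Icc 0 x) ≤ 2 * (k * x) - d := by
  obtain ⟨B, hBdef⟩ : ∃ B, B = A ∩ Icc 0 x := ⟨_, rfl⟩
  rw [← hBdef]
  have hlev := sum_min_le_measureReal_nsmul (B := B) (hBdef ▸ hA.inter_right isClosed_Icc) hx
    (hBdef ▸ ⟨h0, le_rfl, hx.le⟩) (hBdef ▸ ⟨hxA, hx.le, le_rfl⟩)
    (hBdef ▸ inter_subset_right) k
  obtain ⟨F, hF⟩ : ∃ F, F = volume.real B := ⟨_, rfl⟩
  rw [← hF] at hlev ⊢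
  have hupper : volume.real (k • B) ≤ k * x - d / 2 := by
    have hsub : k • B ⊆ A ∪ Icc d (k * x) := by
      intro y hy
      have hyA : y ∈ k • A := nsmul_subset_nsmul_left (hBdef ▸ inter_subset_left) hy
      have hy0 : 0 ≤ y := (nsmul_inter_Icc_subset h0 hstab k).1 hyA
      rcases le_total y d with h | h
      · exact Or.inl ((nsmul_inter_Icc_subset h0 hstab k).2 ⟨hyA, hy0, h⟩)
      · refine Or.inr ⟨h, nsmul_subset_Iic (B := B) (fun b hb => ?_) k hy⟩
        rw [hBdef] at hb
        exact hb.2.2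
    calc volume.real (k • B) ≤ volume.real (A ∪ Icc d (k * x)) :=
          measureReal_mono hsub (hA.union isCompact_Icc).measure_lt_top.ne
      _ ≤ volume.real A + volume.real (Icc d (k * x)) := measureReal_union_le _ _
      _ = k * x - d / 2 := by
          rw [hmeas, Real.volume_real_Icc, max_eq_left (by linarith)]
          ring
  have hgauss : ∑ j ∈ Finset.range k, ((j : ℝ) + 1) = k * (k + 1) / 2 := by
    clear * -
    induction k with
    | zero => simp
    | succ k ih => rw [Finset.sum_range_succ, ih]; push_cast; ring
  have hk2 : (2 : ℝ) ≤ k := by exact_mod_cast hk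
  have hF0 : 0 ≤ F := hF ▸ measureReal_nonneg
  have hjk : ∀ j ∈ Finset.range k, (j : ℝ) + 1 ≤ k := fun j hj => by
    exact_mod_cast Finset.mem_range.1 hj
  rcases le_or_gt (k * F) x with hle | hlt
  · have : ∑ j ∈ Finset.range k, min x (((j : ℝ) + 1) * F) = k * (k + 1) / 2 * F := by
      rw [← hgauss, Finset.sum_mul]
      refine Finset.sum_congr rfl fun j hj => min_eq_right ?_
      nlinarith [hjk j hj]
    linarith
  · exfalso
    have hxk : x / k < F := by rw [div_lt_iff₀ (by linarith)]; linarith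
    have hxk0 : 0 < x / k := by positivity
    have hkk : k * (x / k) = x := by field_simp
    have : ∑ j ∈ Finset.range k, ((j : ℝ) + 1) * (x / k)
        < ∑ j ∈ Finset.range k, min x (((j : ℝ) + 1) * F) := by
      refine Finset.sum_lt_sum (fun j hj => le_min ?_ (by gcongr))
        ⟨0, Finset.mem_range.2 (by omega), lt_min ?_ (by simpa using hxk)⟩
      · nlinarith [hjk j hj]
      · simp only [Nat.cast_zero, zero_add, one_mul]
        nlinarith
    rw [← Finset.sum_mul, hgauss] at this
    have h2 : (k : ℝ) * (k + 1) / 2 * (x / k) = (k + 1) / 2 * x := by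
      field_simp
    linarith

lemma exists_nat_mul_bracket {x d : ℝ} (hx : 0 < x) (hxd : x ≤ d) :
    ∃ k : ℕ, 2 ≤ k ∧ d < k * x ∧ ((k : ℝ) - 1) * x ≤ d := by
  refine ⟨⌊d / x⌋₊ + 1, ?_, ?_, ?_⟩
  · have : 1 ≤ ⌊d / x⌋₊ := Nat.le_floor (by rw [le_div_iff₀ hx]; simpa using hxd)
    omega
  · rw [← div_lt_iff₀ hx]
    exact_mod_cast Nat.lt_floor_add_one (d / x)
  · rw [← le_div_iff₀ hx]
    push_cast
    rw [add_sub_cancel_right]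
    exact Nat.floor_le (div_nonneg (hx.le.trans hxd) hx.le)

/-- Theorem 2.3 (`thmstabA`): sharp upper bound on the left measure-distribution of an
additively left-stable compact set of density 1/2. The function `h` is the continuous
piecewise affine function with `h 0 = 0` and `h x = (2x - 1/k)/(k+1)` on `(1/k, 1/(k-1)]`
for every integer `k ≥ 2`. -/
theorem leftStable_density_half_bound (h : ℝ → ℝ) (h0 : h 0 = 0)
    (hh : ∀ k : ℕ, 2 ≤ k → ∀ x : ℝ, 1 / (k : ℝ) < x → x ≤ 1 / ((k : ℝ) - 1) →
      h x = (2 * x - 1 / (k : ℝ)) / ((k : ℝ) + 1))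
    (A : Set ℝ) (hA : IsCompact A) (hne : A.Nonempty) (hinf : sInf A = 0)
    (d : ℝ) (hd : d = sSup A)
    (hstab : (A + A) ∩ Icc 0 d = A)
    (hdpos : 0 < d) (hmeas : (volume A).toReal = d / 2) :
    ∀ x ∈ Icc 0 d, (volume (A ∩ Icc 0 x)).toReal ≤ d * h (x / d) := by
  rintro x ⟨hx0, hxd⟩
  have hzero : 0 ∈ A := hinf ▸ hA.sInf_mem hne
  rcases hx0.eq_or_lt with rfl | hxpos
  · have : volume (A ∩ Icc 0 0) = 0 := measure_mono_null inter_subset_right (by simp)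
    rw [this, zero_div, h0, ENNReal.toReal_zero, mul_zero]
  obtain ⟨k, hk, hk1, hk2⟩ := exists_nat_mul_bracket hxpos hxd
  have hkR : (2 : ℝ) ≤ k := by exact_mod_cast hk
  have hhx : d * h (x / d) = (2 * (k * x) - d) / (k * (k + 1)) := by
    rw [hh k hk (x / d) (by rw [div_lt_div_iff₀ (by linarith) hdpos]; linarith)
      (by rw [div_le_div_iff₀ hdpos (by linarith)]; linarith)]
    field_simp
  rw [hhx, le_div_iff₀ (by positivity)]
  obtain ⟨y, ⟨hyA, hy0, hyx⟩, hymax⟩ := (hA.inter_right isClosed_Icc).exists_isGreatest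
    (s := A ∩ Icc 0 x) ⟨0, hzero, le_rfl, hx0⟩
  have hAxy : A ∩ Icc 0 x = A ∩ Icc 0 y := by
    ext z
    exact ⟨fun hz => ⟨hz.1, hz.2.1, hymax hz⟩, fun hz => ⟨hz.1, hz.2.1, hz.2.2.trans hyx⟩⟩
  rw [hAxy]
  rcases hy0.eq_or_lt with rfl | hypos
  · have : volume (A ∩ Icc 0 0) = 0 := measure_mono_null inter_subset_right (by simp)
    rw [this, ENNReal.toReal_zero]
    linarith
  obtain ⟨l, hl, hl1, hl2⟩ := exists_nat_mul_bracket hypos (hyx.trans hxd)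
  have hmain := measureReal_inter_Icc_le_of_mem hA hzero hstab hmeas hyA hypos hl hl1.le hl2
  rw [measureReal_def] at hmain
  obtain ⟨F, hF⟩ : ∃ F, F = (volume (A ∩ Icc 0 y)).toReal := ⟨_, rfl⟩
  rw [← hF] at hmain ⊢
  have hlR : (2 : ℝ) ≤ l := by exact_mod_cast hl
  have hkl : k ≤ l := by
    have h1 : ((k : ℝ) - 1) * y < l * y :=
      (mul_le_mul_of_nonneg_left hyx (by linarith)).trans_lt (hk2.trans_lt hl1)
    have h2 : (k : ℝ) < l + 1 := by linarith [lt_of_mul_lt_mul_right h1 hypos.le]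
    exact Nat.lt_succ_iff.1 (by exact_mod_cast h2)
  have hint : 0 ≤ ((l : ℝ) - k) * (l - k - 1) := by
    rcases hkl.eq_or_lt with rfl | hlt
    · simp
    · have : (k : ℝ) + 1 ≤ l := by exact_mod_cast hlt
      exact mul_nonneg (by linarith) (by linarith)
  have hklR : (k : ℝ) ≤ l := by exact_mod_cast hkl
  have hcomp : k * (k + 1) * (2 * (l * x) - d) ≤ l * (l + 1) * (2 * (k * x) - d) := by
    have : 0 ≤ 2 * (l * (l - k)) * ((k : ℝ) * x - d) :=
      mul_nonneg (by nlinarith) (by linarith)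
    nlinarith [mul_nonneg hint hdpos.le]
  have hlx : l * (l + 1) * F ≤ 2 * (l * x) - d := by
    nlinarith
  have h3 := mul_le_mul_of_nonneg_left hlx (by positivity : (0 : ℝ) ≤ k * (k + 1))
  refine le_of_mul_le_mul_left (a := (l : ℝ) * (l + 1)) ?_ (by positivity)
  linarith
end

section
/- Let d > 0 be a real number, let x ∈ (0, d], and let k be the unique integer such that (k−1)x < d ≤ kx. Define A = (⋃_{i=0}^{k−1} [i·((k−1)x/(k+1) + d/(k(k+1))), i·x]) ∪ [k(k−1)x/(k+1) + d/(k+1), d]. Then A is a compact set with min(A) = 0, max(A) = d, (A + A) ∩ [0, d] = A, λ(A) = d/2, and λ(A ∩ [0, x]) = (1/(k+1))·(2x − d/k). -/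
open MeasureTheory Pointwise Set

/-- The union of the intervals `[i * a, i * x]` for `i < k`, together with `[k * a, d]`. -/
def dilatedIntervals (a x d : ℝ) (k : ℕ) : Set ℝ :=
  (⋃ i ∈ Finset.range k, Icc ((i : ℝ) * a) ((i : ℝ) * x)) ∪ Icc ((k : ℝ) * a) d

section dilatedIntervals

variable {a x d : ℝ} {k : ℕ}

lemma mem_dilatedIntervals {y : ℝ} : y ∈ dilatedIntervals a x d k ↔
    (∃ i : ℕ, i < k ∧ (i : ℝ) * a ≤ y ∧ y ≤ (i : ℝ) * x) ∨ ((k : ℝ) * a ≤ y ∧ y ≤ d) := by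
  simp [dilatedIntervals, and_left_comm]

lemma isCompact_dilatedIntervals : IsCompact (dilatedIntervals a x d k) :=
  ((Finset.range k).isCompact_biUnion fun _ _ => isCompact_Icc).union isCompact_Icc

lemma zero_mem_dilatedIntervals (hk : 0 < k) : (0 : ℝ) ∈ dilatedIntervals a x d k :=
  mem_dilatedIntervals.2 (Or.inl ⟨0, hk, by simp, by simp⟩)

lemma dilatedIntervals_subset_Icc (ha : 0 ≤ a) (hx : 0 ≤ x) (hkd : ((k : ℝ) - 1) * x ≤ d) :
    dilatedIntervals a x d k ⊆ Icc 0 d := by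
  intro y hy
  rcases mem_dilatedIntervals.1 hy with ⟨i, hi, h1, h2⟩ | ⟨h1, h2⟩
  · have hi' : (i : ℝ) ≤ (k : ℝ) - 1 := by
      have : (i : ℝ) + 1 ≤ k := by exact_mod_cast hi
      linarith
    exact ⟨le_trans (by positivity) h1,
      h2.trans ((mul_le_mul_of_nonneg_right hi' hx).trans hkd)⟩
  · exact ⟨le_trans (by positivity) h1, h2⟩

lemma dilatedIntervals_add_self_inter (ha : 0 ≤ a) (hx : 0 ≤ x) (hk : 0 < k)
    (hkd : ((k : ℝ) - 1) * x ≤ d) :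
    (dilatedIntervals a x d k + dilatedIntervals a x d k) ∩ Icc 0 d =
      dilatedIntervals a x d k := by
  apply Subset.antisymm
  · rintro _ ⟨⟨y, hy, z, hz, rfl⟩, hd⟩
    have hy0 := (dilatedIntervals_subset_Icc ha hx hkd hy).1
    have hz0 := (dilatedIntervals_subset_Icc ha hx hkd hz).1
    have hd2 : y + z ≤ d := hd.2
    change y + z ∈ _
    rw [mem_dilatedIntervals]
    rcases mem_dilatedIntervals.1 hy with ⟨i, hi, h1, h2⟩ | ⟨h1, h2⟩
    · rcases mem_dilatedIntervals.1 hz with ⟨j, hj, h3, h4⟩ | ⟨h3, h4⟩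
      · rcases lt_or_ge (i + j) k with h | h
        · left
          refine ⟨i + j, h, ?_, ?_⟩ <;> push_cast <;> linarith
        · right
          have h' : (k : ℝ) ≤ (i : ℝ) + j := by exact_mod_cast h
          exact ⟨by linarith [mul_le_mul_of_nonneg_right h' ha], hd2⟩
      · exact Or.inr ⟨by linarith, hd2⟩
    · exact Or.inr ⟨by linarith, hd2⟩
  · intro y hy
    exact ⟨⟨y, hy, 0, zero_mem_dilatedIntervals hk, add_zero y⟩,
      dilatedIntervals_subset_Icc ha hx hkd hy⟩

lemma natCast_mul_lt_natCast_mul (ha : 0 ≤ a) (hax : a ≤ x)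
    (hgap : ((k : ℝ) - 1) * x < k * a) {i j : ℕ} (hi : i < k) (hij : i < j) :
    (i : ℝ) * x < j * a := by
  have hi' : (i : ℝ) ≤ (k : ℝ) - 1 := by
    have : (i : ℝ) + 1 ≤ k := by exact_mod_cast hi
    linarith
  have hj' : (i : ℝ) + 1 ≤ j := by exact_mod_cast hij
  nlinarith [mul_le_mul_of_nonneg_right hj' ha,
    mul_le_mul_of_nonneg_right hi' (sub_nonneg.2 hax)]

lemma sum_range_natCast_mul (k : ℕ) (c : ℝ) :
    ∑ i ∈ Finset.range k, (i : ℝ) * c = (k : ℝ) * ((k : ℝ) - 1) / 2 * c := by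
  induction k with
  | zero => simp
  | succ n ih => rw [Finset.sum_range_succ, ih]; push_cast; ring

lemma volume_dilatedIntervals (ha : 0 ≤ a) (hax : a ≤ x)
    (hgap : ((k : ℝ) - 1) * x < k * a) (hd : (k : ℝ) * a ≤ d) :
    volume (dilatedIntervals a x d k) =
      ENNReal.ofReal ((k : ℝ) * ((k : ℝ) - 1) / 2 * (x - a) + (d - k * a)) := by
  have hnonneg : ∀ i ∈ Finset.range k, 0 ≤ (i : ℝ) * (x - a) := fun i _ =>
    mul_nonneg i.cast_nonneg (sub_nonneg.2 hax)
  have hdisj : Disjoint (⋃ i ∈ Finset.range k, Icc ((i : ℝ) * a) ((i : ℝ) * x))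
      (Icc ((k : ℝ) * a) d) := by
    simp only [disjoint_iUnion_left, Finset.mem_range]
    intro i hi
    rw [Set.disjoint_left]
    intro y h1 h2
    linarith [h1.2, h2.1, natCast_mul_lt_natCast_mul ha hax hgap hi hi]
  have hpair : (↑(Finset.range k) : Set ℕ).PairwiseDisjoint
      fun i : ℕ => Icc ((i : ℝ) * a) ((i : ℝ) * x) := by
    intro i hi j hj hij
    simp only [Finset.coe_range, mem_Iio] at hi hj
    refine Set.disjoint_left.2 fun y h1 h2 => ?_
    rcases lt_or_gt_of_ne hij with h | h
    · linarith [h1.2, h2.1, natCast_mul_lt_natCast_mul ha hax hgap hi h]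
    · linarith [h1.1, h2.2, natCast_mul_lt_natCast_mul ha hax hgap hj h]
  rw [dilatedIntervals, measure_union hdisj measurableSet_Icc,
    measure_biUnion_finset hpair fun _ _ => measurableSet_Icc]
  simp only [Real.volume_Icc, ← mul_sub]
  rw [← ENNReal.ofReal_sum_of_nonneg hnonneg,
    ← ENNReal.ofReal_add (Finset.sum_nonneg hnonneg) (sub_nonneg.2 hd), sum_range_natCast_mul]

lemma dilatedIntervals_inter_Icc (ha : 0 ≤ a) (hax : a ≤ x) (hk : 0 < k)
    (hxd : x ≤ d) :
    dilatedIntervals a x d k ∩ Icc 0 x = {0} ∪ Icc a x := by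
  ext y
  simp only [mem_inter_iff, mem_dilatedIntervals, mem_Icc, mem_union, mem_singleton_iff]
  constructor
  · rintro ⟨⟨i, hi, h1, h2⟩ | ⟨h1, h2⟩, h0, hyx⟩
    · rcases Nat.eq_zero_or_pos i with rfl | hi0
      · left
        simp only [Nat.cast_zero, zero_mul] at h1 h2
        exact le_antisymm h2 h1
      · have : (1 : ℝ) ≤ i := by exact_mod_cast hi0
        exact Or.inr ⟨by nlinarith, hyx⟩
    · have : (1 : ℝ) ≤ k := by exact_mod_cast hk
      exact Or.inr ⟨by nlinarith, hyx⟩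
  · rintro (rfl | ⟨h1, h2⟩)
    · exact ⟨Or.inl ⟨0, hk, by simp, by simp⟩, le_rfl, ha.trans hax⟩
    · refine ⟨?_, ha.trans h1, h2⟩
      rcases Nat.lt_or_ge 1 k with h | h
      · exact Or.inl ⟨1, h, by simpa using h1, by simpa using h2⟩
      · obtain rfl : k = 1 := by omega
        exact Or.inr ⟨by simpa using h1, h2.trans hxd⟩

lemma volume_dilatedIntervals_inter_Icc (ha : 0 ≤ a) (hax : a ≤ x) (hk : 0 < k)
    (hxd : x ≤ d) :
    volume (dilatedIntervals a x d k ∩ Icc 0 x) = ENNReal.ofReal (x - a) := by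
  rw [dilatedIntervals_inter_Icc ha hax hk hxd,
    singleton_union, measure_congr (insert_ae_eq_self _ _), Real.volume_Icc]

end dilatedIntervals

/-- Theorem 2.4 (existence part): the explicit union of intervals is an additively
left-stable compact set of diameter `d`, measure `d/2`, whose measure on `[0, x]`
equals the extremal value `(2x - d/k)/(k+1)`. -/
theorem extremal_leftStable_set_exists (d : ℝ) (hd : 0 < d) (x : ℝ) (hx : x ∈ Ioc 0 d)
    (k : ℕ) (hk1 : ((k : ℝ) - 1) * x < d) (hk2 : d ≤ (k : ℝ) * x)
    (A : Set ℝ)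
    (hAdef : A = (⋃ i ∈ Finset.range k,
        Icc ((i : ℝ) * (((k : ℝ) - 1) * x / ((k : ℝ) + 1) + d / ((k : ℝ) * ((k : ℝ) + 1))))
          ((i : ℝ) * x)) ∪
      Icc ((k : ℝ) * ((k : ℝ) - 1) * x / ((k : ℝ) + 1) + d / ((k : ℝ) + 1)) d) :
    IsCompact A ∧ sInf A = 0 ∧ sSup A = d ∧ (A + A) ∩ Icc 0 d = A ∧
      volume A = ENNReal.ofReal (d / 2) ∧
      volume (A ∩ Icc 0 x) = ENNReal.ofReal (1 / ((k : ℝ) + 1) * (2 * x - d / (k : ℝ))) := by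
  obtain ⟨hx0, hxd⟩ := hx
  have hk : 0 < k := by
    rcases Nat.eq_zero_or_pos k with rfl | h
    · simp only [Nat.cast_zero, zero_mul] at hk2
      linarith
    · exact h
  have hkR : (1 : ℝ) ≤ k := by exact_mod_cast hk
  set a : ℝ := ((k : ℝ) - 1) * x / ((k : ℝ) + 1) + d / ((k : ℝ) * ((k : ℝ) + 1)) with ha_def
  have hka : (k : ℝ) * ((k : ℝ) - 1) * x / ((k : ℝ) + 1) + d / ((k : ℝ) + 1) = k * a := by
    rw [ha_def]; field_simp
  have hmul : ((k : ℝ) + 1) * (k * a) = k * (((k : ℝ) - 1) * x) + d := by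
    rw [ha_def]; field_simp
  obtain rfl : A = dilatedIntervals a x d k := by rw [hAdef, hka]; rfl
  have ha : 0 ≤ a := by
    have : 0 ≤ (k : ℝ) - 1 := by linarith
    positivity
  have hgap : ((k : ℝ) - 1) * x < k * a := by nlinarith
  have hkad : (k : ℝ) * a ≤ d := by nlinarith
  have hax : a ≤ x := by
    refine le_of_mul_le_mul_left ?_ (by positivity : (0 : ℝ) < ((k : ℝ) + 1) * k)
    nlinarith [mul_pos (by positivity : (0 : ℝ) < k) hx0]
  have hsub := dilatedIntervals_subset_Icc ha hx0.le hk1.le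
  have hleast : IsLeast (dilatedIntervals a x d k) 0 :=
    ⟨zero_mem_dilatedIntervals hk, fun y hy => (hsub hy).1⟩
  have hgreatest : IsGreatest (dilatedIntervals a x d k) d :=
    ⟨mem_dilatedIntervals.2 (Or.inr ⟨hkad, le_rfl⟩), fun y hy => (hsub hy).2⟩
  refine ⟨isCompact_dilatedIntervals, hleast.csInf_eq, hgreatest.csSup_eq,
    dilatedIntervals_add_self_inter ha hx0.le hk hk1.le, ?_, ?_⟩
  · rw [volume_dilatedIntervals ha hax hgap hkad]
    congr 1
    linarith
  · rw [volume_dilatedIntervals_inter_Icc ha hax hk hxd]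
    congr 1
    rw [ha_def]
    field_simp
    ring
end

section
/- Let A be a nonempty compact subset of ℝ with λ(A) > 0 and diameter d = max(A) − min(A). Assume λ(A + A) = d + λ(A) < 3λ(A). Set Δ = 2λ(A) − d and define g(x) = λ((A − min(A)) ∩ [0, x]) for x ∈ [0, d]. Then there exists b ∈ [0, d − Δ] such that: (i) for all x ∈ [b, b + Δ], g(x) = x − b/2; (ii) for all x ∈ [0, b], g(x) ≤ b·h(x/b) (with the convention that this bound is 0 when b = 0); (iii) for all x ∈ [b + Δ, d], g(x) ≥ λ(A) − (d − Δ − b)·h((d − x)/(d − Δ − b)) (with the convention that the subtracted term is 0 when d − Δ − b = 0). Here h : [0,1] → ℝ is defined by h(0) = 0 and h(x) = (1/(k+1))·(2x − 1/k) for x ∈ (1/k, 1/(k−1)], k ≥ 2 an integer. -/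
open MeasureTheory Pointwise Set

/-- A subset of `[0, x]` is covered by the cells of length `x / q` that it meets. -/
lemma exists_finset_cells {x : ℝ} (hx : 0 < x) (q : ℕ) [NeZero q] {X : Set ℝ}
    (hX : X ⊆ Icc 0 x) :
    ∃ F : Finset (ZMod q),
      (∀ i ∈ F, ∃ t ∈ X, x / q * i.val ≤ t ∧ t ≤ x / q * (i.val + 1)) ∧
      (∀ t ∈ X, ∃ i ∈ F, t ∈ Icc (x / q * i.val) (x / q * (i.val + 1))) ∧
      volume.real X ≤ F.card * (x / q) := by
  classical
  have hq : (0 : ℝ) < q := by exact_mod_cast Nat.pos_of_ne_zero (NeZero.ne q)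
  have hδ : 0 < x / q := by positivity
  let F : Finset (ZMod q) := Finset.univ.filter
    fun i => ∃ t ∈ X, x / q * i.val ≤ t ∧ t ≤ x / q * (i.val + 1)
  have hcov : ∀ t ∈ X, ∃ i ∈ F, t ∈ Icc (x / q * i.val) (x / q * (i.val + 1)) := by
    intro t ht
    obtain ⟨m, hmq, h1, h2⟩ : ∃ m : ℕ, m < q ∧ x / q * m ≤ t ∧ t ≤ x / q * (m + 1) := by
      rcases (hX ht).2.lt_or_eq with h | h
      · have h0 : 0 ≤ t / (x / q) := div_nonneg (hX ht).1 hδ.le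
        refine ⟨⌊t / (x / q)⌋₊, ?_, ?_, ?_⟩
        · rw [Nat.floor_lt h0, div_lt_iff₀ hδ]
          field_simp
          exact h
        · have := Nat.floor_le h0
          rw [le_div_iff₀ hδ] at this
          linarith
        · have := (Nat.lt_floor_add_one (t / (x / q))).le
          rw [div_le_iff₀ hδ] at this
          linarith
      · have h1q : 1 ≤ q := Nat.one_le_iff_ne_zero.2 (NeZero.ne q)
        have hxq : x / q * q = x := by field_simp
        refine ⟨q - 1, by omega, ?_, ?_⟩
        · push_cast [h1q]
          nlinarith
        · push_cast [h1q]
          nlinarith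
    have hv : ((m : ZMod q)).val = m := ZMod.val_cast_of_lt hmq
    refine ⟨m, ?_, ?_⟩
    · simp only [F, Finset.mem_filter, Finset.mem_univ, true_and]
      exact ⟨t, ht, by rw [hv]; exact h1, by rw [hv]; exact h2⟩
    · rw [hv]; exact ⟨h1, h2⟩
  refine ⟨F, fun i hi => (Finset.mem_filter.1 hi).2, hcov, ?_⟩
  calc volume.real X
      ≤ volume.real (⋃ i ∈ F, Icc (x / q * i.val) (x / q * (i.val + 1))) := by
        refine measureReal_mono (fun t ht => ?_) ?_
        · obtain ⟨i, hi, h⟩ := hcov t ht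
          exact mem_iUnion₂.2 ⟨i, hi, h⟩
        · exact (F.isCompact_biUnion fun i _ => isCompact_Icc).measure_lt_top.ne
    _ ≤ ∑ i ∈ F, volume.real (Icc (x / q * i.val) (x / q * (i.val + 1))) :=
        measureReal_biUnion_finset_le _ _
    _ = F.card * (x / q) := by
        rw [Finset.sum_congr rfl fun i _ => ?_, Finset.sum_const, nsmul_eq_mul]
        rw [Real.volume_real_Icc_of_le (by nlinarith)]
        ring

/-- Distinct cells of length `δ` have additive measure. -/
lemma volume_real_biUnion_cells {δ : ℝ} (hδ : 0 < δ) {q : ℕ} [NeZero q] (F : Finset (ZMod q)) :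
    volume.real (⋃ i ∈ F, Ico (δ * i.val) (δ * (i.val + 1))) = F.card * δ := by
  rw [measureReal_biUnion_finset ?_ (fun _ _ => measurableSet_Ico)
    (fun _ _ => measure_Ico_lt_top.ne)]
  · rw [Finset.sum_congr rfl fun i _ => ?_, Finset.sum_const, nsmul_eq_mul]
    rw [Real.volume_real_Ico_of_le (by nlinarith)]
    ring
  · intro i _ j _ hij
    refine Set.disjoint_left.2 fun t hi hj => hij (ZMod.val_injective q ?_)
    have h1 : δ * i.val < δ * (j.val + 1) := hi.1.trans_lt hj.2
    have h2 : δ * j.val < δ * (i.val + 1) := hj.1.trans_lt hi.2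
    have h1 := lt_of_mul_lt_mul_left h1 hδ.le
    have h2 := lt_of_mul_lt_mul_left h2 hδ.le
    norm_cast at h1 h2
    omega

/-- Discretised form of Raikov's inequality, from the Cauchy–Davenport theorem. -/
lemma min_le_volume_cthickening {x : ℝ} (hx : 0 < x) {X Y : Set ℝ}
    (hX : X ⊆ Icc 0 x) (hY : Y ⊆ Icc 0 x) (hX0 : X.Nonempty) (hY0 : Y.Nonempty)
    {q : ℕ} (hq : q.Prime) :
    min x (volume.real X + volume.real Y - x / q) ≤
      volume.real (Metric.cthickening (2 * (x / q))
        {t | t ∈ X + Y ∨ t + x ∈ X + Y} ∩ Icc 0 x) := by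
  classical
  have : NeZero q := ⟨hq.ne_zero⟩
  have hq0 : (0 : ℝ) < q := by exact_mod_cast hq.pos
  set δ := x / q with hδdef
  have hδ : 0 < δ := by positivity
  have hδq : δ * q = x := by rw [hδdef]; field_simp
  obtain ⟨F, hF, hF', hFX⟩ := exists_finset_cells hx q hX
  obtain ⟨G, hG, hG', hGY⟩ := exists_finset_cells hx q hY
  rw [← hδdef] at hFX hGY
  have hFn : F.Nonempty := let ⟨t, ht⟩ := hX0; let ⟨i, hi, _⟩ := hF' t ht; ⟨i, hi⟩
  have hGn : G.Nonempty := let ⟨t, ht⟩ := hY0; let ⟨i, hi, _⟩ := hG' t ht; ⟨i, hi⟩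
  have hcd := ZMod.cauchy_davenport hq hFn hGn
  have hcard : 1 ≤ F.card + G.card := by have := hFn.card_pos; omega
  have hcd' : min (q : ℝ) (F.card + G.card - 1) ≤ (F + G).card := by
    have : ((min q (F.card + G.card - 1) : ℕ) : ℝ) ≤ (F + G).card := by exact_mod_cast hcd
    push_cast [hcard] at this
    exact this
  have key : min x (volume.real X + volume.real Y - δ) ≤ (F + G).card * δ := by
    rcases le_total (q : ℝ) (F.card + G.card - 1) with h | h
    · rw [min_eq_left h] at hcd'
      refine (min_le_left _ _).trans ?_
      nlinarith
    · rw [min_eq_right h] at hcd'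
      refine (min_le_right _ _).trans ?_
      nlinarith
  refine key.trans ?_
  rw [← volume_real_biUnion_cells hδ (F + G)]
  refine measureReal_mono ?_ (measure_ne_top_of_subset inter_subset_right
    isCompact_Icc.measure_lt_top.ne)
  refine iUnion₂_subset fun m hm t ht => ?_
  obtain ⟨i, hi, j, hj, rfl⟩ := Finset.mem_add.1 hm
  obtain ⟨u, huX, hu1, hu2⟩ := hF i hi
  obtain ⟨v, hvY, hv1, hv2⟩ := hG j hj
  rw [← hδdef] at hu1 hu2 hv1 hv2
  have hmq : ((i + j).val : ℝ) + 1 ≤ q := by exact_mod_cast ZMod.val_lt (i + j)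
  refine ⟨?_, le_trans (by positivity) ht.1, ht.2.le.trans ?_⟩
  · rcases lt_or_ge (i.val + j.val) q with h | h
    · have hval : ((i + j).val : ℝ) = i.val + j.val := by
        rw [ZMod.val_add_of_lt h]; push_cast; rfl
      rw [hval] at ht
      refine Metric.mem_cthickening_of_dist_le t (u + v) _ _ (Or.inl (add_mem_add huX hvY)) ?_
      rw [Real.dist_eq, abs_le]
      constructor <;> nlinarith [ht.1, ht.2]
    · have hval : ((i + j).val : ℝ) = i.val + j.val - q := by
        have := ZMod.val_add_val_of_le h
        rw [eq_sub_iff_add_eq]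
        exact_mod_cast this.symm
      rw [hval] at ht
      refine Metric.mem_cthickening_of_dist_le t (u + v - x) _ _
        (Or.inr (by simpa using add_mem_add huX hvY)) ?_
      rw [Real.dist_eq, abs_le]
      constructor <;> nlinarith [ht.1, ht.2]
  · nlinarith

/-- Raikov's inequality on the circle of length `x`. -/
lemma min_le_volume_add_mod {x : ℝ} (hx : 0 < x) {X Y : Set ℝ}
    (hXc : IsCompact X) (hYc : IsCompact Y)
    (hX : X ⊆ Icc 0 x) (hY : Y ⊆ Icc 0 x) (hX0 : X.Nonempty) (hY0 : Y.Nonempty) :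
    min x (volume.real X + volume.real Y) ≤
      volume.real ({t | t ∈ X + Y ∨ t + x ∈ X + Y} ∩ Icc 0 x) := by
  set W : Set ℝ := {t | t ∈ X + Y ∨ t + x ∈ X + Y}
  have hW : IsClosed W := by
    have h := (hXc.add hYc).isClosed
    exact h.union (h.preimage (continuous_id.add continuous_const))
  let μ := volume.restrict (Icc 0 x)
  have hμ : IsFiniteMeasure μ := ⟨by simp [μ]⟩
  have hlim := tendsto_measure_cthickening_of_isClosed (μ := μ) (s := W)
    ⟨1, one_pos, measure_ne_top _ _⟩ hW
  have hlim' := (ENNReal.tendsto_toReal (measure_ne_top μ W)).comp hlim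
  have hprime : Filter.Tendsto (Nat.nth Nat.Prime) Filter.atTop Filter.atTop :=
    (Nat.nth_strictMono Nat.infinite_setOfPred_prime).tendsto_atTop
  have hδ : Filter.Tendsto (fun n => x / (Nat.nth Nat.Prime n : ℝ)) Filter.atTop (nhds 0) :=
    tendsto_const_nhds.div_atTop (tendsto_natCast_atTop_atTop.comp hprime)
  have hδ2 : Filter.Tendsto (fun n => 2 * (x / (Nat.nth Nat.Prime n : ℝ))) Filter.atTop
      (nhds 0) := by simpa using hδ.const_mul 2
  have hR := hlim'.comp hδ2
  have hL : Filter.Tendsto (fun n => min x (volume.real X + volume.real Y -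
      x / (Nat.nth Nat.Prime n : ℝ))) Filter.atTop
      (nhds (min x (volume.real X + volume.real Y - 0))) :=
    tendsto_const_nhds.min (tendsto_const_nhds.sub hδ)
  rw [sub_zero] at hL
  have hWr : volume.real (W ∩ Icc 0 x) = (μ W).toReal :=
    (measureReal_restrict_apply' measurableSet_Icc).symm
  rw [hWr]
  refine le_of_tendsto_of_tendsto' hL hR fun n => ?_
  refine (min_le_volume_cthickening hx hX hY hX0 hY0
    (Nat.nth_mem_of_infinite Nat.infinite_setOfPred_prime n)).trans (le_of_eq ?_)
  exact (measureReal_restrict_apply' measurableSet_Icc).symm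

lemma volume_real_inter_singleton (T : Set ℝ) (x : ℝ) : volume.real (T ∩ {x}) = 0 := by
  rw [measureReal_def, measure_mono_null inter_subset_right Real.volume_singleton,
    ENNReal.toReal_zero]

lemma volume_real_inter_Icc_add {T : Set ℝ} (hT : MeasurableSet T) {p q r : ℝ}
    (hpq : p ≤ q) (hqr : q ≤ r) :
    volume.real (T ∩ Icc p q) + volume.real (T ∩ Icc q r) = volume.real (T ∩ Icc p r) := by
  have hfin : ∀ u v : ℝ, volume (T ∩ Icc u v) ≠ ⊤ := fun u v =>
    measure_ne_top_of_subset inter_subset_right isCompact_Icc.measure_lt_top.ne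
  rw [← measureReal_union_add_inter (hT.inter measurableSet_Icc) (hfin _ _) (hfin _ _),
    ← inter_union_distrib_left, Icc_union_Icc_eq_Icc hpq hqr]
  have : volume.real (T ∩ Icc p q ∩ (T ∩ Icc q r)) = 0 := by
    refine measureReal_mono_null (s₂ := {q}) ?_ (by simp [measureReal_def])
      (by rw [Real.volume_singleton]; exact ENNReal.zero_ne_top)
    rintro t ⟨⟨_, _, h⟩, _, h', _⟩
    exact le_antisymm h h'
  linarith

lemma volume_real_inter_Icc_of_subset {T : Set ℝ} {p q : ℝ} (hpq : p ≤ q) (h : Icc p q ⊆ T) :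
    volume.real (T ∩ Icc p q) = q - p := by
  rw [inter_eq_self_of_subset_right h, Real.volume_real_Icc_of_le hpq]

/-- A closed set of full measure in an interval contains it. -/
lemma Icc_subset_of_le_volume {T : Set ℝ} (hT : IsClosed T) {p q : ℝ} (hpq : p < q)
    (h : q - p ≤ volume.real (T ∩ Icc p q)) : Icc p q ⊆ T := by
  have hsplit := measureReal_inter_add_sdiff (μ := volume) (s := Icc p q) hT.measurableSet
    isCompact_Icc.measure_lt_top.ne
  rw [Real.volume_real_Icc_of_le hpq.le, inter_comm] at hsplit
  have h0 : volume.real (Icc p q \ T) = 0 := le_antisymm (by linarith) measureReal_nonneg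
  have h1 : volume (Icc p q \ T) = 0 := (measureReal_eq_zero_iff
    (measure_ne_top_of_subset sdiff_subset isCompact_Icc.measure_lt_top.ne)).1 h0
  have h2 : Ioo p q \ T = ∅ := (isOpen_Ioo.sdiff hT).measure_eq_zero_iff volume |>.1
    (measure_mono_null (sdiff_subset_sdiff_left Ioo_subset_Icc_self) h1)
  rw [← closure_Ioo hpq.ne]
  exact hT.closure_subset_iff.2 (sdiff_eq_empty.1 h2)

/-- Superadditivity modulo `x` of the measures of the layers of a closed additive semigroup. -/
lemma min_le_volume_layer_succ {T : Set ℝ} (hT : IsClosed T) (h0 : 0 ∈ T)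
    (hadd : ∀ s ∈ T, ∀ t ∈ T, s + t ∈ T) {x : ℝ} (hx : x ∈ T) (hx0 : 0 < x) (j : ℕ) :
    min x (volume.real (T ∩ Icc 0 x) + volume.real (T ∩ Icc (j * x) ((j + 1) * x))) ≤
      volume.real (T ∩ Icc ((j + 1) * x) ((j + 1 + 1) * x)) := by
  have hmul : ∀ m : ℕ, (m : ℝ) * x ∈ T := by
    intro m
    induction m with
    | zero => simpa using h0
    | succ m ih => push_cast; rw [add_one_mul]; exact hadd _ ih _ hx
  have htr : ∀ m : ℝ, volume.real ((fun t => t + m * x) ⁻¹' (T ∩ Icc (m * x) ((m + 1) * x))) =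
      volume.real (T ∩ Icc (m * x) ((m + 1) * x)) := fun m => by
    rw [measureReal_def, measure_preimage_add_right, measureReal_def]
  have hXc : IsCompact (T ∩ Icc 0 x) := isCompact_Icc.inter_left hT
  have hYs : (fun t => t + j * x) ⁻¹' (T ∩ Icc (j * x) ((j + 1) * x)) ⊆ Icc 0 x := by
    rintro t ⟨_, h1, h2⟩
    constructor <;> linarith
  have hYc : IsCompact ((fun t => t + j * x) ⁻¹' (T ∩ Icc (j * x) ((j + 1) * x))) :=
    isCompact_Icc.of_isClosed_subset
      ((hT.inter isClosed_Icc).preimage (continuous_id.add continuous_const)) hYs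
  have key := min_le_volume_add_mod hx0 hXc hYc inter_subset_right hYs
    ⟨0, h0, le_rfl, hx0.le⟩ ⟨0, by simpa using hmul j, by simp, by simp; nlinarith⟩
  rw [htr] at key
  refine key.trans ?_
  rw [← htr ((j : ℝ) + 1)]
  refine measureReal_mono ?_ ?_
  · rintro t ⟨ht, ht0, htx⟩
    have hmem : t + (j + 1) * x ∈ T := by
      rcases ht with ht | ht
      · obtain ⟨u, hu, v, hv, rfl⟩ := mem_add.1 ht
        have := hadd _ (hadd _ hu.1 _ hv.1) _ hx
        convert this using 1
        ring
      · obtain ⟨u, hu, v, hv, huv⟩ := mem_add.1 ht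
        have := hadd _ hu.1 _ hv.1
        convert this using 1
        linear_combination -huv
    exact ⟨hmem, by linarith, by linarith⟩
  · rw [measure_preimage_add_right]
    exact measure_ne_top_of_subset inter_subset_right isCompact_Icc.measure_lt_top.ne

/-- The measure of an initial piece of a closed additive semigroup of `[0, ∞)` that contains
`[b, ∞)` and has density `1 / 2` in `[0, b]`. -/
lemma exists_volume_semigroup_le {T : Set ℝ} (hT : IsClosed T) (h0 : 0 ∈ T)
    (hadd : ∀ s ∈ T, ∀ t ∈ T, s + t ∈ T) {b : ℝ} (hbT : Ici b ⊆ T)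
    (hb : volume.real (T ∩ Icc 0 b) = b / 2) {x : ℝ} (hx : x ∈ T) (hx0 : 0 < x) (hxb : x ≤ b) :
    ∃ n : ℕ, 1 ≤ n ∧ volume.real (T ∩ Icc 0 x) ≤ (2 * x - b / n) / (n + 1) := by
  have hb0 : 0 < b := hx0.trans_le hxb
  have hmul : ∀ m : ℕ, (m : ℝ) * x ∈ T := by
    intro m
    induction m with
    | zero => simpa using h0
    | succ m ih => push_cast; rw [add_one_mul]; exact hadd _ ih _ hx
  set u := volume.real (T ∩ Icc 0 x) with hu
  set s : ℕ → ℝ := fun j => volume.real (T ∩ Icc (j * x) ((j + 1) * x)) with hs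
  have hs0 : s 0 = u := by simp [hs, hu]
  have hstep : ∀ j, min x (u + s j) ≤ s (j + 1) := fun j => by
    simpa [hs] using min_le_volume_layer_succ hT h0 hadd hx hx0 j
  have hlow : ∀ n : ℕ, (∀ i < n, (i + 1) * u ≤ s i) →
      n * (n + 1) / 2 * u ≤ volume.real (T ∩ Icc 0 (n * x)) := by
    intro n
    induction n with
    | zero => intro _; simp
    | succ n ih =>
      intro hn
      have h1 := ih fun i hi => hn i (by omega)
      have h2 := hn n (by omega)
      have h3 := volume_real_inter_Icc_add hT.measurableSet (p := 0) (q := n * x)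
        (r := (n + 1) * x) (by positivity) (by nlinarith)
      simp only [hs] at h2
      push_cast
      rw [← h3]
      nlinarith
  have hfin : ∀ n : ℕ, 1 ≤ n → n * (n + 1) / 2 * u ≤ n * x - b / 2 →
      u ≤ (2 * x - b / n) / (n + 1) := by
    intro n hn h
    have hn0 : (0 : ℝ) < n := by exact_mod_cast hn
    rw [le_div_iff₀ (by positivity)]
    refine le_of_mul_le_mul_left ?_ hn0
    have : (n : ℝ) * (2 * x - b / n) = 2 * (n * x) - b := by field_simp
    rw [this]
    nlinarith
  obtain ⟨k, hk, hkb, hkx⟩ : ∃ k : ℕ, 1 ≤ k ∧ b ≤ k * x ∧ (k - 1) * x < b := by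
    refine ⟨⌈b / x⌉₊, Nat.one_le_ceil_iff.2 (by positivity), ?_, ?_⟩
    · rw [← div_le_iff₀ hx0]; exact Nat.le_ceil _
    · rw [← lt_div_iff₀ hx0]
      have := Nat.ceil_lt_add_one (a := b / x) (by positivity)
      linarith
  by_cases hall : ∀ i < k, (i + 1) * u ≤ s i
  · refine ⟨k, hk, hfin k hk ((hlow k hall).trans (le_of_eq ?_))⟩
    rw [← volume_real_inter_Icc_add hT.measurableSet hb0.le hkb, hb,
      volume_real_inter_Icc_of_subset hkb (Icc_subset_Ici_self.trans hbT)]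
    ring
  · push Not at hall
    classical
    obtain ⟨hNk, hN⟩ := Nat.find_spec hall
    have hmin := fun i (hi : i < Nat.find hall) => Nat.find_min hall hi
    obtain ⟨N, hNe⟩ : ∃ N, Nat.find hall = N := ⟨_, rfl⟩
    rw [hNe] at hNk hN hmin
    have hlowN : ∀ i < N, (i + 1) * u ≤ s i := fun i hi => by
      have := hmin i hi
      push Not at this
      exact this (hi.trans hNk)
    have hN1 : 1 ≤ N := by
      by_contra hN0
      have : N = 0 := by omega
      subst this
      simp [hs0] at hN
    obtain ⟨M, rfl⟩ : ∃ M, N = M + 1 := ⟨N - 1, by omega⟩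
    have hxs : x ≤ s (M + 1) := by
      have h1 := hlowN M (by omega)
      have h2 := hstep M
      push_cast at hN
      rcases min_le_iff.1 h2 with h | h
      · exact h
      · linarith
    have hlayer : Icc (((M + 1 : ℕ) : ℝ) * x) ((((M + 1 : ℕ) : ℝ) + 1) * x) ⊆ T :=
      Icc_subset_of_le_volume hT (by nlinarith) (by linarith)
    have hNb : ((M + 1 : ℕ) : ℝ) * x ≤ b := by
      have : ((M + 1 : ℕ) : ℝ) ≤ k - 1 := by
        rw [le_sub_iff_add_le]; exact_mod_cast hNk
      nlinarith
    have hfull : Icc (((M + 1 : ℕ) : ℝ) * x) b ⊆ T := by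
      intro t ht
      have hr0 : 0 ≤ (t - (M + 1 : ℕ) * x) / x := div_nonneg (by linarith [ht.1]) hx0.le
      have h1 := Nat.floor_le hr0
      have h2 := (Nat.lt_floor_add_one ((t - (M + 1 : ℕ) * x) / x)).le
      set m := ⌊(t - (M + 1 : ℕ) * x) / x⌋₊
      rw [le_div_iff₀ hx0] at h1
      rw [div_le_iff₀ hx0] at h2
      have := hadd _ (hlayer (show t - m * x ∈ _ from ⟨by linarith, by linarith⟩)) _ (hmul m)
      simpa using this
    refine ⟨M + 1, hN1, hfin _ hN1 ((hlow _ hlowN).trans (le_of_eq ?_))⟩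
    have := volume_real_inter_Icc_add hT.measurableSet (p := 0) (by positivity) hNb
    rw [hb, volume_real_inter_Icc_of_subset hNb hfull] at this
    linarith

/-- A function given on each `(1 / k, 1 / (k - 1)]` by the affine function
`y ↦ (2 * y - 1 / k) / (k + 1)` dominates all of these affine functions. -/
lemma affine_le_of_eq_on_pieces {h : ℝ → ℝ}
    (hh : ∀ k : ℕ, 2 ≤ k → ∀ x : ℝ, 1 / (k : ℝ) < x → x ≤ 1 / ((k : ℝ) - 1) →
      h x = (2 * x - 1 / (k : ℝ)) / ((k : ℝ) + 1))
    {y : ℝ} (hy0 : 0 < y) (hy1 : y ≤ 1) :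
    0 ≤ h y ∧ ∀ n : ℕ, 1 ≤ n → (2 * y - 1 / n) / (n + 1) ≤ h y := by
  obtain ⟨m, hm, h1, h2⟩ : ∃ m : ℕ, 1 ≤ m ∧ 1 < (m + 1) * y ∧ m * y ≤ 1 := by
    have hr0 : 0 ≤ 1 / y := by positivity
    refine ⟨⌊1 / y⌋₊, Nat.le_floor (by rw [le_div_iff₀ hy0]; simpa using hy1), ?_, ?_⟩
    · rw [← div_lt_iff₀ hy0]; exact Nat.lt_floor_add_one _
    · rw [← le_div_iff₀ hy0]; exact Nat.floor_le hr0
  have hm0 : (1 : ℝ) ≤ m := by exact_mod_cast hm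
  have hval := hh (m + 1) (by omega) y
    (by push_cast; rw [div_lt_iff₀ (by positivity)]; linarith)
    (by push_cast; rw [add_sub_cancel_right, le_div_iff₀ (by positivity)]; linarith)
  push_cast at hval
  have hk : 1 / ((m : ℝ) + 1) < y := by rw [div_lt_iff₀ (by positivity)]; linarith
  refine ⟨by rw [hval]; exact div_nonneg (by linarith) (by linarith), fun n hn => ?_⟩
  have hn0 : (1 : ℝ) ≤ n := by exact_mod_cast hn
  rw [hval, ← sub_nonneg]
  have hid : (2 * y - 1 / ((m : ℝ) + 1)) / (m + 1 + 1) - (2 * y - 1 / (n : ℝ)) / (n + 1) =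
      ((m + 1 - n) * (m + n + 2 - 2 * y * n * (m + 1))) / (n * (n + 1) * (m + 1) * (m + 2)) := by
    have : (m : ℝ) + 1 + 1 = m + 2 := by ring
    rw [this]
    field_simp
    ring
  rw [hid]
  refine div_nonneg ?_ (by positivity)
  rcases le_or_gt n m with hnm | hnm
  · have hnm' : (n : ℝ) ≤ m := by exact_mod_cast hnm
    refine mul_nonneg (by linarith) ?_
    nlinarith [mul_le_mul_of_nonneg_left h2 (show (0 : ℝ) ≤ n by linarith),
      mul_le_mul_of_nonneg_right hnm' hy0.le]
  · rcases (Nat.succ_le_of_lt hnm).eq_or_lt with rfl | hnm'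
    · push_cast
      simp
    have hnm' : (m : ℝ) + 1 + 1 ≤ n := by exact_mod_cast hnm'
    refine mul_nonneg_of_nonpos_of_nonpos (by linarith) ?_
    nlinarith [mul_lt_mul_of_pos_left h1 (show (0 : ℝ) < n by linarith)]

/-- A subset of `[p, q]` of density more than `1 / 2` has `p + q` in its sumset. -/
lemma add_mem_add_of_lt_volume {B : Set ℝ} (hB : IsCompact B) {p q : ℝ} (hpq : p ≤ q)
    (hsub : B ⊆ Icc p q) (h : q - p < 2 * volume.real B) : p + q ∈ B + B := by
  have hsub' : (fun t => p + q - t) ⁻¹' B ⊆ Icc p q := by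
    intro t ht
    have := hsub ht
    constructor <;> linarith [this.1, this.2]
  have hvol : volume.real ((fun t => p + q - t) ⁻¹' B) = volume.real B := by
    rw [measureReal_def, (Measure.measurePreserving_sub_left volume (p + q)).measure_preimage
      hB.measurableSet.nullMeasurableSet, measureReal_def]
  obtain ⟨t, ht, ht'⟩ := nonempty_inter_of_measureReal_lt_add' (μ := volume)
    hB.measurableSet hsub hsub'
    (by rw [hvol, Real.volume_real_Icc_of_le hpq]; linarith) isCompact_Icc.measure_lt_top.ne
  exact mem_add.2 ⟨t, ht, p + q - t, ht', by ring⟩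

section Critical

variable {A : Set ℝ} {d : ℝ}

lemma mem_add_of_lt_volume (hA : IsCompact A) {x : ℝ} (hx : 0 ≤ x)
    (h : x < 2 * volume.real (A ∩ Icc 0 x)) : x ∈ A + A := by
  have := add_mem_add_of_lt_volume (hA.inter_right isClosed_Icc) hx inter_subset_right
    (by linarith)
  rw [zero_add] at this
  exact add_subset_add inter_subset_left inter_subset_left this

lemma add_mem_add_of_volume_lt (hA : IsCompact A) (hsub : A ⊆ Icc 0 d) {x : ℝ}
    (hx : x ∈ Icc 0 d)
    (h : 2 * volume.real (A ∩ Icc 0 x) - x < 2 * volume.real A - d) : x + d ∈ A + A := by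
  have hsplit := volume_real_inter_Icc_add hA.measurableSet hx.1 hx.2
  rw [inter_eq_self_of_subset_left hsub] at hsplit
  have := add_mem_add_of_lt_volume (hA.inter_right isClosed_Icc) hx.2 inter_subset_right
    (by linarith)
  exact add_subset_add inter_subset_left inter_subset_left this

/-- For a critical set, almost every point with two representatives in `A + A` modulo `d`
lies in `A`. -/
lemma volume_double_sdiff_eq_zero (hA : IsCompact A) (hsub : A ⊆ Icc 0 d) (h0 : 0 ∈ A)
    (hd : d ∈ A) (hsum : volume.real (A + A) = d + volume.real A)
    (hsmall : d < 2 * volume.real A) :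
    volume (({x | x ∈ A + A ∧ x + d ∈ A + A} ∩ Icc 0 d) \ A) = 0 := by
  have hd0 : 0 ≤ d := (hsub hd).1
  have hS : IsClosed (A + A) := (hA.add hA).isClosed
  set S := A + A with hSdef
  set Q : Set ℝ := (fun x => x + d) ⁻¹' (S ∩ Icc d (2 * d)) with hQ
  have hQm : MeasurableSet Q :=
    ((hS.inter isClosed_Icc).preimage (continuous_id.add continuous_const)).measurableSet
  have hQsub : Q ⊆ Icc 0 d := fun x hx => ⟨by linarith [hx.2.1], by linarith [hx.2.2]⟩
  have hPm : MeasurableSet (S ∩ Icc 0 d) := (hS.inter isClosed_Icc).measurableSet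
  have hfin : ∀ {E : Set ℝ}, E ⊆ Icc 0 d → volume E ≠ ⊤ := fun h =>
    measure_ne_top_of_subset h isCompact_Icc.measure_lt_top.ne
  have hQv : volume.real Q = volume.real (S ∩ Icc d (2 * d)) := by
    rw [measureReal_def, measure_preimage_add_right, measureReal_def]
  have hsplit := volume_real_inter_Icc_add hS.measurableSet hd0 (by linarith : d ≤ 2 * d)
  have hSsub : S ⊆ Icc 0 (2 * d) := by
    rintro _ ⟨a, ha, a', ha', rfl⟩
    have h1 := hsub ha
    have h2 := hsub ha'
    exact ⟨add_nonneg h1.1 h2.1, by linarith [h1.2, h2.2]⟩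
  rw [inter_eq_self_of_subset_left hSsub, hsum, ← hQv] at hsplit
  have hun : S ∩ Icc 0 d ∪ Q = Icc 0 d := by
    refine subset_antisymm (union_subset inter_subset_right hQsub) fun x hx => ?_
    rcases lt_or_ge x (2 * volume.real (A ∩ Icc 0 x)) with h | h
    · exact Or.inl ⟨mem_add_of_lt_volume hA hx.1 h, hx⟩
    · refine Or.inr ⟨add_mem_add_of_volume_lt hA hsub hx (by linarith), ?_, ?_⟩ <;>
        linarith [hx.1, hx.2]
  have hui := measureReal_union_add_inter (μ := volume) (s := S ∩ Icc 0 d) hQm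
    (hfin inter_subset_right) (hfin hQsub)
  rw [hun, Real.volume_real_Icc_of_le hd0, hsplit] at hui
  have hAsub : A ⊆ S ∩ Icc 0 d ∩ Q := by
    intro a ha
    have := hsub ha
    refine ⟨⟨mem_add.2 ⟨a, ha, 0, h0, add_zero a⟩, this⟩, mem_add.2 ⟨a, ha, d, hd, rfl⟩, ?_, ?_⟩ <;>
      linarith [this.1, this.2]
  have hdiff := measureReal_sdiff (μ := volume) hAsub hA.measurableSet
    (hfin (inter_subset_left.trans inter_subset_right))
  have hz : volume.real ((S ∩ Icc 0 d ∩ Q) \ A) = 0 := by linarith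
  rw [measureReal_eq_zero_iff
    (hfin (sdiff_subset.trans (inter_subset_left.trans inter_subset_right)))] at hz
  refine measure_mono_null ?_ hz
  rintro x ⟨⟨⟨h1, h2⟩, h3⟩, h4⟩
  exact ⟨⟨⟨h1, h3⟩, h2, by linarith [h3.1], by linarith [h3.2]⟩, h4⟩

/-- If `A ∩ [0, b]` is almost stable under addition within `[0, b]` and has density `1 / 2`
there, then its distribution function is bounded by a rescaling of `h`. -/
lemma volume_inter_Icc_le {h : ℝ → ℝ} (h0 : h 0 = 0)
    (hh : ∀ k : ℕ, 2 ≤ k → ∀ x : ℝ, 1 / (k : ℝ) < x → x ≤ 1 / ((k : ℝ) - 1) →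
      h x = (2 * x - 1 / (k : ℝ)) / ((k : ℝ) + 1))
    (hA : IsCompact A) (hsub : A ⊆ Ici 0) {b : ℝ}
    (hS : volume (((A + A) ∩ Icc 0 b) \ A) = 0) (hb : volume.real (A ∩ Icc 0 b) = b / 2)
    {x : ℝ} (hx : x ∈ Icc 0 b) : volume.real (A ∩ Icc 0 x) ≤ b * h (x / b) := by
  rcases hx.1.eq_or_lt with rfl | hx0
  · simp [h0, volume_real_inter_singleton]
  have hb0 : 0 < b := hx0.trans_le hx.2
  set K : Set ℝ := (volume.restrict A).support with hK
  have hKA : K ⊆ A := Measure.support_subset_of_isClosed hA.isClosed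
    (self_mem_ae_restrict hA.measurableSet)
  have hKc : IsClosed K := Measure.isClosed_support
  have hAK : volume (A \ K) = 0 := by
    have := Measure.measure_compl_support (μ := volume.restrict A)
    rw [Measure.restrict_apply' hA.measurableSet] at this
    rwa [Set.sdiff_eq, inter_comm]
  have hKadd : ∀ s ∈ K, ∀ t ∈ K, s + t < b → s + t ∈ K := by
    intro s hs t ht hst
    rw [hK, Measure.mem_support_iff_forall] at ht ⊢
    intro U hU
    have hV : (fun r => s + r) ⁻¹' (U ∩ Iio b) ∈ nhds t :=
      (continuous_const.add continuous_id).continuousAt.preimage_mem_nhds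
        (Filter.inter_mem hU (Iio_mem_nhds hst))
    have hpos := ht _ hV
    rw [Measure.restrict_apply' hA.measurableSet] at hpos ⊢
    refine pos_iff_ne_zero.2 fun hz => hpos.ne' ?_
    have h1 : volume ((fun r => s + r) ⁻¹' (U ∩ A ∪ (((A + A) ∩ Icc 0 b) \ A))) = 0 := by
      rw [measure_preimage_add]
      exact measure_union_null hz hS
    refine measure_mono_null ?_ h1
    rintro r ⟨⟨hrU, hrb⟩, hrA⟩
    by_cases hmem : s + r ∈ A
    · exact Or.inl ⟨hrU, hmem⟩
    · exact Or.inr ⟨⟨mem_add.2 ⟨s, hKA hs, r, hrA, rfl⟩,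
        add_nonneg (hsub (hKA hs)) (hsub hrA), le_of_lt hrb⟩, hmem⟩
  set T : Set ℝ := {0} ∪ K ∪ Ici b with hT
  have hTc : IsClosed T := (isClosed_singleton.union hKc).union isClosed_Ici
  have hT0 : T ⊆ Ici 0 := by
    rintro t ((rfl | ht) | ht)
    · exact self_mem_Ici
    · exact hsub (hKA ht)
    · exact hb0.le.trans ht
  have hTadd : ∀ s ∈ T, ∀ t ∈ T, s + t ∈ T := by
    intro s hs t ht
    rcases le_or_gt b (s + t) with hst | hst
    · exact Or.inr hst
    have hs0 : 0 ≤ s := hT0 hs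
    have ht0 : 0 ≤ t := hT0 ht
    rcases hs with (rfl | hs) | hs
    · simpa using ht
    · rcases ht with (rfl | ht) | ht
      · rw [add_zero]; exact Or.inl (Or.inr hs)
      · exact Or.inl (Or.inr (hKadd s hs t ht hst))
      · have : b ≤ t := ht
        linarith
    · have : b ≤ s := hs
      linarith
  have hvol : ∀ y ≤ b, volume.real (T ∩ Icc 0 y) = volume.real (A ∩ Icc 0 y) := by
    intro y hy
    refine congrArg ENNReal.toReal (le_antisymm ?_ ?_)
    · refine (measure_mono (t := (A ∩ Icc 0 y) ∪ {0, b}) ?_).trans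
        ((measure_union_le _ _).trans (by
          rw [(Set.toFinite ({0, b} : Set ℝ)).measure_zero, add_zero]))
      rintro t ⟨(rfl | ht) | ht, hty⟩
      · exact Or.inr (Or.inl rfl)
      · exact Or.inl ⟨hKA ht, hty⟩
      · exact Or.inr (Or.inr (le_antisymm (hty.2.trans hy) ht))
    · refine (measure_mono (t := (T ∩ Icc 0 y) ∪ A \ K) ?_).trans
        ((measure_union_le _ _).trans (by rw [hAK, add_zero]))
      rintro t ⟨htA, hty⟩
      by_cases htK : t ∈ K
      · exact Or.inl ⟨Or.inl (Or.inr htK), hty⟩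
      · exact Or.inr ⟨htA, htK⟩
  have hyb : x / b ∈ Ioc 0 1 := ⟨by positivity, (div_le_one hb0).2 hx.2⟩
  obtain ⟨hh0, hle⟩ := affine_le_of_eq_on_pieces hh hyb.1 hyb.2
  obtain ⟨z, ⟨hzT, hz⟩, hzmax⟩ := (isCompact_Icc.inter_left hTc).exists_isGreatest
    (show (T ∩ Icc 0 x).Nonempty from ⟨0, Or.inl (Or.inl rfl), le_rfl, hx.1⟩)
  have hzx : T ∩ Icc 0 x = T ∩ Icc 0 z := by
    ext t
    exact ⟨fun ht => ⟨ht.1, ht.2.1, hzmax ht⟩, fun ht => ⟨ht.1, ht.2.1, ht.2.2.trans hz.2⟩⟩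
  rw [← hvol x hx.2, hzx]
  rcases hz.1.eq_or_lt with rfl | hz0
  · rw [Icc_self, volume_real_inter_singleton]
    positivity
  obtain ⟨n, hn, hnz⟩ := exists_volume_semigroup_le hTc (Or.inl (Or.inl rfl)) hTadd
    subset_union_right ((hvol b le_rfl).trans hb) hzT hz0 (hz.2.trans hx.2)
  have hn0 : (0 : ℝ) < n := by exact_mod_cast hn
  calc volume.real (T ∩ Icc 0 z) ≤ (2 * z - b / n) / (n + 1) := hnz
    _ ≤ (2 * x - b / n) / (n + 1) := by gcongr; exact hz.2
    _ = b * ((2 * (x / b) - 1 / n) / (n + 1)) := by field_simp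
    _ ≤ b * h (x / b) := by gcongr; exact hle n hn

/-- Reflected form of `volume_inter_Icc_le`, for the right end of `A`. -/
lemma le_volume_inter_Icc {h : ℝ → ℝ} (h0 : h 0 = 0)
    (hh : ∀ k : ℕ, 2 ≤ k → ∀ x : ℝ, 1 / (k : ℝ) < x → x ≤ 1 / ((k : ℝ) - 1) →
      h x = (2 * x - 1 / (k : ℝ)) / ((k : ℝ) + 1))
    (hA : IsCompact A) (hsub : A ⊆ Icc 0 d) {c : ℝ} (hc : c ∈ Icc 0 d)
    (hS : volume (({x | x + d ∈ A + A} ∩ Icc c d) \ A) = 0)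
    (hcv : volume.real (A ∩ Icc c d) = (d - c) / 2) {x : ℝ} (hx : x ∈ Icc c d) :
    volume.real A - (d - c) * h ((d - x) / (d - c)) ≤ volume.real (A ∩ Icc 0 x) := by
  have hmp := Measure.measurePreserving_sub_left (volume : Measure ℝ) d
  set B : Set ℝ := (fun t => d - t) ⁻¹' A with hB
  have hBA : ∀ y, volume.real (B ∩ Icc 0 y) = volume.real (A ∩ Icc (d - y) d) := by
    intro y
    rw [measureReal_def, measureReal_def, ← hmp.measure_preimage
      (hA.measurableSet.inter measurableSet_Icc).nullMeasurableSet]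
    congr 2
    ext t
    simp only [hB, mem_inter_iff, mem_preimage, mem_Icc]
    refine and_congr_right fun _ => ⟨fun h => ⟨?_, ?_⟩, fun h => ⟨?_, ?_⟩⟩ <;>
      linarith [h.1, h.2]
  have hBc : IsCompact B := by
    refine (isCompact_Icc (a := 0) (b := d)).of_isClosed_subset
      (hA.isClosed.preimage (continuous_const.sub continuous_id)) fun t ht => ?_
    have := hsub ht
    constructor <;> linarith [this.1, this.2]
  have hBsub : B ⊆ Ici 0 := fun t ht => by
    have := (hsub ht).2
    simp only [mem_Ici]
    linarith
  have hBS : volume (((B + B) ∩ Icc 0 (d - c)) \ B) = 0 := by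
    rw [← hmp.measure_preimage (NullMeasurableSet.of_null hS)] at hS
    refine measure_mono_null ?_ hS
    rintro t ⟨⟨ht, ht0, htc⟩, htB⟩
    obtain ⟨u, hu, v, hv, rfl⟩ := mem_add.1 ht
    refine ⟨⟨mem_add.2 ⟨d - u, hu, d - v, hv, by ring⟩, ?_, ?_⟩, htB⟩ <;> linarith
  have key := volume_inter_Icc_le h0 hh hBc hBsub hBS
    (by rw [hBA, sub_sub_cancel]; exact hcv) (x := d - x)
    ⟨by linarith [hx.2], by linarith [hx.1]⟩
  rw [hBA, sub_sub_cancel] at key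
  have hsplit := volume_real_inter_Icc_add hA.measurableSet (hc.1.trans hx.1) hx.2
  rw [inter_eq_self_of_subset_left hsub] at hsplit
  linarith

end Critical

lemma continuous_volume_inter_Icc (A : Set ℝ) :
    Continuous fun x => volume.real (A ∩ Icc 0 x) := by
  have hfin : ∀ u v : ℝ, volume (Icc u v) ≠ ⊤ := fun u v => isCompact_Icc.measure_lt_top.ne
  have key : ∀ x y : ℝ, x ≤ y → volume.real (A ∩ Icc 0 x) ≤ volume.real (A ∩ Icc 0 y) ∧
      volume.real (A ∩ Icc 0 y) ≤ volume.real (A ∩ Icc 0 x) + (y - x) := by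
    intro x y hxy
    refine ⟨measureReal_mono (inter_subset_inter_right _ (Icc_subset_Icc_right hxy))
      (measure_ne_top_of_subset inter_subset_right (hfin 0 y)), ?_⟩
    rw [← Real.volume_real_Icc_of_le hxy]
    refine (measureReal_mono (s₂ := (A ∩ Icc 0 x) ∪ Icc x y) ?_ ?_).trans
      (measureReal_union_le _ _)
    · rintro t ⟨htA, ht⟩
      rcases le_total t x with htx | htx
      · exact Or.inl ⟨htA, ht.1, htx⟩
      · exact Or.inr ⟨htx, ht.2⟩
    · exact measure_union_ne_top (measure_ne_top_of_subset inter_subset_right (hfin 0 x))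
        (hfin x y)
  refine (LipschitzWith.of_dist_le_mul (K := 1) fun x y => ?_).continuous
  rw [NNReal.coe_one, one_mul, Real.dist_eq, Real.dist_eq]
  rcases le_total x y with hxy | hxy
  · have := key x y hxy
    rw [abs_sub_comm, abs_sub_comm x, abs_of_nonneg (by linarith), abs_of_nonneg (by linarith)]
    linarith
  · have := key y x hxy
    rw [abs_of_nonneg (by linarith), abs_of_nonneg (by linarith)]
    linarith

/-- A continuous function that has slope `1` wherever its values lie in `(0, D)` cannot leave
that range downwards. -/
lemma le_of_slope_one {f : ℝ → ℝ} (hf : Continuous f) {D p q : ℝ} (hD : 0 < D) (hpq : p ≤ q)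
    (hslope : ∀ r s, p ≤ r → r ≤ s → s ≤ q → (∀ t ∈ Ioo r s, f t ∈ Ioo 0 D) →
      f s - f r = s - r)
    (hp : 0 < f p) (hq : f q < D) : f p ≤ f q := by
  by_contra! hlt
  obtain ⟨v, hv1, hv2⟩ : ∃ v, max (f q) 0 < v ∧ v < min (f p) D :=
    exists_between (max_lt (lt_min hlt hq) (lt_min hp hD))
  obtain ⟨w, hw1, hw2⟩ := exists_between hv2
  rw [max_lt_iff] at hv1
  rw [lt_min_iff] at hw2
  obtain ⟨r, ⟨hr, hwr⟩, hrmax⟩ := (isCompact_Icc.inter_right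
    (isClosed_Ici.preimage hf)).exists_isGreatest
    (show (Icc p q ∩ f ⁻¹' Ici w).Nonempty from ⟨p, ⟨le_rfl, hpq⟩, hw2.1.le⟩)
  obtain ⟨s, ⟨hs, hvs⟩, hsmin⟩ := (isCompact_Icc.inter_right
    (isClosed_Iic.preimage hf)).exists_isLeast
    (show (Icc r q ∩ f ⁻¹' Iic v).Nonempty from ⟨q, ⟨hr.2, le_rfl⟩, hv1.1.le⟩)
  have := hslope r s hr.1 hs.1 hs.2 fun t ht => by
    refine ⟨?_, ?_⟩
    · by_contra! h
      exact absurd (hsmin ⟨⟨ht.1.le, ht.2.le.trans hs.2⟩, (h.trans hv1.2.le : f t ≤ v)⟩)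
        (not_le.2 ht.2)
    · by_contra! h
      exact absurd (hrmax ⟨⟨hr.1.trans ht.1.le, ht.2.le.trans hs.2⟩,
        (hw2.2.le.trans h : w ≤ f t)⟩) (not_le.2 ht.1)
  have h1 : w ≤ f r := hwr
  have h2 : f s ≤ v := hvs
  linarith [hs.1]

/-- The description of the distribution function of a critical set with minimum `0`. -/
lemma exists_distribution_of_critical {h : ℝ → ℝ} (h0 : h 0 = 0)
    (hh : ∀ k : ℕ, 2 ≤ k → ∀ x : ℝ, 1 / (k : ℝ) < x → x ≤ 1 / ((k : ℝ) - 1) →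
      h x = (2 * x - 1 / (k : ℝ)) / ((k : ℝ) + 1))
    {A : Set ℝ} {d Δ : ℝ} (hA : IsCompact A) (hsub : A ⊆ Icc 0 d) (h0A : 0 ∈ A) (hdA : d ∈ A)
    (hsum : volume.real (A + A) = d + volume.real A)
    (hΔ : Δ = 2 * volume.real A - d) (hΔ0 : 0 < Δ) :
    ∃ b ∈ Icc 0 (d - Δ),
      (∀ x ∈ Icc b (b + Δ), volume.real (A ∩ Icc 0 x) = x - b / 2) ∧
      (∀ x ∈ Icc 0 b, volume.real (A ∩ Icc 0 x) ≤ b * h (x / b)) ∧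
      (∀ x ∈ Icc (b + Δ) d, volume.real (A ∩ Icc 0 x) ≥
        volume.real A - (d - Δ - b) * h ((d - x) / (d - Δ - b))) := by
  have hd0 : 0 ≤ d := (hsub hdA).1
  have hnull := volume_double_sdiff_eq_zero hA hsub h0A hdA hsum (by linarith)
  set f : ℝ → ℝ := fun x => 2 * volume.real (A ∩ Icc 0 x) - x with hf
  have hfc : Continuous f :=
    ((continuous_volume_inter_Icc A).const_mul 2).sub continuous_id
  have hf0 : f 0 = 0 := by
    simp [hf, volume_real_inter_singleton]
  have hfd : f d = Δ := by
    simp only [hf, inter_eq_self_of_subset_left hsub]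
    linarith
  have hpos : ∀ x ∈ Icc 0 d, 0 < f x → x ∈ A + A := fun x hx h =>
    mem_add_of_lt_volume hA hx.1 (by simp only [hf] at h; linarith)
  have hlt : ∀ x ∈ Icc 0 d, f x < Δ → x + d ∈ A + A := fun x hx h =>
    add_mem_add_of_volume_lt hA hsub hx (by simp only [hf] at h; linarith)
  have hslope : ∀ r s, 0 ≤ r → r ≤ s → s ≤ d → (∀ t ∈ Ioo r s, f t ∈ Ioo 0 Δ) →
      f s - f r = s - r := by
    intro r s hr hrs hs hrange
    have hsplit := volume_real_inter_Icc_add hA.measurableSet hr hrs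
    have hfin : volume (Icc r s) ≠ ⊤ := isCompact_Icc.measure_lt_top.ne
    have hle : volume.real (A ∩ Icc r s) ≤ s - r := by
      rw [← Real.volume_real_Icc_of_le hrs]
      exact measureReal_mono inter_subset_right hfin
    have hge : s - r ≤ volume.real (A ∩ Icc r s) := by
      rw [← Real.volume_real_Ioo_of_le hrs]
      refine ENNReal.toReal_mono (measure_ne_top_of_subset inter_subset_right hfin) ?_
      refine (measure_mono (t := (A ∩ Icc r s) ∪ _) fun t ht => ?_).trans
        ((measure_union_le _ _).trans (by rw [hnull, add_zero]))
      by_cases htA : t ∈ A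
      · exact Or.inl ⟨htA, ht.1.le, ht.2.le⟩
      · have htd : t ∈ Icc 0 d := ⟨hr.trans ht.1.le, ht.2.le.trans hs⟩
        have hft := hrange t ht
        exact Or.inr ⟨⟨⟨hpos t htd hft.1, hlt t htd hft.2⟩, htd⟩, htA⟩
    simp only [hf]
    linarith
  obtain ⟨b, ⟨hb, hfb⟩, hbmax⟩ := (isCompact_Icc.inter_right
    (isClosed_Iic.preimage hfc)).exists_isGreatest
    (show (Icc 0 d ∩ f ⁻¹' Iic 0).Nonempty from ⟨0, ⟨le_rfl, hd0⟩, hf0.le⟩)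
  replace hfb : f b = 0 := by
    obtain ⟨t, ht, hft⟩ := intermediate_value_Icc hb.2 hfc.continuousOn
      (show (0 : ℝ) ∈ Icc (f b) (f d) from ⟨hfb, by linarith⟩)
    have : t ≤ b := hbmax ⟨⟨hb.1.trans ht.1, ht.2⟩, hft.le⟩
    rwa [le_antisymm this ht.1] at hft
  obtain ⟨c, ⟨hc, hfc'⟩, hcmin⟩ := (isCompact_Icc.inter_right
    (isClosed_Ici.preimage hfc)).exists_isLeast
    (show (Icc b d ∩ f ⁻¹' Ici Δ).Nonempty from ⟨d, ⟨hb.2, le_rfl⟩, hfd.ge⟩)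
  replace hfc' : f c = Δ := by
    obtain ⟨t, ht, hft⟩ := intermediate_value_Icc hc.1 hfc.continuousOn
      (show Δ ∈ Icc (f b) (f c) from ⟨by linarith, hfc'⟩)
    have : c ≤ t := hcmin ⟨⟨ht.1, ht.2.trans hc.2⟩, hft.ge⟩
    rwa [le_antisymm ht.2 this] at hft
  have hmid : ∀ t ∈ Ioo b c, f t ∈ Ioo 0 Δ := by
    intro t ht
    refine ⟨?_, ?_⟩
    · by_contra! h
      exact absurd (hbmax ⟨⟨hb.1.trans ht.1.le, ht.2.le.trans hc.2⟩, h⟩) (not_le.2 ht.1)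
    · by_contra! h
      exact absurd (hcmin ⟨⟨ht.1.le, ht.2.le.trans hc.2⟩, h⟩) (not_le.2 ht.2)
  have hcb : c = b + Δ := by
    have := hslope b c hb.1 hc.1 hc.2 hmid
    linarith
  subst hcb
  have hleft : ∀ x ∈ Icc 0 b, f x ≤ 0 := by
    intro x hx
    by_contra! h
    have := le_of_slope_one hfc hΔ0 hx.2
      (fun r s hr hrs hs => hslope r s (hx.1.trans hr) hrs (hs.trans hb.2)) h (by linarith)
    linarith
  have hright : ∀ x ∈ Icc (b + Δ) d, Δ ≤ f x := by
    intro x hx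
    by_contra! h
    have := le_of_slope_one hfc hΔ0 hx.1
      (fun r s hr hrs hs => hslope r s (by linarith [hb.1]) hrs (hs.trans hx.2))
      (by linarith) h
    linarith
  have hc0 : 0 ≤ b + Δ := by linarith [hb.1]
  refine ⟨b, ⟨hb.1, by linarith [hc.2]⟩, fun x hx => ?_, fun x hx => ?_, fun x hx => ?_⟩
  · have := hslope b x hb.1 hx.1 (hx.2.trans hc.2) fun t ht => hmid t ⟨ht.1, ht.2.trans_le hx.2⟩
    simp only [hf] at this hfb
    linarith
  · refine volume_inter_Icc_le h0 hh hA (hsub.trans Icc_subset_Ici_self) ?_ ?_ hx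
    · refine measure_mono_null ?_ hnull
      rintro t ⟨⟨htS, ht⟩, htA⟩
      have htd : t ∈ Icc 0 d := ⟨ht.1, ht.2.trans hb.2⟩
      exact ⟨⟨⟨htS, hlt t htd (by linarith [hleft t ht])⟩, htd⟩, htA⟩
    · simp only [hf] at hfb
      linarith
  · have hsplit := volume_real_inter_Icc_add hA.measurableSet hc0 hc.2
    rw [inter_eq_self_of_subset_left hsub] at hsplit
    rw [sub_right_comm, sub_sub d b]
    refine le_volume_inter_Icc h0 hh hA hsub ⟨hc0, hc.2⟩ ?_ ?_ hx
    · refine measure_mono_null ?_ hnull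
      rintro t ⟨⟨htS, ht⟩, htA⟩
      have htd : t ∈ Icc 0 d := ⟨hc0.trans ht.1, ht.2⟩
      exact ⟨⟨⟨hpos t htd (by linarith [hright t ht]), htS⟩, htd⟩, htA⟩
    · simp only [hf] at hfc'
      linarith

/-- Corollary 2.5 (`critA_new`): description of the distribution function of a critical set
for Ruzsa's inequality in the symmetric case. The function `h` is the continuous piecewise
affine function with `h 0 = 0` and `h x = (2x - 1/k)/(k+1)` on `(1/k, 1/(k-1)]` for every
integer `k ≥ 2`. (When `b = 0`, resp. `d - Δ - b = 0`, division by zero gives `x / 0 = 0`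
and `h 0 = 0`, so the corresponding bound is `0`, matching the stated convention.) -/
theorem critical_set_distribution (h : ℝ → ℝ) (h0 : h 0 = 0)
    (hh : ∀ k : ℕ, 2 ≤ k → ∀ x : ℝ, 1 / (k : ℝ) < x → x ≤ 1 / ((k : ℝ) - 1) →
      h x = (2 * x - 1 / (k : ℝ)) / ((k : ℝ) + 1))
    (A : Set ℝ) (hA : IsCompact A) (hne : A.Nonempty) (hpos : 0 < volume A)
    (d : ℝ) (hd : d = sSup A - sInf A)
    (hsum : (volume (A + A)).toReal = d + (volume A).toReal)
    (hsmall : d + (volume A).toReal < 3 * (volume A).toReal)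
    (Δ : ℝ) (hΔ : Δ = 2 * (volume A).toReal - d)
    (g : ℝ → ℝ) (hg : ∀ x, g x = (volume ((fun a => a - sInf A) '' A ∩ Icc 0 x)).toReal) :
    ∃ b ∈ Icc 0 (d - Δ),
      (∀ x ∈ Icc b (b + Δ), g x = x - b / 2) ∧
      (∀ x ∈ Icc 0 b, g x ≤ b * h (x / b)) ∧
      (∀ x ∈ Icc (b + Δ) d,
        g x ≥ (volume A).toReal - (d - Δ - b) * h ((d - x) / (d - Δ - b))) := by
  set m := sInf A with hm
  have himg : (fun a => a - m) '' A = (fun t => t + m) ⁻¹' A := by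
    rw [image_eq_preimage_of_inverse] <;> intro t <;> simp
  have hvol : volume.real ((fun a => a - m) '' A) = volume.real A := by
    rw [himg, measureReal_def, measure_preimage_add_right, measureReal_def]
  have hadd : (fun a => a - m) '' A + (fun a => a - m) '' A =
      (fun t => t + 2 * m) ⁻¹' (A + A) := by
    ext t
    simp only [himg, mem_add, mem_preimage]
    constructor
    · rintro ⟨u, hu, v, hv, rfl⟩
      exact ⟨_, hu, _, hv, by ring⟩
    · rintro ⟨u, hu, v, hv, huv⟩
      exact ⟨u - m, by simpa using hu, v - m, by simpa using hv, by linear_combination huv⟩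
  have hsub : (fun a => a - m) '' A ⊆ Icc 0 d := by
    rintro _ ⟨a, ha, rfl⟩
    have h1 := csInf_le hA.bddBelow ha
    have h2 := le_csSup hA.bddAbove ha
    constructor <;> linarith
  have hcpt : IsCompact ((fun a => a - m) '' A) := hA.image (by fun_prop)
  obtain ⟨b, hb, hb'⟩ := exists_distribution_of_critical (Δ := Δ) h0 hh hcpt hsub
    ⟨m, hA.sInf_mem hne, sub_self m⟩ ⟨sSup A, hA.sSup_mem hne, hd.symm⟩
    (by rw [hadd, measureReal_def, measure_preimage_add_right, hvol]; exact hsum)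
    (hvol ▸ hΔ) (by linarith)
  refine ⟨b, hb, ?_⟩
  simp only [hg]
  rw [hvol] at hb'
  exact hb'
end

section
/- Let b > 0 and let A be a compact subset of [0, b] with min(A) = 0, max(A) = b, and λ((A + A) ∩ [0, b]) = λ(A). Then there exists a closed set K ⊆ A with min(K) = 0, max(K) = b, λ(K) = λ(A), and (K + K) ∩ [0, b] = K. -/
open MeasureTheory Pointwise Set

/-- Two points of the support of `A` whose sum lies in an open set on which `A + A` is almost
contained in `A` add up to a point of the support of `A`. -/
lemma add_mem_support_restrict {A O : Set ℝ} (hA : MeasurableSet A) (hO : IsOpen O)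
    (hnull : volume (((A + A) ∩ O) \ A) = 0) {x y : ℝ}
    (hx : x ∈ (volume.restrict A).support) (hy : y ∈ (volume.restrict A).support)
    (hxy : x + y ∈ O) : x + y ∈ (volume.restrict A).support := by
  rw [Measure.mem_support_iff_forall] at hx hy ⊢
  intro U hU
  have hUO : U ∩ O ∈ nhds (x + y) := Filter.inter_mem hU (hO.mem_nhds hxy)
  have hcont : Filter.Tendsto (fun p : ℝ × ℝ => p.1 + p.2) (nhds (x, y)) (nhds (x + y)) :=
    continuous_add.tendsto (x, y)
  obtain ⟨V, hV, W, hW, hVW⟩ := mem_nhds_prod_iff.1 (hcont hUO)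
  have hVpos := hx V hV
  have hWpos := hy W hW
  rw [Measure.restrict_apply' hA] at hVpos hWpos ⊢
  obtain ⟨w, hwW, hwA⟩ := nonempty_of_measure_ne_zero hWpos.ne'
  have htrans : (fun v => v + w) '' (V ∩ A) ⊆ (U ∩ A) ∪ (((A + A) ∩ O) \ A) := by
    rintro _ ⟨v, ⟨hvV, hvA⟩, rfl⟩
    have hmem : v + w ∈ U ∩ O := hVW (mk_mem_prod hvV hwW)
    by_cases h : v + w ∈ A
    · exact Or.inl ⟨hmem.1, h⟩
    · exact Or.inr ⟨⟨add_mem_add hvA hwA, hmem.2⟩, h⟩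
  calc 0 < volume (V ∩ A) := hVpos
    _ = volume ((fun v => v + w) '' (V ∩ A)) := by
      rw [image_add_right, measure_preimage_add_right]
    _ ≤ volume ((U ∩ A) ∪ (((A + A) ∩ O) \ A)) := measure_mono htrans
    _ ≤ volume (U ∩ A) + volume (((A + A) ∩ O) \ A) := measure_union_le _ _
    _ = volume (U ∩ A) := by rw [hnull, add_zero]

/-- The claim, from the proof of Corollary 2.5: if `A ⊆ [0, b]` is compact with
`min A = 0`, `max A = b` and `λ((A + A) ∩ [0, b]) = λ(A)`, then there is a closed
subset `K ⊆ A` of full measure which is genuinely additively left-stable. -/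
theorem exists_leftStable_closed_subset (b : ℝ) (hb : 0 < b)
    (A : Set ℝ) (hA : IsCompact A) (hsub : A ⊆ Icc 0 b)
    (hinf : sInf A = 0) (hsup : sSup A = b)
    (hmeas : volume ((A + A) ∩ Icc 0 b) = volume A) :
    ∃ K : Set ℝ, IsClosed K ∧ K ⊆ A ∧ sInf K = 0 ∧ sSup K = b ∧
      volume K = volume A ∧ (K + K) ∩ Icc 0 b = K := by
  have hne : A.Nonempty := by
    rw [nonempty_iff_ne_empty]
    rintro rfl
    rw [Real.sSup_empty] at hsup
    exact hb.ne hsup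
  have h0A : (0 : ℝ) ∈ A := hinf ▸ hA.sInf_mem hne
  have hbA : b ∈ A := by simpa only [hsup] using hA.sSup_mem hne
  have hAsum : A ⊆ (A + A) ∩ Icc 0 b := fun a ha =>
    ⟨⟨0, h0A, a, ha, zero_add a⟩, hsub ha⟩
  have hdiff : volume (((A + A) ∩ Icc 0 b) \ A) = 0 := by
    rw [measure_sdiff hAsum hA.measurableSet.nullMeasurableSet hA.measure_lt_top.ne, hmeas,
      tsub_self]
  have hnull : volume (((A + A) ∩ Iio b) \ A) = 0 := by
    refine measure_mono_null (sdiff_subset_sdiff_left ?_) hdiff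
    rintro _ ⟨⟨x, hx, y, hy, rfl⟩, hlt⟩
    exact ⟨add_mem_add hx hy, add_nonneg (hsub hx).1 (hsub hy).1, le_of_lt hlt⟩
  set S := (volume.restrict A).support
  have hSA : S ⊆ A := Measure.support_restrict_subset.trans
    (inter_subset_left.trans hA.isClosed.closure_subset)
  have hKA : {0, b} ∪ S ⊆ A := union_subset (pair_subset h0A hbA) hSA
  have h0K : (0 : ℝ) ∈ {0, b} ∪ S := by simp
  have hbK : b ∈ {0, b} ∪ S := by simp
  refine ⟨{0, b} ∪ S, (toFinite {0, b}).isClosed.union Measure.isClosed_support, hKA, ?_, ?_, ?_,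
    ?_⟩
  · exact IsLeast.csInf_eq ⟨h0K, fun x hx => (hsub (hKA hx)).1⟩
  · exact IsGreatest.csSup_eq ⟨hbK, fun x hx => (hsub (hKA hx)).2⟩
  · refine le_antisymm (measure_mono hKA) ?_
    have hSc : volume (Sᶜ ∩ A) = 0 := by
      rw [← Measure.restrict_apply' hA.measurableSet]
      exact Measure.measure_compl_support
    calc volume A ≤ volume (({0, b} ∪ S) ∪ (Sᶜ ∩ A)) := measure_mono fun a ha => by
          by_cases h : a ∈ S
          · exact Or.inl (Or.inr h)
          · exact Or.inr ⟨h, ha⟩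
      _ ≤ volume ({0, b} ∪ S) + volume (Sᶜ ∩ A) := measure_union_le _ _
      _ = volume ({0, b} ∪ S) := by rw [hSc, add_zero]
  · refine Subset.antisymm ?_ fun x hx => ⟨⟨0, h0K, x, hx, zero_add x⟩, hsub (hKA hx)⟩
    rintro _ ⟨⟨x, hx, y, hy, rfl⟩, -, hle⟩
    have hx0 := (hsub (hKA hx)).1
    have hy0 := (hsub (hKA hy)).1
    change x + y ∈ {0, b} ∪ S
    change x + y ≤ b at hle
    rcases hle.eq_or_lt with heq | hlt
    · exact heq ▸ hbK
    rcases hx with (rfl | rfl) | hxS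
    · simpa only [zero_add] using hy
    · linarith
    rcases hy with (rfl | rfl) | hyS
    · exact (add_zero x).symm ▸ Or.inr hxS
    · linarith
    exact Or.inr (add_mem_support_restrict hA.measurableSet isOpen_Iio hnull hxS hyS hlt)
end

section
/- Let A and B be finite nonempty subsets of ℤ with |B| ≥ 3, and let s' ≥ 1 be an integer such that 2|A| ≥ s'(s'−1)(|B| − 2) + 2s'. If B is not contained in any arithmetic progression of integers of size at most |A + B| − |A| + 1, then |A + B| ≥ |A| + s'(|B| − 2) + 1. -/
open Pointwise

set_option linter.unusedSectionVars false

namespace Grynkiewicz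

section Kneser

variable {G : Type*} [AddCommGroup G]

/-- The subgroup of translations preserving a finite set. -/
def period (S : Finset G) : AddSubgroup G where
  carrier := {g | ∀ x, x + g ∈ S ↔ x ∈ S}
  zero_mem' := by simp
  add_mem' := by
    intro a b ha hb x
    rw [← add_assoc, hb, ha]
  neg_mem' := by
    intro a ha x
    rw [← ha (x + -a)]
    simp

theorem mem_period {S : Finset G} {g : G} : g ∈ period S ↔ ∀ x, x + g ∈ S ↔ x ∈ S := Iff.rfl

theorem mem_period_of_forall_add_mem [DecidableEq G] {S : Finset G} {g : G}
    (h : ∀ x ∈ S, x + g ∈ S) : g ∈ period S := by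
  have hsub : S.image (· + g) ⊆ S := by
    intro y hy
    obtain ⟨x, hx, rfl⟩ := Finset.mem_image.1 hy
    exact h x hx
  have heq : S.image (· + g) = S :=
    Finset.eq_of_subset_of_card_le hsub (Finset.card_image_of_injective _ (add_left_injective g)).ge
  intro x
  refine ⟨fun hx => ?_, h x⟩
  rw [← heq] at hx
  obtain ⟨y, hy, hyx⟩ := Finset.mem_image.1 hx
  rwa [← add_right_cancel hyx]

variable [Fintype G]

open Classical in
/-- The underlying finite set of a subgroup of a finite group. -/
noncomputable def toFin (K : AddSubgroup G) : Finset G := Finset.univ.filter (· ∈ K)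

@[simp] theorem mem_toFin {K : AddSubgroup G} {g : G} : g ∈ toFin K ↔ g ∈ K := by simp [toFin]

theorem toFin_card_pos (K : AddSubgroup G) : 0 < (toFin K).card :=
  Finset.card_pos.2 ⟨0, by simp⟩

variable [DecidableEq G]

theorem card_add_toFin_eq (K : AddSubgroup G) [DecidableEq (G ⧸ K)] (S : Finset G)
    (hS : ∀ g ∈ K, ∀ x ∈ S, x + g ∈ S) :
    S.card = (toFin K).card * (S.image (QuotientAddGroup.mk : G → G ⧸ K)).card := by
  rw [Finset.card_eq_sum_card_image (QuotientAddGroup.mk : G → G ⧸ K) S,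
    Finset.sum_const_nat (m := (toFin K).card), mul_comm]
  intro z hz
  obtain ⟨x, hx, rfl⟩ := Finset.mem_image.1 hz
  rw [← Finset.card_image_of_injective (toFin K) (add_right_injective x)]
  congr 1
  ext y
  simp only [Finset.mem_filter, Finset.mem_image, mem_toFin]
  constructor
  · rintro ⟨_, hyx⟩
    exact ⟨-x + y, QuotientAddGroup.eq.1 hyx.symm, by abel⟩
  · rintro ⟨g, hg, rfl⟩
    exact ⟨hS g hg x hx, QuotientAddGroup.eq.2 (by simpa using hg)⟩

theorem card_toFin_dvd (K : AddSubgroup G) (S : Finset G)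
    (hS : ∀ g ∈ K, ∀ x ∈ S, x + g ∈ S) : (toFin K).card ∣ S.card := by
  classical
  exact ⟨_, card_add_toFin_eq K S hS⟩

theorem exists_subset_add_of_zero_mem (n : ℕ) : ∀ A B : Finset G, B.card ≤ n → 0 ∈ B → ∀ a ∈ A,
    ∃ C ⊆ A + B, a ∈ C ∧ A.card + B.card ≤ C.card + (toFin (period C)).card := by
  induction n with
  | zero =>
    intro A B hB h0
    have := Finset.card_pos.2 ⟨0, h0⟩
    omega
  | succ n ih =>
    intro A B hB h0 a ha
    by_cases hall : ∀ e ∈ A, ∀ b ∈ B, b + e ∈ A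
    · refine ⟨A, fun x hx => ?_, ha, ?_⟩
      · simpa using Finset.add_mem_add hx h0
      · have : B ⊆ toFin (period A) := by
          intro b hb
          rw [mem_toFin]
          refine mem_period_of_forall_add_mem fun x hx => ?_
          rw [add_comm]
          exact hall x hx b hb
        have := Finset.card_le_card this
        omega
    · push Not at hall
      obtain ⟨e, he, b, hb, hbe⟩ := hall
      set B' := B.filter (fun b => b + e ∈ A) with hB'
      set A' := A ∪ B.image (· + e) with hA'
      have hlt : B'.card < B.card := by
        refine Finset.card_lt_card (Finset.filter_ssubset.2 ⟨b, hb, hbe⟩)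
      have hcard : A'.card + B'.card = A.card + B.card := by
        have h1 := Finset.card_union_add_card_inter A (B.image (· + e))
        have h2 : A ∩ B.image (· + e) = B'.image (· + e) := by
          ext y
          simp only [hB', Finset.mem_inter, Finset.mem_image, Finset.mem_filter]
          constructor
          · rintro ⟨hy, x, hx, rfl⟩
            exact ⟨x, ⟨hx, hy⟩, rfl⟩
          · rintro ⟨x, ⟨hx, hy⟩, rfl⟩
            exact ⟨hy, x, hx, rfl⟩
        rw [h2, Finset.card_image_of_injective _ (add_left_injective e),
          Finset.card_image_of_injective _ (add_left_injective e)] at h1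
        exact h1
      obtain ⟨C, hC, haC, hCc⟩ := ih A' B' (by omega) (by simp [hB', h0, he]) a
        (Finset.mem_union_left _ ha)
      refine ⟨C, hC.trans ?_, haC, by omega⟩
      intro z hz
      obtain ⟨x, hx, y, hy, rfl⟩ := Finset.mem_add.1 hz
      rw [hB', Finset.mem_filter] at hy
      rcases Finset.mem_union.1 hx with hx | hx
      · exact Finset.add_mem_add hx hy.1
      · obtain ⟨b, hb, rfl⟩ := Finset.mem_image.1 hx
        have := Finset.add_mem_add hy.2 hb
        convert this using 1
        abel

theorem exists_subset_add (A B : Finset G) {a b : G} (ha : a ∈ A) (hb : b ∈ B) :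
    ∃ C ⊆ A + B, a + b ∈ C ∧ A.card + B.card ≤ C.card + (toFin (period C)).card := by
  obtain ⟨C, hC, haC, hCc⟩ := exists_subset_add_of_zero_mem _ (A.image (· + b))
    (B.image (· - b)) le_rfl (Finset.mem_image.2 ⟨b, hb, by simp⟩) (a + b)
    (Finset.mem_image.2 ⟨a, ha, rfl⟩)
  refine ⟨C, hC.trans ?_, haC, ?_⟩
  · intro z hz
    obtain ⟨x, hx, y, hy, rfl⟩ := Finset.mem_add.1 hz
    obtain ⟨x, hx, rfl⟩ := Finset.mem_image.1 hx
    obtain ⟨y, hy, rfl⟩ := Finset.mem_image.1 hy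
    have hxy : x + b + (y - b) = x + y := by abel
    rw [hxy]
    exact Finset.add_mem_add (by assumption) (by assumption)
  · rwa [Finset.card_image_of_injective _ (add_left_injective b),
      Finset.card_image_of_injective _ (sub_left_injective)] at hCc

theorem mul_card_sdiff_ge (C₁ C₂ : Finset G) (H₁ H₂ : AddSubgroup G)
    (h₁ : ∀ g ∈ H₁, ∀ x, x + g ∈ C₁ ↔ x ∈ C₁) (h₂ : ∀ g ∈ H₂, ∀ x, x + g ∈ C₂ ↔ x ∈ C₂) (x : G) :
    ((toFin H₂).filter (fun h => x + h ∈ C₁)).card *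
        ((toFin H₁).filter (fun h => x + h ∉ C₂)).card ≤
      (toFin (H₁ ⊓ H₂)).card * (C₁ \ C₂).card := by
  rw [← Finset.card_product]
  refine (Finset.card_le_mul_card_image (f := fun p : G × G => x + p.1 + p.2) _
    (toFin (H₁ ⊓ H₂)).card ?_).trans (Nat.mul_le_mul_left _ (Finset.card_le_card ?_))
  · intro z _
    rcases Finset.eq_empty_or_nonempty ({p ∈ ((toFin H₂).filter (fun h => x + h ∈ C₁)) ×ˢ
        ((toFin H₁).filter (fun h => x + h ∉ C₂)) | x + p.1 + p.2 = z}) with he | ⟨p₀, hp₀⟩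
    · simp [he]
    · refine Finset.card_le_card_of_injOn (fun p => p.1 - p₀.1) ?_ ?_
      · intro p hp
        simp only [Finset.coe_filter, Finset.mem_product, Finset.mem_filter, mem_toFin,
          Set.mem_ofPred_eq, Finset.mem_coe, AddSubgroup.mem_inf] at hp hp₀ ⊢
        refine ⟨?_, sub_mem hp.1.1.1 hp₀.1.1.1⟩
        have : p.1 - p₀.1 = p₀.2 - p.2 := by
          have := hp.2.trans hp₀.2.symm
          rw [add_assoc, add_assoc, add_right_inj] at this
          rw [sub_eq_sub_iff_add_eq_add, this, add_comm]
        rw [this]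
        exact sub_mem hp₀.1.2.1 hp.1.2.1
      · intro p hp q hq hpq
        simp only [Finset.coe_filter, Set.mem_ofPred_eq] at hp hq
        have h1 : p.1 = q.1 := sub_left_injective hpq
        have := hp.2.trans hq.2.symm
        rw [h1, add_right_inj] at this
        exact Prod.ext h1 this
  · intro z hz
    simp only [Finset.mem_image, Finset.mem_product, Finset.mem_filter, mem_toFin,
      Finset.mem_sdiff] at hz ⊢
    obtain ⟨p, ⟨⟨hp1, hp2⟩, hp3, hp4⟩, rfl⟩ := hz
    refine ⟨(h₁ _ hp3 _).2 hp2, ?_⟩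
    rw [add_right_comm, h₂ _ hp1]
    exact hp4

theorem not_crossing_counts {p p' q q' a b ι c d : ℕ} (hp : 0 < p) (hp' : 0 < p') (hq : 0 < q)
    (e1 : p + p' = b) (e2 : q + q' = a) (i1 : p * q' * ι ≤ c)
    (i2 : q * p' * ι ≤ d) (h1 : d + ι < ι * a) (h2 : c + ι < ι * b) : False := by
  have j1 : q * p' + 1 < a := by
    refine Nat.lt_of_mul_lt_mul_left (a := ι) ?_
    calc ι * (q * p' + 1) = q * p' * ι + ι := by ring
      _ < ι * a := by omega
  have j2 : p * q' + 1 < b := by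
    refine Nat.lt_of_mul_lt_mul_left (a := ι) ?_
    calc ι * (p * q' + 1) = p * q' * ι + ι := by ring
      _ < ι * b := by omega
  subst e1 e2
  zify at *
  have k1 : (q : ℤ) * (p' - 1) ≤ q' - 2 := by linarith
  have k2 : (p : ℤ) * (q' - 1) ≤ p' - 2 := by linarith
  have k3 : 1 * ((p' : ℤ) - 1) ≤ q * (p' - 1) := by gcongr <;> linarith
  have k4 : 1 * ((q' : ℤ) - 1) ≤ p * (q' - 1) := by gcongr <;> linarith
  linarith

theorem card_add_card_period_union (C₁ C₂ : Finset G) (h12 : ¬ C₁ ⊆ C₂) (h21 : ¬ C₂ ⊆ C₁) (M : ℕ)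
    (hM₁ : M ≤ C₁.card + (toFin (period C₁)).card) (hM₂ : M ≤ C₂.card + (toFin (period C₂)).card) :
    M ≤ (C₁ ∪ C₂).card + (toFin (period (C₁ ∪ C₂))).card := by
  set H₁ := period C₁ with hH₁
  set H₂ := period C₂ with hH₂
  set ι := (toFin (H₁ ⊓ H₂)).card with hι
  have hιpos : 0 < ι := toFin_card_pos _
  have hle : ι ≤ (toFin (period (C₁ ∪ C₂))).card := by
    refine Finset.card_le_card fun g hg => ?_
    rw [mem_toFin, AddSubgroup.mem_inf] at hg
    rw [mem_toFin]
    intro x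
    rw [Finset.mem_union, Finset.mem_union, hg.1 x, hg.2 x]
  have hu1 : (C₁ ∪ C₂).card = C₁.card + (C₂ \ C₁).card := by
    rw [← Finset.union_sdiff_self_eq_union, Finset.card_union_of_disjoint Finset.disjoint_sdiff]
  have hu2 : (C₁ ∪ C₂).card = C₂.card + (C₁ \ C₂).card := by
    rw [Finset.union_comm, ← Finset.union_sdiff_self_eq_union,
      Finset.card_union_of_disjoint Finset.disjoint_sdiff]
  obtain ⟨a', ha'⟩ : ι ∣ (toFin H₁).card := card_toFin_dvd _ _ fun g hg x hx => by
    rw [mem_toFin] at hx ⊢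
    exact add_mem hx (AddSubgroup.mem_inf.1 hg).1
  obtain ⟨b', hb'⟩ : ι ∣ (toFin H₂).card := card_toFin_dvd _ _ fun g hg x hx => by
    rw [mem_toFin] at hx ⊢
    exact add_mem hx (AddSubgroup.mem_inf.1 hg).2
  suffices h : (toFin H₁).card ≤ (C₂ \ C₁).card + ι ∨ (toFin H₂).card ≤ (C₁ \ C₂).card + ι by omega
  by_contra hcon
  push Not at hcon
  obtain ⟨hc1, hc2⟩ := hcon
  -- the counts along a pair of orbits through `x`, in units of `ι`
  have key : ∀ x : G, ∃ p p' q q' : ℕ, p + p' = b' ∧ q + q' = a' ∧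
      p * q' * ι ≤ (C₁ \ C₂).card ∧ q * p' * ι ≤ (C₂ \ C₁).card ∧
      (x ∈ C₁ → 0 < p) ∧ (x ∉ C₁ → 0 < p') ∧ (x ∈ C₂ → 0 < q) ∧ (x ∉ C₂ → 0 < q') := by
    intro x
    obtain ⟨p, hp⟩ : ι ∣ ((toFin H₂).filter (fun h => x + h ∈ C₁)).card :=
      card_toFin_dvd _ _ fun g hg y hy => by
        rw [Finset.mem_filter, mem_toFin] at hy ⊢
        rw [AddSubgroup.mem_inf] at hg
        exact ⟨add_mem hy.1 hg.2, by rw [← add_assoc, hg.1]; exact hy.2⟩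
    obtain ⟨p', hp'⟩ : ι ∣ ((toFin H₂).filter (fun h => x + h ∉ C₁)).card :=
      card_toFin_dvd _ _ fun g hg y hy => by
        rw [Finset.mem_filter, mem_toFin] at hy ⊢
        rw [AddSubgroup.mem_inf] at hg
        exact ⟨add_mem hy.1 hg.2, by rw [← add_assoc, hg.1]; exact hy.2⟩
    obtain ⟨q, hq⟩ : ι ∣ ((toFin H₁).filter (fun h => x + h ∈ C₂)).card :=
      card_toFin_dvd _ _ fun g hg y hy => by
        rw [Finset.mem_filter, mem_toFin] at hy ⊢
        rw [AddSubgroup.mem_inf] at hg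
        exact ⟨add_mem hy.1 hg.1, by rw [← add_assoc, hg.2]; exact hy.2⟩
    obtain ⟨q', hq'⟩ : ι ∣ ((toFin H₁).filter (fun h => x + h ∉ C₂)).card :=
      card_toFin_dvd _ _ fun g hg y hy => by
        rw [Finset.mem_filter, mem_toFin] at hy ⊢
        rw [AddSubgroup.mem_inf] at hg
        exact ⟨add_mem hy.1 hg.1, by rw [← add_assoc, hg.2]; exact hy.2⟩
    have e1 := Finset.card_filter_add_card_filter_not (s := toFin H₂) (fun h => x + h ∈ C₁)
    have e2 := Finset.card_filter_add_card_filter_not (s := toFin H₁) (fun h => x + h ∈ C₂)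
    rw [hp, hp', hb', ← mul_add] at e1
    rw [hq, hq', ha', ← mul_add] at e2
    have i1 := mul_card_sdiff_ge C₁ C₂ H₁ H₂ (fun g hg => hg) (fun g hg => hg) x
    have i2 := mul_card_sdiff_ge C₂ C₁ H₂ H₁ (fun g hg => hg) (fun g hg => hg) x
    rw [hp, hq'] at i1
    rw [inf_comm, hq, hp'] at i2
    have pos : ∀ {K : AddSubgroup G} {D : Finset G} {t : ℕ},
        ((toFin K).filter (fun h => x + h ∈ D)).card = ι * t → x ∈ D → 0 < t := by
      intro K D t ht hx
      have : 0 < ι * t := ht ▸ Finset.card_pos.2 ⟨0, by simpa using hx⟩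
      exact Nat.pos_of_mul_pos_left this
    have pos' : ∀ {K : AddSubgroup G} {D : Finset G} {t : ℕ},
        ((toFin K).filter (fun h => x + h ∉ D)).card = ι * t → x ∉ D → 0 < t := by
      intro K D t ht hx
      have : 0 < ι * t := ht ▸ Finset.card_pos.2 ⟨0, by simpa using hx⟩
      exact Nat.pos_of_mul_pos_left this
    refine ⟨p, p', q, q', Nat.eq_of_mul_eq_mul_left hιpos e1, Nat.eq_of_mul_eq_mul_left hιpos e2,
      ?_, ?_, pos hp, pos' hp', pos hq, pos' hq'⟩
    · refine Nat.le_of_mul_le_mul_left ?_ hιpos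
      calc ι * (p * q' * ι) = ι * p * (ι * q') := by ring
        _ ≤ _ := i1
    · refine Nat.le_of_mul_le_mul_left ?_ hιpos
      calc ι * (q * p' * ι) = ι * q * (ι * p') := by ring
        _ ≤ _ := i2
  rw [ha'] at hc1
  rw [hb'] at hc2
  obtain ⟨x, hx1, hx2⟩ := Finset.not_subset.1 h12
  obtain ⟨y, hy2, hy1⟩ := Finset.not_subset.1 h21
  have m1 : ι * a' ≤ (C₁ \ C₂).card := by
    obtain ⟨p, p', q, q', e1, e2, i1, i2, hp, hp', hq, hq'⟩ := key x
    have hp := hp hx1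
    have hq' := hq' hx2
    have i3 : q' * ι ≤ (C₁ \ C₂).card :=
      (Nat.mul_le_mul_right ι (Nat.le_mul_of_pos_left q' hp)).trans i1
    have i4 : p * ι ≤ (C₁ \ C₂).card :=
      (Nat.mul_le_mul_right ι (Nat.le_mul_of_pos_right p hq')).trans i1
    rcases Nat.eq_zero_or_pos q with rfl | hq
    · rw [zero_add] at e2
      rwa [e2, mul_comm] at i3
    rcases Nat.eq_zero_or_pos p' with rfl | hp'
    · rw [add_zero] at e1
      rw [e1, mul_comm] at i4
      omega
    exact (not_crossing_counts hp hp' hq e1 e2 i1 i2 hc1 hc2).elim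
  have m2 : ι * b' ≤ (C₂ \ C₁).card := by
    obtain ⟨p, p', q, q', e1, e2, i1, i2, hp, hp', hq, hq'⟩ := key y
    have hp' := hp' hy1
    have hq := hq hy2
    have i3 : q * ι ≤ (C₂ \ C₁).card :=
      (Nat.mul_le_mul_right ι (Nat.le_mul_of_pos_right q hp')).trans i2
    have i4 : p' * ι ≤ (C₂ \ C₁).card :=
      (Nat.mul_le_mul_right ι (Nat.le_mul_of_pos_left p' hq)).trans i2
    rcases Nat.eq_zero_or_pos p with rfl | hp
    · rw [zero_add] at e1
      rwa [e1, mul_comm] at i4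
    rcases Nat.eq_zero_or_pos q' with rfl | hq'
    · rw [add_zero] at e2
      rw [e2, mul_comm] at i3
      omega
    exact (not_crossing_counts hp hp' hq e1 e2 i1 i2 hc1 hc2).elim
  omega

theorem card_add_card_le_card_add_period {A B : Finset G} (hA : A.Nonempty) (hB : B.Nonempty) :
    A.card + B.card ≤ (A + B).card + (toFin (period (A + B))).card := by
  obtain ⟨a, ha⟩ := hA
  obtain ⟨b, hb⟩ := hB
  obtain ⟨C₀, hC₀, -, hC₀c⟩ := exists_subset_add A B ha hb
  obtain ⟨C, hC, hmax⟩ := Finset.exists_max_image ((A + B).powerset.filter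
    (fun C => A.card + B.card ≤ C.card + (toFin (period C)).card)) Finset.card
    ⟨C₀, Finset.mem_filter.2 ⟨Finset.mem_powerset.2 hC₀, hC₀c⟩⟩
  rw [Finset.mem_filter, Finset.mem_powerset] at hC
  suffices A + B ⊆ C by
    rw [← hC.1.antisymm this]
    exact hC.2
  by_contra hsub
  obtain ⟨z, hz, hzC⟩ := Finset.not_subset.1 hsub
  obtain ⟨a, ha, b, hb, rfl⟩ := Finset.mem_add.1 hz
  obtain ⟨D, hD, habD, hDc⟩ := exists_subset_add A B ha hb
  by_cases hCD : C ⊆ D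
  · have h1 := hmax D (Finset.mem_filter.2 ⟨Finset.mem_powerset.2 hD, hDc⟩)
    exact hzC ((Finset.eq_of_subset_of_card_le hCD h1) ▸ habD)
  · have hDC : ¬ D ⊆ C := fun h => hzC (h habD)
    have h1 := hmax (C ∪ D) (Finset.mem_filter.2 ⟨Finset.mem_powerset.2
      (Finset.union_subset hC.1 hD), card_add_card_period_union C D hCD hDC _ hC.2 hDc⟩)
    have h2 := Finset.eq_of_subset_of_card_le Finset.subset_union_left h1
    exact hzC (h2 ▸ Finset.mem_union_right _ habD)

end Kneser

section Fragments

variable {G : Type*} [AddCommGroup G] [Fintype G] [DecidableEq G]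

theorem add_mem_add_toFin {S : Finset G} {K : AddSubgroup G} :
    ∀ g ∈ K, ∀ x ∈ S + toFin K, x + g ∈ S + toFin K := by
  intro g hg x hx
  obtain ⟨s, hs, k, hk, rfl⟩ := Finset.mem_add.1 hx
  rw [add_assoc]
  exact Finset.add_mem_add hs (mem_toFin.2 (add_mem (mem_toFin.1 hk) hg))

theorem add_toFin_eq_self {S : Finset G} {K : AddSubgroup G}
    (hS : ∀ g ∈ K, ∀ x ∈ S, x + g ∈ S) : S + toFin K = S := by
  ext x
  constructor
  · intro hx
    obtain ⟨s, hs, k, hk, rfl⟩ := Finset.mem_add.1 hx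
    exact hS k (mem_toFin.1 hk) s hs
  · intro hx
    simpa using Finset.add_mem_add hx (mem_toFin.2 K.zero_mem)

theorem add_mem_of_mem_period {S : Finset G} : ∀ g ∈ period S, ∀ x ∈ S, x + g ∈ S :=
  fun _ hg x hx => (mem_period.1 hg x).2 hx

/-- **Kneser's theorem** in a finite abelian group. -/
theorem kneser {A B : Finset G} (hA : A.Nonempty) (hB : B.Nonempty) :
    (A + toFin (period (A + B))).card + (B + toFin (period (A + B))).card ≤
      (A + B).card + (toFin (period (A + B))).card := by
  set K := period (A + B) with hK
  have hne : (toFin K).Nonempty := ⟨0, by simp⟩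
  have h := card_add_card_le_card_add_period (hA.add hne) (hB.add hne)
  have heq : A + toFin K + (B + toFin K) = A + B := by
    rw [add_add_add_comm, ← add_assoc, add_toFin_eq_self add_mem_of_mem_period,
      add_toFin_eq_self add_mem_of_mem_period]
  rwa [heq, ← hK] at h

theorem mk_mem_image_mk_iff {K : AddSubgroup G} [DecidableEq (G ⧸ K)] {S : Finset G}
    (hS : ∀ g ∈ K, ∀ x ∈ S, x + g ∈ S) {x : G} :
    (x : G ⧸ K) ∈ S.image (QuotientAddGroup.mk : G → G ⧸ K) ↔ x ∈ S := by
  constructor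
  · intro h
    obtain ⟨y, hy, hyx⟩ := Finset.mem_image.1 h
    have := hS _ (QuotientAddGroup.eq.1 hyx) y hy
    simpa using this
  · exact fun h => Finset.mem_image_of_mem _ h

theorem image_mk_add (K : AddSubgroup G) [DecidableEq (G ⧸ K)] (A B : Finset G) :
    (A + B).image (QuotientAddGroup.mk : G → G ⧸ K) =
      A.image (QuotientAddGroup.mk : G → G ⧸ K) + B.image (QuotientAddGroup.mk : G → G ⧸ K) :=
  Finset.image_add (QuotientAddGroup.mk' K)

theorem image_mk_add_toFin (K : AddSubgroup G) [DecidableEq (G ⧸ K)] (A : Finset G) :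
    (A + toFin K).image (QuotientAddGroup.mk : G → G ⧸ K) =
      A.image (QuotientAddGroup.mk : G → G ⧸ K) := by
  ext z
  simp only [Finset.mem_image, Finset.mem_add, mem_toFin]
  constructor
  · rintro ⟨_, ⟨a, ha, g, hg, rfl⟩, rfl⟩
    exact ⟨a, ha, QuotientAddGroup.eq.2 (by simpa using hg)⟩
  · rintro ⟨a, ha, rfl⟩
    exact ⟨a, ⟨a, ha, 0, K.zero_mem, add_zero a⟩, rfl⟩

theorem card_image_mk_add_card_image_mk_le {A B : Finset G} (hA : A.Nonempty) (hB : B.Nonempty)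
    [DecidableEq (G ⧸ period (A + B))] :
    (A.image (QuotientAddGroup.mk : G → G ⧸ period (A + B))).card +
      (B.image (QuotientAddGroup.mk : G → G ⧸ period (A + B))).card ≤
      (A.image (QuotientAddGroup.mk : G → G ⧸ period (A + B)) +
        B.image (QuotientAddGroup.mk : G → G ⧸ period (A + B))).card + 1 := by
  have h := kneser hA hB
  rw [card_add_toFin_eq _ (A + _) add_mem_add_toFin, card_add_toFin_eq _ (B + _) add_mem_add_toFin,
    image_mk_add_toFin, image_mk_add_toFin] at h
  have h2 := card_add_toFin_eq (period (A + B)) (A + B) add_mem_of_mem_period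
  rw [image_mk_add] at h2
  rw [h2, ← mul_add, ← mul_add_one] at h
  exact Nat.le_of_mul_le_mul_left h (toFin_card_pos _)

theorem period_image_mk_eq_bot {S : Finset G} [DecidableEq (G ⧸ period S)] :
    period (S.image (QuotientAddGroup.mk : G → G ⧸ period S)) = ⊥ := by
  rw [eq_bot_iff]
  intro g hg
  obtain ⟨g, rfl⟩ := QuotientAddGroup.mk_surjective g
  rw [AddSubgroup.mem_bot, QuotientAddGroup.eq_zero_iff]
  refine mem_period_of_forall_add_mem fun x hx => ?_
  have := (mem_period.1 hg (x : G ⧸ period S)).2 (Finset.mem_image_of_mem _ hx)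
  rw [← QuotientAddGroup.mk_add] at this
  exact (mk_mem_image_mk_iff add_mem_of_mem_period).1 this

/-- If some `X` has a small sumset `X + T` that does not fill the subgroup generated by `T`,
then the extremal such set may be taken to be a subgroup. -/
theorem exists_subgroup_fragment {T X₀ : Finset G} (h0 : 0 ∈ T) (hX₀ : X₀.Nonempty)
    (hlt : (X₀ + T).card < (toFin (AddSubgroup.closure (T : Set G))).card)
    (hsmall : (X₀ + T).card + 2 ≤ X₀.card + T.card) :
    ∃ (L : AddSubgroup G) (κ : ℕ), (toFin L + T).card = (toFin L).card + κ ∧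
      (toFin L).card ≤ κ ∧ 2 ≤ (toFin L).card ∧ κ + 2 ≤ T.card ∧
      (toFin L + T).card < (toFin (AddSubgroup.closure (T : Set G))).card ∧
      ∀ W : Finset G, W.Nonempty →
        (W + T).card < (toFin (AddSubgroup.closure (T : Set G))).card →
        W.card < (toFin L).card → W.card + κ + 1 ≤ (W + T).card := by
  classical
  set h := (toFin (AddSubgroup.closure (T : Set G))).card with hh
  have hsub : ∀ W : Finset G, W ⊆ W + T := fun W x hx => by
    simpa using Finset.add_mem_add hx h0
  have hle : ∀ W : Finset G, W.card ≤ (W + T).card := fun W => Finset.card_le_card (hsub W)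
  obtain ⟨X, hX, hmin⟩ := Finset.exists_min_image
    (Finset.univ.filter (fun X : Finset G => X.Nonempty ∧ (X + T).card < h))
    (fun X => toLex ((X + T).card - X.card, X.card))
    ⟨X₀, by simp [hX₀, hlt]⟩
  simp only [Finset.mem_filter, Finset.mem_univ, true_and, Prod.Lex.toLex_le_toLex, and_imp]
    at hX hmin
  obtain ⟨hXne, hXlt⟩ := hX
  set H := period (X + T) with hH
  have hHne : (toFin H).Nonempty := ⟨0, by simp⟩
  have hk := kneser hXne ⟨0, h0⟩
  rw [← hH, add_comm T] at hk
  have hXH : X.card ≤ (X + toFin H).card :=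
    Finset.card_le_card fun x hx => by
      simpa using Finset.add_mem_add hx (mem_toFin.2 H.zero_mem)
  have hHX : (toFin H).card ≤ (X + toFin H).card := by
    obtain ⟨x, hx⟩ := hXne
    rw [← Finset.card_singleton_add x (toFin H)]
    exact Finset.card_le_card (Finset.add_subset_add_right (Finset.singleton_subset_iff.2 hx))
  have hHT : (toFin H + T).card ≤ (X + T).card := by
    obtain ⟨x, hx⟩ := hXne
    rw [← add_toFin_eq_self (S := X + T) add_mem_of_mem_period, ← hH, add_assoc, add_comm T,
      ← Finset.card_singleton_add x (toFin H + T)]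
    exact Finset.card_le_card (Finset.add_subset_add_right (Finset.singleton_subset_iff.2 hx))
  have m0 := hmin X₀ hX₀ hlt
  have mH := hmin (toFin H) hHne (hHT.trans_lt hXlt)
  have l0 := hle X₀
  have lX := hle X
  have lH := hle (toFin H)
  have hcard : X.card = (toFin H).card := by omega
  obtain ⟨U, hU⟩ : (toFin H).card ∣ (toFin H + T).card := by
    rw [add_comm]
    exact card_toFin_dvd H _ add_mem_add_toFin
  have hT : T.card ≤ (toFin H + T).card := Finset.card_le_card fun t ht => by
    simpa using Finset.add_mem_add (mem_toFin.2 H.zero_mem) ht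
  have hU2 : 2 ≤ U := by
    by_contra hU2
    have hU1 : U = 1 := by
      have : U ≠ 0 := by
        rintro rfl
        have := toFin_card_pos H
        omega
      omega
    subst hU1
    have heq : toFin H = toFin H + T :=
      Finset.eq_of_subset_of_card_le (hsub _) (by omega)
    have hcl : AddSubgroup.closure (T : Set G) ≤ H := by
      rw [AddSubgroup.closure_le]
      intro t ht
      have : t ∈ toFin H := by
        rw [heq]
        simpa using Finset.add_mem_add (mem_toFin.2 H.zero_mem) ht
      exact mem_toFin.1 this
    have : h ≤ (toFin H).card :=
      Finset.card_le_card fun g hg => mem_toFin.2 (hcl (mem_toFin.1 hg))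
    omega
  have hU3 : (toFin H).card * 2 ≤ (toFin H).card * U := Nat.mul_le_mul_left _ hU2
  refine ⟨H, (toFin H + T).card - (toFin H).card, by omega, by omega, by omega, by omega,
    by omega, ?_⟩
  intro W hW hWlt hWc
  have mW := hmin W hW hWlt
  have lW := hle W
  omega

theorem exists_coset_avoiding {T Y : Finset G} {L : AddSubgroup G} {κ h : ℕ}
    (hLT : (toFin L + T).card = (toFin L).card + κ) (hlt : (toFin L + T).card < h)
    (hfrag : ∀ W : Finset G, W.Nonempty → (W + T).card < h →
      W.card < (toFin L).card → W.card + κ + 1 ≤ (W + T).card)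
    (hper : ¬ L ≤ period (Y + T)) :
    ∃ ζ Yl : Finset G, Yl ⊆ Y ∧ Yl.Nonempty ∧ Yl.card + 2 ≤ (toFin L).card ∧
      (∀ j ∈ Y, ∀ t ∈ T, j + t ∈ ζ → j ∈ Yl) ∧
      ∀ W ⊆ Yl, W.Nonempty → W.card + 1 ≤ ((W + T) ∩ ζ).card := by
  classical
  obtain ⟨g, hg, z, hz, hzg⟩ : ∃ g ∈ L, ∃ z ∈ Y + T, z + g ∉ Y + T := by
    by_contra hcon
    push Not at hcon
    exact hper fun g hg => mem_period_of_forall_add_mem (hcon g hg)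
  set ζ := {z} + toFin L with hζ
  have hzζ : z ∈ ζ := by
    simpa using Finset.add_mem_add (Finset.mem_singleton_self z) (mem_toFin.2 L.zero_mem)
  have hgζ : z + g ∈ ζ :=
    Finset.add_mem_add (Finset.mem_singleton_self z) (mem_toFin.2 hg)
  have hζc : ζ.card = (toFin L).card := Finset.card_singleton_add _ _
  have hnegL : -toFin L = toFin L := by
    ext x
    simp [Finset.mem_neg']
  have hnζ : (-ζ + T).card = (toFin L).card + κ := by
    rw [hζ, neg_add, hnegL, add_assoc, Finset.neg_singleton, Finset.card_singleton_add, hLT]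
  have main : ∀ W ⊆ Y.filter (fun j => ∃ t ∈ T, j + t ∈ ζ), W.Nonempty →
      W.card + 1 ≤ ((W + T) ∩ ζ).card := by
    intro W hW hWne
    set V := (W + T) ∩ ζ with hV
    have hVne : V.Nonempty := by
      obtain ⟨w, hw⟩ := hWne
      obtain ⟨-, t, ht, hwt⟩ := Finset.mem_filter.1 (hW hw)
      exact ⟨w + t, Finset.mem_inter.2 ⟨Finset.add_mem_add hw ht, hwt⟩⟩
    have hCc : (ζ \ V).card + V.card = ζ.card :=
      Finset.card_sdiff_add_card_eq_card Finset.inter_subset_right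
    have hCne : (ζ \ V).Nonempty := by
      refine ⟨z + g, Finset.mem_sdiff.2 ⟨hgζ, fun hmem => hzg ?_⟩⟩
      exact Finset.add_subset_add_right (hW.trans (Finset.filter_subset _ _))
        (Finset.mem_inter.1 hmem).1
    have hsub1 : -(ζ \ V) + T ⊆ -ζ + T :=
      Finset.add_subset_add_right (Finset.neg_subset_neg Finset.sdiff_subset)
    have hsub2 : -W ⊆ -ζ + T := by
      intro w hw
      rw [Finset.mem_neg'] at hw
      obtain ⟨-, t, ht, hwt⟩ := Finset.mem_filter.1 (hW hw)
      refine Finset.mem_add.2 ⟨-(-w + t), Finset.neg_mem_neg hwt, t, ht, by abel⟩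
    have hdisj : Disjoint (-W) (-(ζ \ V) + T) := by
      rw [Finset.disjoint_left]
      intro w hw hw'
      rw [Finset.mem_neg'] at hw
      obtain ⟨c, hc, t, ht, rfl⟩ := Finset.mem_add.1 hw'
      rw [Finset.mem_neg', Finset.mem_sdiff] at hc
      refine hc.2 (Finset.mem_inter.2 ⟨?_, hc.1⟩)
      have := Finset.add_mem_add hw ht
      convert this using 1
      abel
    have hcard := Finset.card_le_card (Finset.union_subset hsub2 hsub1)
    rw [Finset.card_union_of_disjoint hdisj, Finset.card_neg, hnζ] at hcard
    have hVpos := Finset.card_pos.2 hVne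
    have hbig := hfrag (-(ζ \ V)) hCne.neg
      ((Finset.card_le_card hsub1).trans_lt (by omega)) (by rw [Finset.card_neg]; omega)
    rw [Finset.card_neg] at hbig
    omega
  have hne : (Y.filter (fun j => ∃ t ∈ T, j + t ∈ ζ)).Nonempty := by
    obtain ⟨j, hj, t, ht, rfl⟩ := Finset.mem_add.1 hz
    exact ⟨j, Finset.mem_filter.2 ⟨hj, t, ht, hzζ⟩⟩
  refine ⟨ζ, Y.filter (fun j => ∃ t ∈ T, j + t ∈ ζ), Finset.filter_subset _ _, hne, ?_, ?_, main⟩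
  · have h1 := main _ subset_rfl hne
    have h2 : (((Y.filter (fun j => ∃ t ∈ T, j + t ∈ ζ)) + T) ∩ ζ).card < ζ.card := by
      refine Finset.card_lt_card ⟨Finset.inter_subset_right, fun hsub => hzg ?_⟩
      exact Finset.add_subset_add_right (Finset.filter_subset _ _)
        (Finset.mem_inter.1 (hsub hgζ)).1
    omega
  · intro j hj t ht hjt
    exact Finset.mem_filter.2 ⟨hj, t, ht, hjt⟩

end Fragments

section Arithmetic

/-- `d ≥ N + N / m + (m + 1) β / 2`, with denominators cleared. -/
def GainBound (β N d m : ℕ) : Prop := 2 * N + 2 * m * N + m * (m + 1) * β ≤ 2 * m * d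

theorem GainBound.card_le {β N d m s : ℕ} (h : GainBound β N d m) (hβ : 1 ≤ β) (hm : 1 ≤ m)
    (hs : 1 ≤ s) (hN : s * (s - 1) * β + 2 * s ≤ 2 * N) : N + s * β + 1 ≤ d := by
  unfold GainBound at h
  obtain ⟨s, rfl⟩ := Nat.exists_eq_add_of_le' hs
  rw [Nat.add_sub_cancel] at hN
  refine Nat.le_of_lt_succ (Nat.lt_of_mul_lt_mul_left (a := 2 * m) ?_)
  zify at *
  suffices h' : 2 * (m : ℤ) ≤ β * ((m - (s + 1)) * (m - s)) + 2 * (s + 1) by nlinarith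
  rcases le_or_gt m (s + 1) with hle | hlt
  · have h1 : (m : ℤ) ≤ s + 1 := by exact_mod_cast hle
    have h2 : 0 ≤ ((m : ℤ) - (s + 1)) * (m - s) := by
      rcases hle.lt_or_eq with h3 | h3
      · have h4 : (m : ℤ) ≤ s := by exact_mod_cast Nat.lt_succ_iff.1 h3
        nlinarith
      · have h4 : (m : ℤ) = s + 1 := by exact_mod_cast h3
        simp [h4]
    have : 0 ≤ (β : ℤ) * (((m : ℤ) - (s + 1)) * (m - s)) := mul_nonneg (by positivity) h2
    linarith
  · obtain ⟨t, rfl⟩ := Nat.exists_eq_add_of_lt hlt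
    push_cast
    have : (t + 1 : ℤ) * (t + 2) * 1 ≤ (t + 1 : ℤ) * (t + 2) * β := by gcongr
    nlinarith

theorem GainBound.one_of_le {β N d : ℕ} (h : N + (N + β) ≤ d) : GainBound β N d 1 := by
  unfold GainBound
  omega

theorem GainBound.add_row {β N' d' m a d : ℕ} (h : GainBound β N' d' m)
    (h₁ : d' + (a + β) ≤ d) (h₂ : N' + a + (a + β) ≤ d) : GainBound β (N' + a) d (m + 1) := by
  unfold GainBound at *
  have h3 : m * (d' + (a + β)) ≤ m * d := Nat.mul_le_mul_left _ h₁
  nlinarith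

theorem GainBound.le_of_not_pred {β N d m : ℕ} (h : GainBound β N d (m + 2))
    (h' : ¬ GainBound β N d (m + 1)) : (m + 2) * (m + 1) * β ≤ 2 * N := by
  unfold GainBound at *
  push Not at h'
  zify at *
  have h3 : ((m : ℤ) + 1) * (2 * N + 2 * (m + 2) * N + (m + 2) * (m + 2 + 1) * β) ≤
      (m + 1) * (2 * (m + 2) * d) := by gcongr
  have h4 := mul_lt_mul_of_pos_left h' (show (0 : ℤ) < m + 2 by positivity)
  nlinarith

theorem GainBound.excess_lt {β N' d' m a d η σ F : ℕ} (h : GainBound β N' d' m)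
    (hσ : σ + η = a + β) (h₁ : d' + σ ≤ d) (h₂ : d = N' + a + σ + F)
    (hnot : ¬ GainBound β (N' + a) d (m + 1)) : F < (m + 1) * η := by
  unfold GainBound at *
  push Not at hnot
  zify at *
  set Φ : ℤ := d' - N' with hΦ
  have hσ' : (σ : ℤ) = a + β - η := by linarith
  rw [hσ'] at h₁ h₂
  have hd' : (d' : ℤ) = Φ + N' := by linarith
  rw [hd'] at h h₁
  rw [h₂] at hnot h₁
  have e1 : Φ ≤ a + F := by linarith
  have hm : (0 : ℤ) ≤ m := by positivity
  have e2 : (m : ℤ) * (2 * Φ) + 2 * N' * 0 ≥ 2 * N' + m * (m + 1) * β := by nlinarith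
  have e3 : ((m : ℤ) + 1) * (a - η + F) < m * Φ + a := by nlinarith
  have e4 : (m : ℤ) * Φ ≤ m * (a + F) := by gcongr
  nlinarith

theorem GainBound.large_rest {k E η β u F xs Nl N' a No m p : ℕ} (hk : E + η ≤ k)
    (hβ : β + E = u * k) (hp : 1 ≤ p) (hu : p + 4 ≤ u) (hum : u ≤ m + 1)
    (hF : F ≤ (m + 1) * η) (hxs : xs ≤ F + E * (p + 1)) (hNl : Nl ≤ xs * p)
    (hN' : m * (m - 1) * β ≤ 2 * N') (hN : N' + a = No + Nl) (ha : 1 ≤ a) :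
    p * (p - 1) * β ≤ 2 * No ∧ 1 ≤ No := by
  obtain ⟨p, rfl⟩ := Nat.exists_eq_add_of_le' hp
  obtain ⟨m, rfl⟩ : ∃ m', m = m' + 1 := ⟨m - 1, by omega⟩
  rw [Nat.add_sub_cancel] at *
  have h1 : xs ≤ (m + 2) * k := by
    calc xs ≤ (m + 1 + 1) * η + E * (p + 1 + 1) := by omega
      _ ≤ (m + 2) * η + E * (m + 2) :=
          Nat.add_le_add (le_of_eq (by ring)) (Nat.mul_le_mul_left E (by omega))
      _ = (m + 2) * (E + η) := by ring
      _ ≤ (m + 2) * k := by gcongr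
  have h2 : k * (p + 1) ≤ β := by
    have : (p + 1) * k + k ≤ u * k := by
      calc (p + 1) * k + k = (p + 2) * k := by ring
        _ ≤ u * k := by gcongr; omega
    nlinarith
  have h3 : Nl ≤ (m + 2) * β := by
    calc Nl ≤ xs * (p + 1) := hNl
      _ ≤ (m + 2) * k * (p + 1) := by gcongr
      _ = (m + 2) * (k * (p + 1)) := by ring
      _ ≤ _ := by gcongr
  have h4 : (p + 1) * p + 2 * (m + 2) ≤ (m + 1) * m := by
    obtain ⟨t, rfl⟩ : ∃ t, m = p + 3 + t := ⟨m - (p + 3), by omega⟩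
    nlinarith
  have h5 := Nat.mul_le_mul_right β h4
  constructor
  · nlinarith
  · nlinarith

theorem GainBound.insert_low {β Nl xs No d₀ d m p : ℕ} (h : GainBound β No d₀ m) (hm : 1 ≤ m)
    (hp : 1 ≤ p) (hd : d₀ + Nl + xs ≤ d) (hNl : Nl ≤ xs * p) (hNo : p * (p - 1) * β ≤ 2 * No) :
    ∃ m', 1 ≤ m' ∧ GainBound β (No + Nl) d m' := by
  unfold GainBound at *
  rcases le_or_gt p m with hpm | hmp
  · refine ⟨m, hm, ?_⟩
    have h1 : xs * p ≤ xs * m := by gcongr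
    have h2 : 2 * m * (d₀ + Nl + xs) ≤ 2 * m * d := by gcongr
    nlinarith
  · refine ⟨p, hp, ?_⟩
    obtain ⟨t, rfl⟩ := Nat.exists_eq_add_of_lt hmp
    have h0 : m + t + 1 - 1 = m + t := by omega
    rw [h0] at hNo
    have h1 : (t + 1) * ((m + t + 1) * m * β) ≤ (t + 1) * (2 * No) := by
      refine Nat.mul_le_mul_left _ (le_trans ?_ hNo)
      gcongr
      omega
    have h2 : m * Nl ≤ m * (xs * (m + t + 1)) := by gcongr
    have h3 : 2 * m * (m + t + 1) * (d₀ + Nl + xs) ≤ 2 * m * (m + t + 1) * d := by gcongr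
    have h4 := Nat.mul_le_mul_left (m + t + 1) h
    refine Nat.le_of_mul_le_mul_left ?_ hm
    nlinarith

end Arithmetic

section Levels

theorem sum_eq_sum_card_levels {ι : Type*} (Z : Finset ι) (f : ι → ℕ) {M : ℕ}
    (hM : ∀ z ∈ Z, f z ≤ M) :
    ∑ z ∈ Z, f z = ∑ τ ∈ Finset.range M, (Z.filter (fun z => τ < f z)).card := by
  simp_rw [Finset.card_filter]
  rw [Finset.sum_comm]
  refine Finset.sum_congr rfl fun z hz => ?_
  rw [← Finset.card_filter]
  have : (Finset.range M).filter (fun τ => τ < f z) = Finset.range (f z) := by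
    ext τ
    have := hM z hz
    simp only [Finset.mem_filter, Finset.mem_range]
    omega
  rw [this, Finset.card_range]

theorem sum_add_le_sum_of_levels {ι κ : Type*} {Y : Finset ι} {Z : Finset κ} {x : ι → ℕ}
    {g : κ → ℕ} (h : ∀ τ, (Y.filter (fun j => τ < x j)).Nonempty →
      (Y.filter (fun j => τ < x j)).card + 1 ≤ (Z.filter (fun z => τ < g z)).card)
    {j : ι} (hj : j ∈ Y) : ∑ i ∈ Y, x i + x j ≤ ∑ z ∈ Z, g z := by
  obtain ⟨M, hY, hZ⟩ : ∃ M, (∀ i ∈ Y, x i ≤ M) ∧ ∀ z ∈ Z, g z ≤ M :=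
    ⟨∑ i ∈ Y, x i + ∑ z ∈ Z, g z,
      fun i hi => (Finset.single_le_sum (fun _ _ => Nat.zero_le _) hi).trans (Nat.le_add_right _ _),
      fun z hz => (Finset.single_le_sum (fun _ _ => Nat.zero_le _) hz).trans (Nat.le_add_left _ _)⟩
  have hj' := sum_eq_sum_card_levels {j} x (M := M) (by simpa using hY j hj)
  rw [Finset.sum_singleton] at hj'
  rw [sum_eq_sum_card_levels Y x hY, sum_eq_sum_card_levels Z g hZ, hj', ← Finset.sum_add_distrib]
  refine Finset.sum_le_sum fun τ _ => ?_
  by_cases hτ : τ < x j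
  · have := h τ ⟨j, Finset.mem_filter.2 ⟨hj, hτ⟩⟩
    simpa [Finset.filter_singleton, hτ] using this
  · rcases Finset.eq_empty_or_nonempty (Y.filter (fun j => τ < x j)) with he | hne
    · simp [he, Finset.filter_singleton, hτ]
    · have := h τ hne
      simp only [Finset.filter_singleton, hτ, if_false, Finset.card_empty]
      omega

variable {G : Type*} [AddCommGroup G] [DecidableEq G]

theorem exists_gainBound_of_expansion {Y T : Finset G} {x g : G → ℕ} {k E c β : ℕ}
    (hY : Y.Nonempty) (h0 : 0 ∈ T) (hc : 1 ≤ c) (hE : E ≤ k) (hβ : β + E = (c + 1) * k)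
    (hexp : ∀ X ⊆ Y, X.Nonempty → X.card + c ≤ (X + T).card)
    (hg : ∀ z ∈ Y + T, x z + k ≤ g z)
    (hgx : ∀ j ∈ Y, ∀ t ∈ T, x j + k ≤ g (j + t) + E) :
    ∃ m, 1 ≤ m ∧ GainBound β (∑ j ∈ Y, x j) (∑ z ∈ Y + T, g z) m := by
  have hYZ : Y ⊆ Y + T := fun y hy => by simpa using Finset.add_mem_add hy h0
  set N := ∑ j ∈ Y, x j with hN
  set R := ∑ z ∈ Y + T, (g z - k) with hR
  set M := N + R with hM
  set y : ℕ → ℕ := fun τ => (Y.filter (fun j => τ < x j)).card with hy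
  set S : ℕ → ℕ := fun τ => ((Y + T).filter (fun z => τ < g z - k)).card with hS
  have hyle : ∀ τ, y τ ≤ Y.card := fun τ => Finset.card_filter_le _ _
  have hNy : N = ∑ τ ∈ Finset.range M, y τ := sum_eq_sum_card_levels Y x fun i hi =>
    (Finset.single_le_sum (fun _ _ => Nat.zero_le _) hi).trans (Nat.le_add_right _ _)
  have hRS : R = ∑ τ ∈ Finset.range M, S τ :=
    sum_eq_sum_card_levels (Y + T) (fun z => g z - k) fun i hi =>
      (Finset.single_le_sum (f := fun z => g z - k) (fun _ _ => Nat.zero_le _) hi).trans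
        (Nat.le_add_left _ _)
  have hyS : ∀ τ, y τ ≤ S τ := by
    intro τ
    refine Finset.card_le_card fun j hj => ?_
    rw [Finset.mem_filter] at hj ⊢
    have := hg j (hYZ hj.1)
    exact ⟨hYZ hj.1, by omega⟩
  have hyES : ∀ τ, 0 < y (τ + E) → y (τ + E) + c ≤ S τ := by
    intro τ hτ
    refine (hexp _ (Finset.filter_subset _ _) (Finset.card_pos.1 hτ)).trans
      (Finset.card_le_card fun z hz => ?_)
    obtain ⟨j, hj, t, ht, rfl⟩ := Finset.mem_add.1 hz
    rw [Finset.mem_filter] at hj ⊢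
    have := hgx j hj.1 t ht
    exact ⟨Finset.add_mem_add hj.1 ht, by omega⟩
  set μ : ℕ → ℕ := fun r => ∑ τ ∈ Finset.range M, min (y τ) r with hμ
  have step : ∀ r, μ (r + c) + N ≤ R + E * (Y.card - r) + μ r := by
    intro r
    have s1 : μ (r + c) + ∑ τ ∈ Finset.range M, (y (τ + E) - r) ≤ R := by
      rw [hRS, hμ, ← Finset.sum_add_distrib]
      refine Finset.sum_le_sum fun τ _ => ?_
      have := hyS τ
      have := hyES τ
      omega
    have s2 : ∑ τ ∈ Finset.range M, (y τ - r) ≤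
        E * (Y.card - r) + ∑ τ ∈ Finset.range M, (y (τ + E) - r) := by
      calc ∑ τ ∈ Finset.range M, (y τ - r) ≤ ∑ τ ∈ Finset.range (E + M), (y τ - r) :=
            Finset.sum_le_sum_of_subset (Finset.range_subset_range.2 (Nat.le_add_left _ _))
        _ = ∑ τ ∈ Finset.range E, (y τ - r) + ∑ τ ∈ Finset.range M, (y (E + τ) - r) :=
            Finset.sum_range_add _ _ _
        _ ≤ _ := by
            simp_rw [add_comm E]
            gcongr
            refine (Finset.sum_le_card_nsmul _ _ (Y.card - r) fun τ _ =>
              Nat.sub_le_sub_right (hyle τ) r).trans ?_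
            simp
    have s3 : N = ∑ τ ∈ Finset.range M, (y τ - r) + μ r := by
      rw [hNy, hμ, ← Finset.sum_add_distrib]
      refine Finset.sum_congr rfl fun τ _ => ?_
      omega
    omega
  have iter : ∀ j : ℕ, (j ≠ 0 → (j - 1) * c ≤ Y.card) → (2 * μ (j * c) + 2 * j * N : ℤ) ≤
      2 * j * R + E * (2 * j * Y.card - c * (j * (j - 1))) := by
    intro j
    induction j with
    | zero => simp [hμ]
    | succ j ih =>
      intro hj
      have hj := hj (by omega)
      rw [Nat.add_sub_cancel] at hj
      have ih := ih fun _ => (Nat.mul_le_mul_right c (Nat.sub_le j 1)).trans hj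
      have st := step (j * c)
      rw [← add_one_mul] at st
      zify [hj] at st
      push_cast
      nlinarith
  have hYpos := Finset.card_pos.2 hY
  obtain ⟨p, s, hps, hs1, hsc⟩ : ∃ p s, Y.card = c * p + s ∧ 1 ≤ s ∧ s ≤ c := by
    refine ⟨(Y.card - 1) / c, (Y.card - 1) % c + 1, ?_, by omega, Nat.mod_lt _ hc⟩
    have := Nat.div_add_mod (Y.card - 1) c
    omega
  have hμN : μ ((p + 1) * c) = N := by
    rw [hNy, hμ]
    refine Finset.sum_congr rfl fun τ _ => min_eq_left ((hyle τ).trans ?_)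
    rw [hps]
    nlinarith
  have hfin := iter (p + 1) fun _ => by
    rw [Nat.add_sub_cancel, hps]
    nlinarith
  rw [hμN] at hfin
  have hW : k * (Y.card + c) + R ≤ ∑ z ∈ Y + T, g z := by
    have h1 : ∑ z ∈ Y + T, g z = R + (Y + T).card * k := by
      rw [hR, ← smul_eq_mul, ← Finset.sum_const, ← Finset.sum_add_distrib]
      refine Finset.sum_congr rfl fun z hz => ?_
      have := hg z hz
      omega
    have h2 := Nat.mul_le_mul_right k (hexp Y subset_rfl hY)
    rw [h1]
    linarith
  refine ⟨p + 1, by omega, ?_⟩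
  unfold GainBound
  rw [hps] at hW hfin
  zify at *
  have hβ' : (β : ℤ) = (c + 1) * k - E := by linarith
  rw [hβ']
  have q1 : 0 ≤ ((p : ℤ) + 1) * (((k : ℤ) - E) * ((c - 1) * p + 2 * (s - 1))) := by
    have a1 : (0 : ℤ) ≤ k - E := by linarith
    have a2 : (0 : ℤ) ≤ c - 1 := by linarith
    have a3 : (0 : ℤ) ≤ s - 1 := by linarith
    positivity
  have q2 := mul_le_mul_of_nonneg_left hW (show (0 : ℤ) ≤ 2 * (p + 1) by positivity)
  linarith

end Levels

section Residues

variable {n : ℕ}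

/-- The elements of `D` that are minimal in their residue class modulo `n`. -/
def residueMin (n : ℕ) (D : Finset ℤ) : Finset ℤ :=
  D.filter fun d => ∀ e ∈ D, (e : ZMod n) = d → d ≤ e

theorem residueMin_subset (D : Finset ℤ) : residueMin n D ⊆ D := Finset.filter_subset _ _

theorem card_residueMin (D : Finset ℤ) :
    (residueMin n D).card = (D.image ((↑) : ℤ → ZMod n)).card := by
  have himg : D.image ((↑) : ℤ → ZMod n) = (residueMin n D).image ((↑) : ℤ → ZMod n) := by
    refine (Finset.image_subset_image (residueMin_subset D)).antisymm' fun z hz => ?_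
    obtain ⟨d, hd, rfl⟩ := Finset.mem_image.1 hz
    obtain ⟨e, he, hmin⟩ := Finset.exists_min_image (D.filter fun e : ℤ => (e : ZMod n) = (d : ZMod n)) id
      ⟨d, Finset.mem_filter.2 ⟨hd, rfl⟩⟩
    rw [Finset.mem_filter] at he
    refine Finset.mem_image.2 ⟨e, Finset.mem_filter.2 ⟨he.1, fun f hf hfe => ?_⟩, he.2⟩
    exact hmin f (Finset.mem_filter.2 ⟨hf, hfe.trans he.2⟩)
  rw [himg, Finset.card_image_of_injOn]
  intro d hd e he hde
  have hd' := Finset.mem_filter.1 hd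
  have he' := Finset.mem_filter.1 he
  exact le_antisymm (hd'.2 e he'.1 hde.symm) (he'.2 d hd'.1 hde)

theorem card_add_card_residues_le (hn : 0 < n) {C D : Finset ℤ} (hCD : C ⊆ D)
    (hshift : ∀ c ∈ C, c + n ∈ D) :
    C.card + (D.image ((↑) : ℤ → ZMod n)).card ≤ D.card := by
  rw [← card_residueMin, ← Finset.card_image_of_injective C (add_left_injective (n : ℤ)),
    ← Finset.card_union_of_disjoint]
  · refine Finset.card_le_card (Finset.union_subset ?_ (residueMin_subset D))
    intro d hd
    obtain ⟨c, hc, rfl⟩ := Finset.mem_image.1 hd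
    exact hshift c hc
  · rw [Finset.disjoint_left]
    intro d hd hd'
    obtain ⟨c, hc, rfl⟩ := Finset.mem_image.1 hd
    have := (Finset.mem_filter.1 hd').2 c (hCD hc) (by simp)
    omega

theorem card_sdiff_residueMin_add_le (A B : Finset ℤ) :
    ((A \ residueMin n A) + B).card + ((A + B).image ((↑) : ℤ → ZMod n)).card ≤ (A + B).card := by
  rw [← card_residueMin, ← Finset.card_union_of_disjoint]
  · exact Finset.card_le_card (Finset.union_subset
      (Finset.add_subset_add_right Finset.sdiff_subset) (residueMin_subset _))
  · rw [Finset.disjoint_left]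
    intro d hd hd'
    obtain ⟨a, ha, b, hb, rfl⟩ := Finset.mem_add.1 hd
    obtain ⟨haA, hamin⟩ := Finset.mem_sdiff.1 ha
    have : ∃ e ∈ A, (e : ZMod n) = a ∧ e < a := by
      by_contra hcon
      push Not at hcon
      exact hamin (Finset.mem_filter.2 ⟨haA, hcon⟩)
    obtain ⟨e, heA, hea, hlt⟩ := this
    have := (Finset.mem_filter.1 hd').2 (e + b) (Finset.add_mem_add heA hb) (by simp [hea])
    omega

theorem card_sdiff_residueMin (A : Finset ℤ) :
    (A \ residueMin n A).card + (A.image ((↑) : ℤ → ZMod n)).card = A.card := by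
  rw [← card_residueMin]
  exact Finset.card_sdiff_add_card_eq_card (residueMin_subset A)

theorem image_cast_add (A B : Finset ℤ) :
    (A + B).image ((↑) : ℤ → ZMod n) =
      A.image ((↑) : ℤ → ZMod n) + B.image ((↑) : ℤ → ZMod n) :=
  Finset.image_add (Int.castAddHom (ZMod n))

theorem card_add_le_card_add_int {A B : Finset ℤ} (hA : A.Nonempty) (hB : B.Nonempty) :
    A.card + B.card ≤ (A + B).card + 1 := by
  have := cauchy_davenport_add_of_linearOrder_isCancelAdd hA hB
  omega

end Residues

section Rows

variable {G : Type*} [AddCommGroup G] [Fintype G] [DecidableEq G]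
  (K : AddSubgroup G) [DecidableEq (G ⧸ K)]

theorem card_filter_mk_le (S : Finset G) (z : G ⧸ K) :
    (S.filter (fun x : G => (x : G ⧸ K) = z)).card ≤ (toFin K).card := by
  obtain ⟨x, rfl⟩ := QuotientAddGroup.mk_surjective z
  refine Finset.card_le_card_of_injOn (fun y => -x + y) (fun y hy => ?_)
    (add_right_injective (-x)).injOn
  have hy := (Finset.mem_filter.1 (Finset.mem_coe.1 hy)).2
  exact Finset.mem_coe.2 (mem_toFin.2 (QuotientAddGroup.eq.1 hy.symm))

theorem card_filter_mk_eq {S : Finset G} (hS : ∀ g ∈ K, ∀ x ∈ S, x + g ∈ S) {z : G ⧸ K}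
    (hz : z ∈ S.image (QuotientAddGroup.mk : G → G ⧸ K)) :
    (S.filter (fun x : G => (x : G ⧸ K) = z)).card = (toFin K).card := by
  refine (card_filter_mk_le K S z).antisymm ?_
  obtain ⟨x, hx, rfl⟩ := Finset.mem_image.1 hz
  rw [← Finset.card_image_of_injective (toFin K) (add_right_injective x)]
  refine Finset.card_le_card fun y hy => ?_
  obtain ⟨g, hg, rfl⟩ := Finset.mem_image.1 hy
  rw [mem_toFin] at hg
  exact Finset.mem_filter.2 ⟨hS g hg x hx, (QuotientAddGroup.eq.2 (by simpa using hg))⟩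

theorem card_le_card_image_mk_mul (S : Finset G) :
    S.card ≤ (toFin K).card * (S.image (QuotientAddGroup.mk : G → G ⧸ K)).card :=
  Finset.card_le_mul_card_image _ _ fun z _ => card_filter_mk_le K S z

theorem card_add_le_card_filter_mk_add (S : Finset G) {z : G ⧸ K}
    (hz : z ∈ S.image (QuotientAddGroup.mk : G → G ⧸ K)) :
    S.card + (toFin K).card ≤ (S.filter (fun x : G => (x : G ⧸ K) = z)).card +
      (toFin K).card * (S.image (QuotientAddGroup.mk : G → G ⧸ K)).card := by
  have h1 := Finset.card_eq_sum_card_image (QuotientAddGroup.mk : G → G ⧸ K) S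
  have h2 : _ ≤ _ • (toFin K).card := Finset.sum_le_card_nsmul
    ((S.image (QuotientAddGroup.mk : G → G ⧸ K)).erase z)
    (fun z => (S.filter (fun x : G => (x : G ⧸ K) = z)).card) _ fun z _ => card_filter_mk_le K S z
  rw [← Finset.add_sum_erase _ _ hz] at h1
  rw [← Finset.card_erase_add_one hz]
  rw [smul_eq_mul] at h2
  linarith

end Rows

section IntegerRows

variable {n : ℕ} [NeZero n] (K : AddSubgroup (ZMod n)) [DecidableEq (ZMod n ⧸ K)]

/-- The part of a set of integers lying over a class of residues modulo `n`. -/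
def row (A : Finset ℤ) (z : ZMod n ⧸ K) : Finset ℤ :=
  A.filter fun a => ((a : ZMod n) : ZMod n ⧸ K) = z

variable {K}

theorem mem_row {A : Finset ℤ} {z : ZMod n ⧸ K} {a : ℤ} :
    a ∈ row K A z ↔ a ∈ A ∧ ((a : ZMod n) : ZMod n ⧸ K) = z := Finset.mem_filter

theorem row_image_cast (A : Finset ℤ) (z : ZMod n ⧸ K) :
    (row K A z).image ((↑) : ℤ → ZMod n) =
      (A.image ((↑) : ℤ → ZMod n)).filter (fun x : ZMod n => (x : ZMod n ⧸ K) = z) := by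
  rw [Finset.filter_image]
  rfl

theorem card_filter_mk_le_card_row (A : Finset ℤ) (z : ZMod n ⧸ K) :
    ((A.image ((↑) : ℤ → ZMod n)).filter (fun x : ZMod n => (x : ZMod n ⧸ K) = z)).card ≤
      (row K A z).card := by
  rw [← row_image_cast]
  exact Finset.card_image_le

theorem sum_card_row {A : Finset ℤ} {Z : Finset (ZMod n ⧸ K)}
    (hZ : (A.image ((↑) : ℤ → ZMod n)).image (QuotientAddGroup.mk : ZMod n → ZMod n ⧸ K) ⊆ Z) :
    ∑ z ∈ Z, (row K A z).card = A.card := by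
  refine (Finset.card_eq_sum_card_fiberwise fun a ha => ?_).symm
  exact hZ (Finset.mem_image_of_mem _ (Finset.mem_image_of_mem _ ha))

theorem row_add_row_subset (A B : Finset ℤ) (y z : ZMod n ⧸ K) :
    row K A y + row K B z ⊆ row K (A + B) (y + z) := by
  intro d hd
  obtain ⟨a, ha, b, hb, rfl⟩ := Finset.mem_add.1 hd
  rw [mem_row] at ha hb
  refine mem_row.2 ⟨Finset.add_mem_add ha.1 hb.1, ?_⟩
  rw [← ha.2, ← hb.2]
  simp

theorem row_nonempty {A : Finset ℤ} {z : ZMod n ⧸ K}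
    (hz : z ∈ (A.image ((↑) : ℤ → ZMod n)).image (QuotientAddGroup.mk : ZMod n → ZMod n ⧸ K)) :
    (row K A z).Nonempty := by
  obtain ⟨x, hx, rfl⟩ := Finset.mem_image.1 hz
  obtain ⟨a, ha, rfl⟩ := Finset.mem_image.1 hx
  exact ⟨a, mem_row.2 ⟨ha, rfl⟩⟩

theorem card_row_add_le {A B : Finset ℤ} (h0 : 0 ∈ B) (hn : (n : ℤ) ∈ B)
    (hK : ∀ g ∈ K, ∀ x ∈ (A + B).image ((↑) : ℤ → ZMod n),
      x + g ∈ (A + B).image ((↑) : ℤ → ZMod n)) {z : ZMod n ⧸ K}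
    (hz : z ∈ ((A + B).image ((↑) : ℤ → ZMod n)).image
      (QuotientAddGroup.mk : ZMod n → ZMod n ⧸ K)) :
    (row K A z).card + (toFin K).card ≤ (row K (A + B) z).card := by
  have h := card_add_card_residues_le (n := n) (C := row K A z) (D := row K (A + B) z)
    (Nat.pos_of_ne_zero (NeZero.ne n)) ?_ ?_
  · rwa [row_image_cast, card_filter_mk_eq K hK hz] at h
  · intro a ha
    rw [mem_row] at ha ⊢
    exact ⟨by simpa using Finset.add_mem_add ha.1 h0, ha.2⟩
  · intro a ha
    rw [mem_row] at ha ⊢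
    exact ⟨Finset.add_mem_add ha.1 hn, by simpa using ha.2⟩

end IntegerRows

section Induction

theorem exists_height_bound {G : Type*} [AddCommGroup G] [DecidableEq G] {Y T ζ Yl : Finset G}
    {x g : G → ℕ} {k E F : ℕ} (h0 : 0 ∈ T) (hEk : E ≤ k) (hx : ∀ z ∉ Y, x z = 0)
    (hg : ∀ z ∈ Y + T, x z + k ≤ g z) (hgx : ∀ j ∈ Y, ∀ t ∈ T, x j + k ≤ g (j + t) + E)
    (hsum : ∑ z ∈ Y + T, g z = ∑ z ∈ Y + T, x z + (Y + T).card * k + F)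
    (hYl : Yl ⊆ Y) (hne : Yl.Nonempty) (hlow : ∀ j ∈ Y, ∀ t ∈ T, j + t ∈ ζ → j ∈ Yl)
    (hW : ∀ W ⊆ Yl, W.Nonempty → W.card + 1 ≤ ((W + T) ∩ ζ).card) :
    ∃ xs, ∑ j ∈ Yl, x j + xs ≤ ∑ z ∈ ζ, g z ∧ ∑ j ∈ Yl, x j ≤ xs * Yl.card ∧
      xs ≤ F + E * (Yl.card + 1) := by
  obtain ⟨j, hj, hmax⟩ := Finset.exists_max_image Yl x hne
  refine ⟨x j, ?_, ?_, ?_⟩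
  · refine sum_add_le_sum_of_levels (fun τ hτ => (hW _ (Finset.filter_subset _ _) hτ).trans
      (Finset.card_le_card fun z hz => ?_)) hj
    obtain ⟨hz, hzζ⟩ := Finset.mem_inter.1 hz
    obtain ⟨i, hi, t, ht, rfl⟩ := Finset.mem_add.1 hz
    rw [Finset.mem_filter] at hi ⊢
    have := hgx i (hYl hi.1) t ht
    exact ⟨hzζ, by omega⟩
  · rw [mul_comm, ← smul_eq_mul]
    exact Finset.sum_le_card_nsmul _ _ _ hmax
  · have h1 : ∑ i ∈ Yl, (x i - E) + (x j - E) ≤ ∑ z ∈ ζ ∩ (Y + T), (g z - k) := by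
      refine sum_add_le_sum_of_levels (x := fun i => x i - E) (g := fun z => g z - k)
        (fun τ hτ => (hW _ (Finset.filter_subset _ _) hτ).trans
        (Finset.card_le_card fun z hz => ?_)) hj
      obtain ⟨hz, hzζ⟩ := Finset.mem_inter.1 hz
      obtain ⟨i, hi, t, ht, rfl⟩ := Finset.mem_add.1 hz
      rw [Finset.mem_filter] at hi ⊢
      have := hgx i (hYl hi.1) t ht
      exact ⟨Finset.mem_inter.2 ⟨hzζ, Finset.add_mem_add (hYl hi.1) ht⟩, by omega⟩
    have h2 : ∑ i ∈ Yl, x i ≤ ∑ i ∈ Yl, (x i - E) + Yl.card * E := by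
      rw [← smul_eq_mul, ← Finset.sum_const, ← Finset.sum_add_distrib]
      exact Finset.sum_le_sum fun i _ => by omega
    have h3 : ∑ z ∈ ζ ∩ (Y + T), x z ≤ ∑ i ∈ Yl, x i := by
      refine Finset.sum_le_sum_of_ne_zero fun z hz hxz => ?_
      have hzY : z ∈ Y := by
        by_contra hzY
        exact hxz (hx z hzY)
      exact hlow z hzY 0 h0 (by simpa using (Finset.mem_inter.1 hz).1)
    have h4 : ∑ z ∈ Y + T, (g z - k - x z) = F := by
      have : ∑ z ∈ Y + T, g z =
          ∑ z ∈ Y + T, x z + (Y + T).card * k + ∑ z ∈ Y + T, (g z - k - x z) := by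
        rw [← smul_eq_mul, ← Finset.sum_const, ← Finset.sum_add_distrib,
          ← Finset.sum_add_distrib]
        refine Finset.sum_congr rfl fun z hz => ?_
        have := hg z hz
        omega
      omega
    have h5 : ∑ z ∈ ζ ∩ (Y + T), (g z - k) ≤
        ∑ z ∈ ζ ∩ (Y + T), x z + ∑ z ∈ Y + T, (g z - k - x z) := by
      refine le_trans ?_ (Nat.add_le_add_left (Finset.sum_le_sum_of_subset
        (Finset.inter_subset_right (s₁ := ζ))) _)
      rw [← Finset.sum_add_distrib]
      exact Finset.sum_le_sum fun z _ => by omega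
    have h6 : E * (Yl.card + 1) = Yl.card * E + E := by ring
    omega

variable {n : ℕ} [NeZero n]

theorem card_toFin_closure_le (K : AddSubgroup (ZMod n)) [DecidableEq (ZMod n ⧸ K)]
    [Fintype (ZMod n ⧸ K)] (S : Finset (ZMod n)) :
    (toFin (AddSubgroup.closure (S : Set (ZMod n)))).card ≤ (toFin K).card *
      (toFin (AddSubgroup.closure ((S.image (QuotientAddGroup.mk : ZMod n → ZMod n ⧸ K) :
        Finset (ZMod n ⧸ K)) : Set (ZMod n ⧸ K)))).card := by
  refine (card_le_card_image_mk_mul K _).trans (Nat.mul_le_mul_left _ (Finset.card_le_card ?_))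
  intro z hz
  obtain ⟨x, hx, rfl⟩ := Finset.mem_image.1 hz
  rw [mem_toFin] at hx ⊢
  have hle : AddSubgroup.closure (S : Set (ZMod n)) ≤ (AddSubgroup.closure
      ((S.image (QuotientAddGroup.mk : ZMod n → ZMod n ⧸ K) : Finset (ZMod n ⧸ K)) :
        Set (ZMod n ⧸ K))).comap (QuotientAddGroup.mk' K) := by
    rw [AddSubgroup.closure_le]
    intro s hs
    exact AddSubgroup.subset_closure (Finset.mem_coe.2 (Finset.mem_image_of_mem _ hs))
  exact hle hx

theorem exists_gainBound {B : Finset ℤ} {β : ℕ} (h0 : 0 ∈ B) (hn : (n : ℤ) ∈ B)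
    (hβ : (B.image ((↑) : ℤ → ZMod n)).card = β + 1) (N : ℕ) : ∀ A : Finset ℤ, A.card = N →
    A.Nonempty → (A.image ((↑) : ℤ → ZMod n) + B.image ((↑) : ℤ → ZMod n)).card <
      (toFin (AddSubgroup.closure ((B.image ((↑) : ℤ → ZMod n) : Finset (ZMod n)) :
        Set (ZMod n)))).card →
    ∃ m, 1 ≤ m ∧ GainBound β A.card (A + B).card m := by
  classical
  induction N using Nat.strong_induction_on with
  | _ N ih =>
  intro A hAN hA hlt
  set A₀ := A.image ((↑) : ℤ → ZMod n) with hA₀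
  set B₀ := B.image ((↑) : ℤ → ZMod n) with hB₀
  have hB₀0 : (0 : ZMod n) ∈ B₀ := Finset.mem_image.2 ⟨0, h0, by simp⟩
  have hB₀ne : B₀.Nonempty := ⟨0, hB₀0⟩
  have hA₀ne : A₀.Nonempty := hA.image _
  have hapos := Finset.card_pos.2 hA₀ne
  have ih' : ∀ A' ⊆ A, A'.Nonempty → A'.card < A.card →
      ∃ m, 1 ≤ m ∧ GainBound β A'.card (A' + B).card m := by
    intro A' hsub hne hc
    refine ih _ (hAN ▸ hc) A' rfl hne (lt_of_le_of_lt (Finset.card_le_card ?_) hlt)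
    exact Finset.add_subset_add_right (Finset.image_subset_image hsub)
  have himg : (A + B).image ((↑) : ℤ → ZMod n) = A₀ + B₀ := image_cast_add A B
  set A' := A \ residueMin n A with hA'
  have hN' : A'.card + A₀.card = A.card := card_sdiff_residueMin A
  have hpeel : (A' + B).card + (A₀ + B₀).card ≤ (A + B).card := by
    rw [← himg]
    exact card_sdiff_residueMin_add_le A B
  have hsimple : A.card + (A₀ + B₀).card ≤ (A + B).card := by
    rw [← himg]
    refine card_add_card_residues_le (Nat.pos_of_ne_zero (NeZero.ne n)) (fun a ha => ?_)
      fun a ha => Finset.add_mem_add ha hn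
    simpa using Finset.add_mem_add ha h0
  by_cases hgood : A₀.card + β ≤ (A₀ + B₀).card
  · rcases Finset.eq_empty_or_nonempty A' with he | hne
    · rw [he, Finset.card_empty] at hN'
      exact ⟨1, le_rfl, GainBound.one_of_le (by omega)⟩
    · obtain ⟨m, hm, hgb⟩ := ih' A' Finset.sdiff_subset hne (by omega)
      refine ⟨m + 1, by omega, ?_⟩
      rw [← hN']
      exact hgb.add_row (by omega) (by omega)
  push Not at hgood
  set K := period (A₀ + B₀) with hK
  have hKS : ∀ g ∈ K, ∀ x ∈ A₀ + B₀, x + g ∈ A₀ + B₀ := add_mem_of_mem_period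
  set Y := A₀.image (QuotientAddGroup.mk : ZMod n → ZMod n ⧸ K) with hY
  set T := B₀.image (QuotientAddGroup.mk : ZMod n → ZMod n ⧸ K) with hT
  have hYT : (A₀ + B₀).image (QuotientAddGroup.mk : ZMod n → ZMod n ⧸ K) = Y + T :=
    image_mk_add K A₀ B₀
  set k := (toFin K).card with hk
  have hkpos : 0 < k := toFin_card_pos K
  have hσ : (A₀ + B₀).card = k * (Y + T).card := by
    rw [← hYT]
    exact card_add_toFin_eq K _ hKS
  have hkn : Y.card + T.card ≤ (Y + T).card + 1 := card_image_mk_add_card_image_mk_le hA₀ne hB₀ne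
  have hY_le : A₀.card ≤ k * Y.card := card_le_card_image_mk_mul K A₀
  have hT_le : B₀.card ≤ k * T.card := card_le_card_image_mk_mul K B₀
  have hTne : T.Nonempty := hB₀ne.image _
  have hYne : Y.Nonempty := hA₀ne.image _
  have hT0 : (0 : ZMod n ⧸ K) ∈ T := Finset.mem_image.2 ⟨0, hB₀0, rfl⟩
  have hYYT : Y ⊆ Y + T := fun y hy => by simpa using Finset.add_mem_add hy hT0
  have hexact : (Y + T).card + 1 = Y.card + T.card := by
    refine le_antisymm ?_ hkn
    by_contra hcon
    have := Nat.mul_le_mul_left k (show Y.card + T.card ≤ (Y + T).card by omega)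
    rw [← hσ, mul_add] at this
    omega
  obtain ⟨ρ, hρ⟩ := Nat.exists_eq_add_of_le hY_le
  obtain ⟨ε, hε⟩ := Nat.exists_eq_add_of_le hT_le
  obtain ⟨η, hη⟩ := Nat.exists_eq_add_of_le hgood.le
  have hkeq : k = ε + 1 + η + ρ := by
    have : k * ((Y + T).card + 1) = k * (Y.card + T.card) := by rw [hexact]
    rw [mul_add, mul_add, ← hσ, hρ, hε, hβ] at this
    omega
  have hβE : β + (ε + 1) = T.card * k := by
    rw [mul_comm, hε, hβ]
    omega
  have hcl : (Y + T).card <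
      (toFin (AddSubgroup.closure (T : Set (ZMod n ⧸ K)))).card := by
    refine Nat.lt_of_mul_lt_mul_left (a := k) ?_
    rw [← hσ]
    exact hlt.trans_le (card_toFin_closure_le K B₀)
  have hu2 : 2 ≤ T.card := by
    by_contra hu
    have hT1 : T = {0} := by
      refine (Finset.eq_of_subset_of_card_le (Finset.singleton_subset_iff.2 hT0) ?_).symm
      rw [Finset.card_singleton]
      omega
    have : (toFin (AddSubgroup.closure (T : Set (ZMod n ⧸ K)))).card ≤ 1 := by
      rw [Finset.card_le_one]
      intro a ha b hb
      rw [mem_toFin, hT1, Finset.coe_singleton, AddSubgroup.closure_singleton_zero,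
        AddSubgroup.mem_bot] at ha hb
      rw [ha, hb]
    have := Finset.card_pos.2 (hYne.mono hYYT)
    omega
  have hg : ∀ z ∈ Y + T, (row K A z).card + k ≤ (row K (A + B) z).card := by
    intro z hz
    refine card_row_add_le h0 hn ?_ ?_
    · rw [himg]
      exact hKS
    · rw [himg, hYT]
      exact hz
  have hgx : ∀ j ∈ Y, ∀ t ∈ T,
      (row K A j).card + k ≤ (row K (A + B) (j + t)).card + (ε + 1) := by
    intro j hj t ht
    have h1 := Finset.card_le_card (row_add_row_subset A B j t)
    have h2 := card_add_le_card_add_int (row_nonempty hj) (row_nonempty ht)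
    have h3 := card_filter_mk_le_card_row B t
    have h4 := card_add_le_card_filter_mk_add K B₀ ht
    rw [← hT, ← hk, hε] at h4
    rw [← hB₀] at h3
    omega
  have hxY : ∀ j ∈ Y, ε + 1 + η ≤ (row K A j).card := by
    intro j hj
    have h3 := card_filter_mk_le_card_row A j
    have h4 := card_add_le_card_filter_mk_add K A₀ hj
    rw [← hY, ← hk, hρ] at h4
    rw [← hA₀] at h3
    omega
  have hx0 : ∀ z ∉ Y, (row K A z).card = 0 := by
    intro z hz
    rw [Finset.card_eq_zero, Finset.eq_empty_iff_forall_notMem]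
    intro a ha
    rw [mem_row] at ha
    exact hz (ha.2 ▸ Finset.mem_image_of_mem _ (Finset.mem_image_of_mem _ ha.1))
  have hsumY : ∑ j ∈ Y, (row K A j).card = A.card := sum_card_row subset_rfl
  have hsumYT : ∑ j ∈ Y + T, (row K A j).card = A.card := sum_card_row hYYT
  have hsumg : ∑ z ∈ Y + T, (row K (A + B) z).card = (A + B).card :=
    sum_card_row (by rw [himg, hYT])
  by_cases hfr : ∀ X ⊆ Y, X.Nonempty → X.card + (T.card - 1) ≤ (X + T).card
  · rw [← hsumY, ← hsumg]
    exact exists_gainBound_of_expansion hYne hT0 (by omega) (by omega)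
      (by rw [hβE, Nat.sub_add_cancel (by omega)]) hfr hg hgx
  push Not at hfr
  obtain ⟨X₀, hX₀Y, hX₀, hX₀lt⟩ := hfr
  obtain ⟨L, κ, hLT, hLκ, hL2, hκT, hLlt, hfrag⟩ := exists_subgroup_fragment hT0 hX₀
    ((Finset.card_le_card (Finset.add_subset_add_right hX₀Y)).trans_lt hcl) (by omega)
  obtain ⟨F, hF⟩ := Nat.exists_eq_add_of_le hsimple
  have hFη : (T.card - 1) * η ≤ F := by
    have h1 : ∑ z ∈ Y + T, ((row K A z).card + k) + ∑ z ∈ (Y + T) \ Y, η ≤ (A + B).card := by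
      rw [← hsumg, ← Finset.sum_sdiff hYYT, ← Finset.sum_sdiff hYYT, add_right_comm,
        ← Finset.sum_add_distrib]
      refine Nat.add_le_add (Finset.sum_le_sum fun z hz => ?_)
        (Finset.sum_le_sum fun z hz => hg z (hYYT hz))
      obtain ⟨hz1, hz2⟩ := Finset.mem_sdiff.1 hz
      obtain ⟨j, hj, t, ht, rfl⟩ := Finset.mem_add.1 hz1
      have h2 := hgx j hj t ht
      have h3 := hxY j hj
      have h4 := hx0 _ hz2
      omega
    rw [Finset.sum_add_distrib, hsumYT, Finset.sum_const, Finset.sum_const, smul_eq_mul,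
      smul_eq_mul, Finset.card_sdiff_of_subset hYYT, mul_comm _ k, ← hσ, hF] at h1
    have h2 : (Y + T).card - Y.card = T.card - 1 := by omega
    rw [h2] at h1
    omega
  rcases Finset.eq_empty_or_nonempty A' with he | hne
  · rw [he, Finset.card_empty] at hN'
    have : 1 * η ≤ (T.card - 1) * η := Nat.mul_le_mul_right η (by omega)
    exact ⟨1, le_rfl, GainBound.one_of_le (by omega)⟩
  have hex := ih' A' Finset.sdiff_subset hne (by omega)
  obtain ⟨hm, hgb⟩ := Nat.find_spec hex
  have hmin : ∀ m' < Nat.find hex, ¬ (1 ≤ m' ∧ GainBound β A'.card (A' + B).card m') :=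
    fun m' h => Nat.find_min hex h
  set m := Nat.find hex with hm_def
  clear_value m
  have hmN' : m * (m - 1) * β ≤ 2 * A'.card := by
    obtain ⟨m, rfl⟩ := Nat.exists_eq_add_of_le' hm
    rcases m with _ | m
    · simp
    · refine hgb.le_of_not_pred fun h => hmin (m + 1) (by omega) ⟨by omega, h⟩
  by_cases hnext : GainBound β A.card (A + B).card (m + 1)
  · exact ⟨m + 1, by omega, hnext⟩
  rw [← hN'] at hnext hF
  have hFlt : F < (m + 1) * η :=
    hgb.excess_lt (σ := (A₀ + B₀).card) (a := A₀.card) (by omega) hpeel hF hnext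
  have hum : T.card ≤ m + 1 := by
    have := Nat.lt_of_mul_lt_mul_right (hFη.trans_lt hFlt)
    omega
  have hper : ¬ L ≤ period (Y + T) := by
    have hbot0 : period (Y + T) = ⊥ := by
      rw [← hYT]
      exact period_image_mk_eq_bot
    rw [hbot0]
    intro hbot
    have : (toFin L).card ≤ 1 := by
      rw [Finset.card_le_one]
      intro a ha b hb
      rw [(AddSubgroup.mem_bot.1 (hbot (mem_toFin.1 ha))),
        (AddSubgroup.mem_bot.1 (hbot (mem_toFin.1 hb)))]
    omega
  obtain ⟨ζ, Yl, hYl, hYlne, hYlc, hlow, hW⟩ := exists_coset_avoiding hLT hLlt hfrag hper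
  obtain ⟨xs, hxs1, hxs2, hxs3⟩ := exists_height_bound (x := fun z => (row K A z).card)
    (g := fun z => (row K (A + B) z).card) (F := F) hT0 (by omega : ε + 1 ≤ k) hx0 hg hgx
    (by rw [hsumg, hsumYT, mul_comm, ← hσ, hF, hN']) hYl hYlne hlow hW
  have hYlpos := Finset.card_pos.2 hYlne
  obtain ⟨p, hp⟩ := Nat.exists_eq_add_of_le' hL2
  set Nl := ∑ j ∈ Yl, (row K A j).card with hNl_def
  set Ao := A.filter (fun a : ℤ => ((a : ZMod n) : ZMod n ⧸ K) ∉ Yl) with hAo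
  have hrest : A.card = Ao.card + Nl := by
    rw [← Finset.card_filter_add_card_filter_not (s := A)
      (fun a : ℤ => ((a : ZMod n) : ZMod n ⧸ K) ∉ Yl), hAo]
    congr 1
    rw [hNl_def, Finset.card_eq_sum_card_fiberwise
      (f := fun a : ℤ => ((a : ZMod n) : ZMod n ⧸ K)) (t := Yl)
      (fun a ha => by simpa using (Finset.mem_filter.1 ha).2)]
    refine Finset.sum_congr rfl fun j hj => congrArg Finset.card ?_
    ext a
    simp only [Finset.mem_filter, mem_row, not_not]
    constructor
    · rintro ⟨⟨h1, -⟩, h2⟩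
      exact ⟨h1, h2⟩
    · rintro ⟨h1, rfl⟩
      exact ⟨⟨h1, hj⟩, rfl⟩
  have hsumset : (Ao + B).card + Nl + xs ≤ (A + B).card := by
    have h1 : ∑ z ∈ ζ, (row K (A + B) z).card =
        ((A + B).filter (fun a : ℤ => ((a : ZMod n) : ZMod n ⧸ K) ∈ ζ)).card := by
      rw [Finset.card_eq_sum_card_fiberwise
        (s := (A + B).filter (fun a : ℤ => ((a : ZMod n) : ZMod n ⧸ K) ∈ ζ))
        (f := fun a : ℤ => ((a : ZMod n) : ZMod n ⧸ K)) (t := ζ)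
        (fun a ha => Finset.mem_coe.2 (Finset.mem_filter.1 (Finset.mem_coe.1 ha)).2)]
      refine Finset.sum_congr rfl fun j hj => congrArg Finset.card ?_
      ext a
      simp only [Finset.mem_filter, mem_row]
      constructor
      · rintro ⟨h1, rfl⟩
        exact ⟨⟨h1, hj⟩, rfl⟩
      · rintro ⟨⟨h1, -⟩, h2⟩
        exact ⟨h1, h2⟩
    have h2 : Disjoint (Ao + B)
        ((A + B).filter (fun a : ℤ => ((a : ZMod n) : ZMod n ⧸ K) ∈ ζ)) := by
      rw [Finset.disjoint_left]
      intro d hd hd'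
      obtain ⟨a, ha, b, hb, rfl⟩ := Finset.mem_add.1 hd
      obtain ⟨haA, haY⟩ := Finset.mem_filter.1 ha
      refine haY (hlow _ (Finset.mem_image_of_mem _ (Finset.mem_image_of_mem _ haA)) _
        (Finset.mem_image_of_mem _ (Finset.mem_image_of_mem _ hb)) ?_)
      simpa using (Finset.mem_filter.1 hd').2
    have h3 := Finset.card_le_card (Finset.union_subset
      (Finset.add_subset_add_right (Finset.filter_subset _ A) : Ao + B ⊆ A + B)
      (Finset.filter_subset (fun a : ℤ => ((a : ZMod n) : ZMod n ⧸ K) ∈ ζ) (A + B)))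
    rw [Finset.card_union_of_disjoint h2, ← h1] at h3
    omega
  have hNlp : Nl ≤ xs * p := hxs2.trans (Nat.mul_le_mul_left _ (by omega))
  have hxsF : xs ≤ F + (ε + 1) * (p + 1) :=
    hxs3.trans (Nat.add_le_add_left (Nat.mul_le_mul_left _ (by omega)) _)
  have hNlpos : 1 ≤ Nl := by
    obtain ⟨j, hj⟩ := hYlne
    have h1 := hxY j (hYl hj)
    have h2 : (row K A j).card ≤ Nl :=
      Finset.single_le_sum (f := fun j => (row K A j).card) (fun _ _ => Nat.zero_le _) hj
    omega
  obtain ⟨hNo, hNopos⟩ := GainBound.large_rest (k := k) (p := p) (a := A₀.card) (by omega) hβE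
    (by omega) (by omega) hum hFlt.le hxsF hNlp hmN' (hN'.trans hrest) hapos
  obtain ⟨m₀, hm₀, hgb₀⟩ := ih' Ao (Finset.filter_subset _ _) (Finset.card_pos.1 hNopos) (by omega)
  rw [hrest]
  exact hgb₀.insert_low hm₀ (by omega) hsumset hNlp hNo

end Induction

/-- The residues modulo `n` of `B ⊆ [0, n]` lie in a subgroup of order `h`, so `B` is contained
in a progression of size `h + 1`. -/
theorem exists_subset_progression {n : ℕ} [NeZero n] {B : Finset ℤ}
    (hB : ∀ b ∈ B, 0 ≤ b ∧ b ≤ n) (K : AddSubgroup (ZMod n))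
    (hK : ∀ b ∈ B, (b : ZMod n) ∈ K) :
    ∃ q : ℤ, q ≠ 0 ∧ ∀ b ∈ B, ∃ i < (toFin K).card + 1, b = q * (i : ℕ) := by
  set h := (toFin K).card with hh
  have hpos : 0 < h := toFin_card_pos K
  have hcard : Nat.card K = h := by
    rw [hh, ← Nat.card_eq_finsetCard]
    exact Nat.card_congr (Equiv.subtypeEquivRight fun x => mem_toFin.symm)
  have hdvd : h ∣ n := by
    simpa only [hcard, Nat.card_zmod] using AddSubgroup.card_addSubgroup_dvd_card K
  obtain ⟨q, hq⟩ := hdvd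
  have hn := NeZero.ne n
  have hq0 : q ≠ 0 := by
    rintro rfl
    exact hn (by simpa using hq)
  refine ⟨q, by exact_mod_cast hq0, fun b hb => ?_⟩
  obtain ⟨hb0, hbn⟩ := hB b hb
  have hz : h • (b : ZMod n) = 0 := by
    have := card_nsmul_eq_zero' (G := K) (x := ⟨_, hK b hb⟩)
    rw [hcard] at this
    exact congrArg Subtype.val this
  have hz' : ((h * b : ℤ) : ZMod n) = 0 := by
    rw [nsmul_eq_mul] at hz
    exact_mod_cast hz
  rw [ZMod.intCast_zmod_eq_zero_iff_dvd, hq, Nat.cast_mul] at hz'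
  obtain ⟨i, rfl⟩ := Int.dvd_of_mul_dvd_mul_left (by exact_mod_cast hpos.ne') hz'
  have hqpos : (0 : ℤ) < q := by exact_mod_cast Nat.pos_of_ne_zero hq0
  have hi0 : 0 ≤ i := nonneg_of_mul_nonneg_right hb0 hqpos
  lift i to ℕ using hi0
  refine ⟨i, ?_, rfl⟩
  rw [hq, Nat.cast_mul, mul_comm (h : ℤ)] at hbn
  have := le_of_mul_le_mul_left hbn hqpos
  omega

theorem card_image_cast_of_endpoints {n : ℕ} [NeZero n] {B : Finset ℤ} (h0 : 0 ∈ B)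
    (hn : (n : ℤ) ∈ B) (hB : ∀ b ∈ B, 0 ≤ b ∧ b ≤ n) :
    (B.image ((↑) : ℤ → ZMod n)).card + 1 = B.card := by
  have hpos := Nat.pos_of_ne_zero (NeZero.ne n)
  have himg : B.image ((↑) : ℤ → ZMod n) = (B.erase n).image ((↑) : ℤ → ZMod n) := by
    conv_lhs => rw [← Finset.insert_erase hn]
    rw [Finset.image_insert, Finset.insert_eq_of_mem]
    exact Finset.mem_image.2 ⟨0, Finset.mem_erase.2 ⟨by omega, h0⟩, by simp⟩
  rw [himg, Finset.card_image_of_injOn, Finset.card_erase_add_one hn]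
  intro x hx y hy hxy
  rw [Finset.mem_coe, Finset.mem_erase] at hx hy
  have hx' := hB x hx.2
  have hy' := hB y hy.2
  have := (ZMod.intCast_eq_intCast_iff' x y n).1 hxy
  rwa [Int.emod_eq_of_lt (by omega) (by omega), Int.emod_eq_of_lt (by omega) (by omega)] at this

theorem le_card_add_of_not_progression {A B : Finset ℤ} (hA : A.Nonempty) {n s β : ℕ} [NeZero n]
    (h0 : 0 ∈ B) (hn : (n : ℤ) ∈ B) (hB : ∀ b ∈ B, 0 ≤ b ∧ b ≤ n) (hβ : B.card = β + 2)
    (hβ1 : 1 ≤ β) (hs : 1 ≤ s) (hcard : s * (s - 1) * β + 2 * s ≤ 2 * A.card)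
    (hnotAP : ∀ (q : ℤ) (m : ℕ), q ≠ 0 → m + A.card ≤ (A + B).card + 1 →
      ¬ ∀ b ∈ B, ∃ i < m, b = q * (i : ℕ)) :
    A.card + s * β + 1 ≤ (A + B).card := by
  have hβ' := card_image_cast_of_endpoints h0 hn hB
  have hsimple : A.card + (A.image ((↑) : ℤ → ZMod n) + B.image ((↑) : ℤ → ZMod n)).card ≤
      (A + B).card := by
    rw [← image_cast_add A B]
    refine card_add_card_residues_le (Nat.pos_of_ne_zero (NeZero.ne n)) (fun a ha => ?_)
      fun a ha => Finset.add_mem_add ha hn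
    simpa using Finset.add_mem_add ha h0
  obtain ⟨q, hq, hqB⟩ := exists_subset_progression hB
    (AddSubgroup.closure ((B.image ((↑) : ℤ → ZMod n) : Finset (ZMod n)) : Set (ZMod n)))
    fun b hb => AddSubgroup.subset_closure (Finset.mem_coe.2 (Finset.mem_image_of_mem _ hb))
  have hlt := not_le.1 fun h => hnotAP q _ hq h hqB
  obtain ⟨m, hm, hgb⟩ := exists_gainBound h0 hn (β := β) (by omega) A.card A rfl hA (by omega)
  exact hgb.card_le hβ1 hm hs hcard

end Grynkiewicz

/-- Proposition 3.1 (`corG`, after Grynkiewicz): if `B` is not contained in an arithmetic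
progression of size at most `|A+B| - |A| + 1`, then `|A+B| ≥ |A| + s'(|B| - 2) + 1`. -/
theorem grynkiewicz_consequence (A B : Finset ℤ) (hA : A.Nonempty) (hB : 3 ≤ B.card)
    (s' : ℕ) (hs' : 1 ≤ s')
    (hcard : s' * (s' - 1) * (B.card - 2) + 2 * s' ≤ 2 * A.card)
    (hnotAP : ¬ ∃ (a q : ℤ) (m : ℕ), q ≠ 0 ∧
      (m : ℤ) ≤ ((A + B).card : ℤ) - (A.card : ℤ) + 1 ∧
      B ⊆ (Finset.range m).image (fun i : ℕ => a + q * (i : ℤ))) :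
    A.card + s' * (B.card - 2) + 1 ≤ (A + B).card := by
  have hBne : B.Nonempty := Finset.card_pos.1 (by omega)
  have hmin := B.min'_mem hBne
  have hle : ∀ b ∈ B, B.min' hBne ≤ b := fun b hb => B.min'_le b hb
  have hge : ∀ b ∈ B, b ≤ B.max' hBne := fun b hb => B.le_max' b hb
  have hmax := B.max'_mem hBne
  have hlt := Finset.min'_lt_max'_of_card B (by omega)
  set c := B.min' hBne
  set d := B.max' hBne
  clear_value c d
  obtain ⟨n, hn⟩ := Int.eq_ofNat_of_zero_le (sub_nonneg.2 hlt.le)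
  have : NeZero n := ⟨by omega⟩
  have hcB : (-c +ᵥ B).card = B.card := Finset.card_vadd_finset _ _
  have hAB : (A + (-c +ᵥ B)).card = (A + B).card := by
    rw [add_vadd_comm, Finset.card_vadd_finset]
  have hmem : ∀ b, b ∈ -c +ᵥ B ↔ b + c ∈ B := fun b => by
    rw [Finset.mem_vadd_finset]
    constructor
    · rintro ⟨x, hx, rfl⟩
      simpa [vadd_eq_add] using hx
    · exact fun h => ⟨_, h, by simp [vadd_eq_add]⟩
  rw [← hAB]
  refine Grynkiewicz.le_card_add_of_not_progression (n := n) hA ((hmem _).2 (by simpa using hmin))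
    ((hmem _).2 (by rw [← hn]; simpa using hmax)) (fun b hb => ?_) (by omega) (by omega) hs' hcard
    fun q m hq hm hAP => hnotAP ⟨c, q, m, hq, by omega, fun b hb => ?_⟩
  · have h1 := hle _ ((hmem b).1 hb)
    have h2 := hge _ ((hmem b).1 hb)
    omega
  · obtain ⟨i, hi, hbi⟩ := hAP (b - c) ((hmem _).2 (by simpa using hb))
    exact Finset.mem_image.2 ⟨i, Finset.mem_range.2 hi, by omega⟩
end
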